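/- arXiv:2210.17006 — 3 statements merged into one kernel-verified Lean document; each statement's English description precedes it below -/
import Mathlib

section
/- Let t > 0 be a real number and let G be a t-tough graph on n ≥ 3 vertices. If σ₂(G) > 2n/(t+1) − 2, then G is hamiltonian. -/
open SimpleGraph

/-- The number of connected components of `G − S`, the subgraph of `G` induced on the
complement of the vertex set `S`. -/
noncomputable def numComp {V : Type*} (G : SimpleGraph V) (S : Set V) : ℕ :=
  Nat.card (G.induce Sᶜ).ConnectedComponent

/-- A graph `G` is `t`-tough if `|S| ≥ t · c(G − S)` for every vertex set `S` whose removal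
leaves at least two components. -/
def Tough {V : Type*} [Fintype V] (t : ℝ) (G : SimpleGraph V) : Prop :=
  ∀ S : Finset V, 2 ≤ numComp G (S : Set V) →
    t * (numComp G (S : Set V) : ℝ) ≤ (S.card : ℝ)

section PathsOnSets

variable {V : Type*} {G : SimpleGraph V}

/-- There is a path of `G` from `u` to `v` whose vertex set is exactly `S`. -/
def PathOn (G : SimpleGraph V) (u v : V) (S : Finset V) : Prop :=
  ∃ p : G.Walk u v, p.IsPath ∧ ∀ x, x ∈ p.support ↔ x ∈ S

/-- `S` is the vertex set of a cycle of `G`, where an edge counts as a cycle of length two. -/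
def CycleOn (G : SimpleGraph V) (S : Finset V) : Prop :=
  ∃ u v, PathOn G u v S ∧ G.Adj v u

/-- `X` is nonempty and induces a connected subgraph of `G`. -/
def ConnOn (G : SimpleGraph V) (X : Finset V) : Prop :=
  X.Nonempty ∧ ∀ x ∈ X, ∀ y ∈ X, ∃ p : G.Walk x y, ∀ z ∈ p.support, z ∈ X

/-- `a` and `b` are adjacent or joined by a walk with all inner vertices in `R`. -/
def LinkVia (G : SimpleGraph V) (R : Finset V) (a b : V) : Prop :=
  G.Adj a b ∨ ∃ c d, ∃ p : G.Walk c d, G.Adj a c ∧ G.Adj d b ∧ ∀ z ∈ p.support, z ∈ R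

lemma pathOn_singleton (u : V) : PathOn G u u {u} :=
  ⟨Walk.nil, Walk.IsPath.nil, by simp⟩

lemma PathOn.symm {u v : V} {S : Finset V} (h : PathOn G u v S) : PathOn G v u S := by
  obtain ⟨p, hp, hS⟩ := h
  exact ⟨p.reverse, hp.reverse, by simpa using hS⟩

lemma PathOn.left_mem {u v : V} {S : Finset V} (h : PathOn G u v S) : u ∈ S := by
  obtain ⟨p, -, hS⟩ := h
  exact (hS u).1 p.start_mem_support

lemma PathOn.trans_adj [DecidableEq V] {u a b w : V} {S T : Finset V} (h₁ : PathOn G u a S)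
    (hab : G.Adj a b) (h₂ : PathOn G b w T) (hST : Disjoint S T) : PathOn G u w (S ∪ T) := by
  obtain ⟨p, hp, hS⟩ := h₁
  obtain ⟨q, hq, hT⟩ := h₂
  have hsupp : (p.append (Walk.cons hab q)).support = p.support ++ q.support := by
    simp [Walk.support_append]
  refine ⟨p.append (Walk.cons hab q), Walk.IsPath.mk' ?_, fun x => ?_⟩
  · rw [hsupp, List.nodup_append]
    refine ⟨hp.support_nodup, hq.support_nodup, fun x hx y hy hxy => ?_⟩
    subst hxy
    exact Finset.disjoint_left.1 hST ((hS x).1 hx) ((hT x).1 hy)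
  · rw [hsupp, List.mem_append, hS, hT, Finset.mem_union]

lemma exists_pathOn_of_walk [DecidableEq V] {u v : V} {R : Finset V} (p : G.Walk u v)
    (hp : ∀ z ∈ p.support, z ∈ R) : ∃ S ⊆ R, PathOn G u v S :=
  ⟨p.bypass.support.toFinset,
    fun _ hz => hp _ (p.support_bypass_subset_support (List.mem_toFinset.1 hz)),
    p.bypass, p.bypass_isPath, by simp⟩

lemma PathOn.trans_walk [DecidableEq V] {u a c d b w : V} {S R T : Finset V}
    (h₁ : PathOn G u a S) (hac : G.Adj a c) (p : G.Walk c d) (hp : ∀ z ∈ p.support, z ∈ R)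
    (hdb : G.Adj d b) (h₂ : PathOn G b w T) (hSR : Disjoint S R) (hRT : Disjoint R T)
    (hST : Disjoint S T) : ∃ P ⊆ R, P.Nonempty ∧ PathOn G u w (S ∪ P ∪ T) := by
  obtain ⟨P, hPR, hP⟩ := exists_pathOn_of_walk p hp
  refine ⟨P, hPR, ⟨c, hP.left_mem⟩, (h₁.trans_adj hac hP ?_).trans_adj hdb h₂ ?_⟩
  · exact hSR.mono_right hPR
  · exact Finset.disjoint_union_left.2 ⟨hST, hRT.mono_left hPR⟩

lemma PathOn.close_walk [DecidableEq V] {u w c d : V} {S R : Finset V} (h : PathOn G u w S)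
    (hwc : G.Adj w c) (p : G.Walk c d) (hp : ∀ z ∈ p.support, z ∈ R) (hdu : G.Adj d u)
    (hSR : Disjoint S R) : ∃ P ⊆ R, P.Nonempty ∧ CycleOn G (S ∪ P) := by
  obtain ⟨P, hPR, hP⟩ := exists_pathOn_of_walk p hp
  exact ⟨P, hPR, ⟨c, hP.left_mem⟩, u, d, h.trans_adj hwc hP (hSR.mono_right hPR), hdu⟩

lemma PathOn.close_link [DecidableEq V] {u w : V} {S R : Finset V} (h : PathOn G u w S)
    (hl : LinkVia G R w u) (hSR : Disjoint S R) : ∃ Q ⊆ R, CycleOn G (S ∪ Q) := by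
  rcases hl with hwu | ⟨c, d, p, hwc, hdu, hp⟩
  · exact ⟨∅, Finset.empty_subset _, u, w, by simpa using h, hwu⟩
  · obtain ⟨P, hPR, -, hP⟩ := h.close_walk hwc p hp hdu hSR
    exact ⟨P, hPR, hP⟩

lemma LinkVia.symm {R : Finset V} {a b : V} (h : LinkVia G R a b) : LinkVia G R b a := by
  rcases h with h | ⟨c, d, p, hac, hdb, hp⟩
  · exact Or.inl h.symm
  · exact Or.inr ⟨d, c, p.reverse, hdb.symm, hac.symm, by simpa using hp⟩

lemma connOn_singleton (x : V) : ConnOn G {x} := by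
  refine ⟨⟨x, Finset.mem_singleton_self x⟩, fun a ha b hb => ?_⟩
  rw [Finset.mem_singleton] at ha hb
  subst ha hb
  exact ⟨Walk.nil, by simp⟩

lemma ConnOn.union_adj [DecidableEq V] {X Y : Finset V} (hX : ConnOn G X) (hY : ConnOn G Y)
    {x y : V} (hx : x ∈ X) (hy : y ∈ Y) (hxy : G.Adj x y) : ConnOn G (X ∪ Y) := by
  refine ⟨hX.1.mono Finset.subset_union_left, fun a ha b hb => ?_⟩
  have key : ∀ a ∈ X, ∀ b ∈ Y, ∃ p : G.Walk a b, ∀ z ∈ p.support, z ∈ X ∪ Y := by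
    intro a ha b hb
    obtain ⟨p, hp⟩ := hX.2 a ha x hx
    obtain ⟨q, hq⟩ := hY.2 y hy b hb
    refine ⟨p.append (Walk.cons hxy q), fun z hz => ?_⟩
    rw [Walk.mem_support_append_iff, Walk.support_cons, List.mem_cons] at hz
    rcases hz with hz | rfl | hz
    · exact Finset.mem_union_left _ (hp z hz)
    · exact Finset.mem_union_left _ hx
    · exact Finset.mem_union_right _ (hq z hz)
  rcases Finset.mem_union.1 ha with ha | ha <;> rcases Finset.mem_union.1 hb with hb | hb
  · obtain ⟨p, hp⟩ := hX.2 a ha b hb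
    exact ⟨p, fun z hz => Finset.mem_union_left _ (hp z hz)⟩
  · exact key a ha b hb
  · obtain ⟨p, hp⟩ := key b hb a ha
    exact ⟨p.reverse, by simpa using hp⟩
  · obtain ⟨p, hp⟩ := hY.2 a ha b hb
    exact ⟨p, fun z hz => Finset.mem_union_right _ (hp z hz)⟩

lemma ConnOn.union_inter [DecidableEq V] {X Y : Finset V} (hX : ConnOn G X) (hY : ConnOn G Y)
    {x : V} (hx : x ∈ X) (hy : x ∈ Y) : ConnOn G (X ∪ Y) := by
  refine ⟨hX.1.mono Finset.subset_union_left, fun a ha b hb => ?_⟩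
  have key : ∀ a ∈ X ∪ Y, ∃ p : G.Walk a x, ∀ z ∈ p.support, z ∈ X ∪ Y := by
    intro a ha
    rcases Finset.mem_union.1 ha with ha | ha
    · obtain ⟨p, hp⟩ := hX.2 a ha x hx
      exact ⟨p, fun z hz => Finset.mem_union_left _ (hp z hz)⟩
    · obtain ⟨p, hp⟩ := hY.2 a ha x hy
      exact ⟨p, fun z hz => Finset.mem_union_right _ (hp z hz)⟩
  obtain ⟨p, hp⟩ := key a ha
  obtain ⟨q, hq⟩ := key b hb
  refine ⟨p.append q.reverse, fun z hz => ?_⟩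
  rw [Walk.mem_support_append_iff, Walk.support_reverse, List.mem_reverse] at hz
  exact hz.elim (hp z) (hq z)

/-- A connected set meeting `W` avoids `U` if it lies in `U ∪ W` and no edge joins `U` to `W`. -/
lemma ConnOn.notMem_of_separated {X : Finset V} (hX : ConnOn G X) {P Q : V → Prop}
    (hPQ : ∀ x ∈ X, P x ∨ Q x) (hsep : ∀ x ∈ X, ∀ y ∈ X, Q x → G.Adj x y → ¬ P y)
    {w : V} (hw : w ∈ X) (hwQ : Q w) (hdis : ∀ x, P x → ¬ Q x) {x : V} (hx : x ∈ X) : ¬ P x := by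
  have aux : ∀ (a b : V) (p : G.Walk a b), (∀ z ∈ p.support, z ∈ X) → Q a → Q b := by
    intro a b p
    induction p with
    | nil => exact fun _ h => h
    | @cons a c b hac p ih =>
      intro hp ha
      have hc : c ∈ X := hp c (by simp)
      exact ih (fun z hz => hp z (by simp [hz]))
        ((hPQ c hc).resolve_left (hsep a (hp a (by simp)) c hc ha hac))
  obtain ⟨p, hp⟩ := hX.2 w hw x hx
  exact fun h => hdis x h (aux w x p hp hwQ)

/-- A connected subset of `R ∪ A ∪ B` meeting both `A` and `B` contains a link from `A` to `B`. -/
lemma ConnOn.exists_linkVia {X R A B : Finset V} (hX : ConnOn G X)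
    (hsub : ∀ x ∈ X, x ∈ R ∨ x ∈ A ∨ x ∈ B) {a b : V} (haX : a ∈ X) (haA : a ∈ A) (hbX : b ∈ X)
    (hbB : b ∈ B) (hAB : ∀ x ∈ A, x ∉ B) : ∃ a' ∈ A, ∃ b' ∈ B, LinkVia G R a' b' := by
  have aux : ∀ (u w : V) (p : G.Walk u w), (∀ z ∈ p.support, z ∈ X) → w ∈ B →
      (∃ a' ∈ A, ∃ b' ∈ B, LinkVia G R a' b') ∨ u ∈ B ∨ ∃ b' ∈ B, LinkVia G R u b' := by
    intro u w p
    induction p with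
    | nil => exact fun _ h => Or.inr (Or.inl h)
    | @cons u c w huc p ih =>
      intro hp hw
      rcases ih (fun z hz => hp z (by simp [hz])) hw with h | h | ⟨b', hb', h⟩
      · exact Or.inl h
      · exact Or.inr (Or.inr ⟨c, h, Or.inl huc⟩)
      · rcases hsub c (hp c (by simp)) with hc | hc | hc
        · refine Or.inr (Or.inr ⟨b', hb', Or.inr ?_⟩)
          rcases h with h | ⟨d, e, q, hcd, heb, hq⟩
          · exact ⟨c, c, Walk.nil, huc, h, by simpa using hc⟩
          · refine ⟨c, e, Walk.cons hcd q, huc, heb, ?_⟩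
            simpa using ⟨hc, hq⟩
        · exact Or.inl ⟨c, hc, b', hb', h⟩
        · exact Or.inr (Or.inr ⟨c, hc, Or.inl huc⟩)
  obtain ⟨p, hp⟩ := hX.2 a haX b hbX
  rcases aux a b p hp hbB with h | h | ⟨b', hb', h⟩
  · exact h
  · exact absurd h (hAB a haA)
  · exact ⟨a, haA, b', hb', h⟩

lemma exists_pathOn_of_clique [DecidableEq V] (K : Finset V)
    (hK : ∀ x ∈ K, ∀ y ∈ K, x ≠ y → G.Adj x y) : ∀ u ∈ K, ∃ v ∈ K, PathOn G u v K := by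
  induction K using Finset.strongInduction with
  | H K ih =>
    intro u hu
    rcases (K.erase u).eq_empty_or_nonempty with he | ⟨w, hw⟩
    · have hKu : K = {u} := by
        rw [← Finset.insert_erase hu, he, insert_empty_eq]
      exact ⟨u, hu, by rw [hKu]; exact pathOn_singleton u⟩
    · obtain ⟨v, hv, h⟩ := ih (K.erase u) (Finset.erase_ssubset hu)
        (fun x hx y hy => hK x (Finset.mem_of_mem_erase hx) y (Finset.mem_of_mem_erase hy)) w hw
      refine ⟨v, Finset.mem_of_mem_erase hv, ?_⟩
      have := (pathOn_singleton u).trans_adj (hK u hu w (Finset.mem_of_mem_erase hw)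
        (Finset.ne_of_mem_erase hw).symm) h (by simp)
      rwa [← Finset.insert_eq, Finset.insert_erase hu] at this

lemma cycleOn_of_clique [DecidableEq V] {K : Finset V}
    (hK : ∀ x ∈ K, ∀ y ∈ K, x ≠ y → G.Adj x y) (h2 : 2 ≤ K.card) : CycleOn G K := by
  obtain ⟨u, hu⟩ : K.Nonempty := Finset.card_pos.1 (by omega)
  obtain ⟨v, hv, p, hp, hS⟩ := exists_pathOn_of_clique K hK u hu
  refine ⟨u, v, ⟨p, hp, hS⟩, hK v hv u hu ?_⟩
  rintro rfl
  have : K = {v} := by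
    ext x
    rw [← hS x, (Walk.isPath_iff_nil.1 hp).eq_nil]
    simp
  simp [this] at h2

lemma isHamiltonian_of_cycleOn_univ [Fintype V] [DecidableEq V] (hn : 3 ≤ Fintype.card V)
    (h : CycleOn G Finset.univ) : G.IsHamiltonian := by
  obtain ⟨u, v, ⟨p, hp, hS⟩, hvu⟩ := h
  have hH : p.IsHamiltonian := hp.isHamiltonian_of_mem fun w => (hS w).2 (Finset.mem_univ w)
  refine fun _ => ⟨v, Walk.cons hvu p,
    Walk.isHamiltonianCycle_iff_isCycle_and_support_count_tail_eq_one.2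
      ⟨?_, fun x => by simpa using hH x⟩⟩
  rw [Walk.cons_isCycle_iff]
  refine ⟨hp, fun he => ?_⟩
  have hl := hH.length_eq
  have := hp.length_eq_one_of_mem_edges (by rwa [Sym2.eq_swap] at he)
  omega

/-- A cyclic enumeration of a cycle with vertex set `C`. -/
structure CyclicEnum (G : SimpleGraph V) (C : Finset V) (N : ℤ) (f : ℤ → V) : Prop where
  periodic : ∀ i, f (i + N) = f i
  adj : ∀ i, G.Adj (f i) (f (i + 1))
  mem : ∀ i, f i ∈ C
  ne : ∀ i j, i < j → j < i + N → f i ≠ f j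
  surj : ∀ c, ∀ x ∈ C, ∃ i, c < i ∧ i ≤ c + N ∧ f i = x

lemma CycleOn.exists_cyclicEnum {C : Finset V} (h : CycleOn G C) :
    ∃ N f, CyclicEnum G C N f := by
  obtain ⟨u, v, ⟨p, hp, hS⟩, hvu⟩ := h
  have hN : (0 : ℤ) < (p.length + 1 : ℤ) := by omega
  refine ⟨p.length + 1, fun i => p.getVert (i % (p.length + 1)).toNat, ?_, ?_, ?_, ?_, ?_⟩
  · intro i; simp
  · intro i
    have h0 := Int.emod_nonneg i hN.ne'
    have h1 := Int.emod_lt_of_pos i hN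
    obtain ⟨k, hk⟩ : ∃ k : ℕ, i % (p.length + 1) = k := ⟨_, (Int.toNat_of_nonneg h0).symm⟩
    have hadd : (i + 1) % (p.length + 1 : ℤ) = ((k : ℤ) + 1) % (p.length + 1) := by
      rw [← hk]; simp
    simp only [hadd, hk]
    rcases lt_or_eq_of_le (show k ≤ p.length by omega) with hlt | heq
    · rw [Int.emod_eq_of_lt (by omega) (by omega)]
      exact p.adj_getVert_succ hlt
    · rw [heq, Int.emod_self]
      simpa using hvu
  · intro i
    exact (hS _).1 (p.getVert_mem_support _)
  · intro i j hij hji heq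
    have h0 := Int.emod_nonneg i hN.ne'
    have h1 := Int.emod_lt_of_pos i hN
    have h2 := Int.emod_nonneg j hN.ne'
    have h3 := Int.emod_lt_of_pos j hN
    have := hp.getVert_injOn (by simp; omega) (by simp; omega) heq
    have hmod : i % (p.length + 1 : ℤ) = j % (p.length + 1) := by omega
    have hdvd := Int.emod_eq_emod_iff_emod_sub_eq_zero.1 hmod.symm
    rw [Int.emod_eq_of_lt (by omega) (by omega)] at hdvd
    omega
  · intro c x hx
    obtain ⟨k, hk, hkl⟩ := Walk.mem_support_iff_exists_getVert.1 ((hS x).2 hx)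
    have h0 := Int.emod_nonneg ((k : ℤ) - (c + 1)) hN.ne'
    have h1 := Int.emod_lt_of_pos ((k : ℤ) - (c + 1)) hN
    refine ⟨c + 1 + ((k : ℤ) - (c + 1)) % (p.length + 1), by omega, by omega, ?_⟩
    have : (c + 1 + ((k : ℤ) - (c + 1)) % (p.length + 1)) % (p.length + 1 : ℤ) = k := by
      rw [Int.add_emod_emod, add_sub_cancel, Int.emod_eq_of_lt (by omega) (by omega)]
    simp only [this]
    simpa using hk

/-- The arc of vertices with indices from `i` to `j`. -/
noncomputable def arc [DecidableEq V] (f : ℤ → V) (i j : ℤ) : Finset V := (Finset.Icc i j).image f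

lemma mem_arc [DecidableEq V] {f : ℤ → V} {i j : ℤ} {x : V} :
    x ∈ arc f i j ↔ ∃ l, i ≤ l ∧ l ≤ j ∧ f l = x := by
  simp [arc, and_assoc]

lemma CyclicEnum.pathOn_arc [DecidableEq V] {C : Finset V} {N : ℤ} {f : ℤ → V}
    (h : CyclicEnum G C N f) {i j : ℤ} (hij : i ≤ j) (hji : j < i + N) :
    PathOn G (f i) (f j) (arc f i j) := by
  induction j, hij using Int.leInduction with
  | base => simpa [arc] using pathOn_singleton (f i)
  | succ j hij ih =>
    have := (ih (by omega)).trans_adj (h.adj j) (pathOn_singleton (f (j + 1))) ?_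
    · convert this using 1
      ext x
      simp only [mem_arc, Finset.mem_union, Finset.mem_singleton]
      constructor
      · rintro ⟨l, h1, h2, rfl⟩
        rcases eq_or_lt_of_le h2 with rfl | h2
        · exact Or.inr rfl
        · exact Or.inl ⟨l, h1, by omega, rfl⟩
      · rintro (⟨l, h1, h2, rfl⟩ | rfl)
        · exact ⟨l, h1, by omega, rfl⟩
        · exact ⟨j + 1, by omega, le_rfl, rfl⟩
    · rw [Finset.disjoint_singleton_right, mem_arc]
      rintro ⟨l, h1, h2, h3⟩
      exact h.ne l (j + 1) (by omega) (by omega) h3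

lemma CyclicEnum.disjoint_arc [DecidableEq V] {C : Finset V} {N : ℤ} {f : ℤ → V}
    (h : CyclicEnum G C N f) {i j k l : ℤ} (hjk : j < k) (hli : l < i + N) :
    Disjoint (arc f i j) (arc f k l) := by
  rw [Finset.disjoint_left]
  intro x hx hy
  obtain ⟨a, h1, h2, rfl⟩ := mem_arc.1 hx
  obtain ⟨b, h3, h4, h5⟩ := mem_arc.1 hy
  exact h.ne a b (by omega) (by omega) h5.symm

end PathsOnSets
section Exchange

variable {V : Type*} [Fintype V] [DecidableEq V] {G : SimpleGraph V}

omit [DecidableEq V] in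
/-- Pairwise separated nonempty sets covering `Sᶜ` bound the number of components from below. -/
lemma card_le_numComp {ι : Type*} [Fintype ι] (Z : ι → Finset V) (S : Finset V)
    (hS : ∀ x, x ∉ S ↔ ∃ a, x ∈ Z a) (hne : ∀ a, (Z a).Nonempty)
    (hsep : ∀ a b, a ≠ b → ∀ x ∈ Z a, ∀ y ∈ Z b, x ≠ y ∧ ¬ G.Adj x y) :
    Fintype.card ι ≤ numComp G (S : Set V) := by
  choose r hr using hne
  have hrS : ∀ a, r a ∈ ((S : Set V)ᶜ : Set V) := fun a => (hS (r a)).2 ⟨a, hr a⟩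
  rw [← Nat.card_eq_fintype_card, numComp]
  refine Nat.card_le_card_of_injective
    (fun a => (G.induce (S : Set V)ᶜ).connectedComponentMk ⟨r a, hrS a⟩) fun a b hab => ?_
  obtain ⟨p⟩ := ConnectedComponent.exact hab
  have aux : ∀ (x y : ((S : Set V)ᶜ : Set V)) (p : (G.induce (S : Set V)ᶜ).Walk x y),
      (x : V) ∈ Z a → (y : V) ∈ Z a := by
    intro x y p
    induction p with
    | nil => exact id
    | @cons x c y hxc p ih =>
      intro hx
      refine ih ?_
      obtain ⟨d, hd⟩ := (hS c).1 c.2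
      by_cases h : a = d
      · rwa [h]
      · exact absurd hxc (hsep a d h x hx c hd).2
  by_contra hne
  exact (hsep a b hne (r b) (aux _ _ p (hr a)) (r b) (hr b)).1 rfl

/-- A cycle through the set `K`, together with a component `U` of maximum size `m` among the
components missed by it, chosen so that no other cycle through `K` is better. -/
structure Extremal (G : SimpleGraph V) (K C U : Finset V) (m : ℕ) : Prop where
  cycle : CycleOn G C
  sub : K ⊆ C
  bound : ∀ X ⊆ Cᶜ, ConnOn G X → X.card ≤ m
  conn : ConnOn G U
  disj : U ⊆ Cᶜ
  card : U.card = m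
  best : ∀ C', CycleOn G C' → K ⊆ C' → (∀ X ⊆ C'ᶜ, ConnOn G X → m ≤ X.card → X ⊆ Cᶜ) → U ⊆ C'ᶜ

open Classical in
lemma exists_extremal {K C₀ : Finset V} (h₀ : CycleOn G C₀) (hK : K ⊆ C₀)
    (hham : ¬ CycleOn G Finset.univ) : ∃ C U m, Extremal G K C U m := by
  have hex : ∃ m, ∃ C, CycleOn G C ∧ K ⊆ C ∧ ∀ X ⊆ Cᶜ, ConnOn G X → X.card ≤ m :=
    ⟨Fintype.card V, C₀, h₀, hK, fun X _ _ => Finset.card_le_univ X⟩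
  set m := Nat.find hex with hm
  let big : Finset V → Finset (Finset V) := fun C =>
    Finset.univ.filter fun X => X ⊆ Cᶜ ∧ ConnOn G X ∧ m ≤ X.card
  have hex2 : ∃ k, ∃ C, (CycleOn G C ∧ K ⊆ C ∧ ∀ X ⊆ Cᶜ, ConnOn G X → X.card ≤ m) ∧
      (big C).card = k := by
    obtain ⟨C, hC⟩ := Nat.find_spec hex
    exact ⟨_, C, hC, rfl⟩
  obtain ⟨C, ⟨hC, hKC, hbd⟩, hcard⟩ := Nat.find_spec hex2
  have hmin : ∀ C', CycleOn G C' → K ⊆ C' → (∀ X ⊆ C'ᶜ, ConnOn G X → X.card ≤ m) →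
      (big C).card ≤ (big C').card := by
    intro C' h1 h2 h3
    rw [hcard]
    exact Nat.find_min' hex2 ⟨C', ⟨h1, h2, h3⟩, rfl⟩
  obtain ⟨x, hx⟩ : ∃ x, x ∉ C := by
    by_contra! h
    exact hham (by rwa [Finset.eq_univ_iff_forall.2 h] at hC)
  have hm1 : 1 ≤ m := by
    simpa using hbd {x} (by simpa using hx) (connOn_singleton x)
  obtain ⟨U, hUC, hU, hUm⟩ : ∃ U ⊆ Cᶜ, ConnOn G U ∧ U.card = m := by
    by_contra! h
    refine Nat.find_min hex (m := m - 1) (by omega) ⟨C, hC, hKC, fun X hX hXc => ?_⟩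
    have := hbd X hX hXc
    have := h X hX hXc
    omega
  refine ⟨C, U, m, hC, hKC, hbd, hU, hUC, hUm, fun C' hC' hKC' hsub => ?_⟩
  by_contra hUC'
  have hlt : (big C').card < (big C).card := by
    refine Finset.card_lt_card ⟨fun X hX => ?_, fun h => hUC' ?_⟩
    · simp only [big, Finset.mem_filter, Finset.mem_univ, true_and] at hX ⊢
      exact ⟨hsub X hX.1 hX.2.1 hX.2.2, hX.2⟩
    · have : U ∈ big C := by simp [big, hUC, hU, hUm]
      have := h this
      simp only [big, Finset.mem_filter, Finset.mem_univ, true_and] at this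
      exact this.1
  refine absurd (hmin C' hC' hKC' fun X hX hXc => ?_) (not_le.2 hlt)
  by_contra! h
  exact absurd (hbd X (hsub X hX hXc h.le) hXc) (not_le.2 h)

open Classical in
/-- The vertices outside `U` with a neighbor in `U`. -/
noncomputable def nbhd (G : SimpleGraph V) (U : Finset V) : Finset V :=
  Finset.univ.filter fun x => x ∉ U ∧ ∃ u ∈ U, G.Adj x u

lemma mem_nbhd {U : Finset V} {x : V} : x ∈ nbhd G U ↔ x ∉ U ∧ ∃ u ∈ U, G.Adj x u := by
  simp [nbhd]

lemma Extremal.nbhd_subset {K C U : Finset V} {m : ℕ} (h : Extremal G K C U m) :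
    nbhd G U ⊆ C := by
  intro x hx
  obtain ⟨hxU, u, hu, hxu⟩ := mem_nbhd.1 hx
  by_contra hxC
  have h1 := (connOn_singleton x).union_adj h.conn (Finset.mem_singleton_self x) hu hxu
  have h2 := h.bound _ (Finset.union_subset (by simpa using hxC) h.disj) h1
  rw [← Finset.insert_eq, Finset.card_insert_of_notMem hxU, h.card] at h2
  omega

/-- The arc `A` contains no vertex of `K` and is met by no large connected subset of `R ∪ A`. -/
def SafeArc (G : SimpleGraph V) (K R : Finset V) (m : ℕ) (A : Finset V) : Prop :=
  (∀ x ∈ A, x ∉ K) ∧ ∀ X ⊆ R ∪ A, ConnOn G X → m ≤ X.card → Disjoint X A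

omit [Fintype V] in
lemma arc_mono {f : ℤ → V} {i j k : ℤ} (h : j ≤ k) : arc f i j ⊆ arc f i k :=
  Finset.image_subset_image (Finset.Icc_subset_Icc le_rfl h)

omit [Fintype V] in
lemma SafeArc.mono {K R A B : Finset V} {m : ℕ} (h : SafeArc G K R m B) (hAB : A ⊆ B) :
    SafeArc G K R m A :=
  ⟨fun x hx => h.1 x (hAB hx), fun X hX hXc hm =>
    (h.2 X (hX.trans (Finset.union_subset_union_right hAB)) hXc hm).mono_right hAB⟩

/-- No cycle through `U` and `C`, except for two safe arcs that are not linked, exists. -/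
lemma Extremal.no_better {K C U : Finset V} {m : ℕ} (h : Extremal G K C U m)
    {A B C' P : Finset V} (hA : SafeArc G K (Cᶜ \ U) m A) (hB : SafeArc G K (Cᶜ \ U) m B)
    (hAC : A ⊆ C) (hBC : B ⊆ C) (hAU : ∀ x ∈ A, x ∉ nbhd G U) (hBU : ∀ x ∈ B, x ∉ nbhd G U)
    (hAB : ∀ x ∈ A, x ∉ B)
    (hlink : ∀ a ∈ A, ∀ b ∈ B, ¬ LinkVia G (Cᶜ \ U) a b) (hC' : CycleOn G C')
    (hcov : ∀ x ∈ C, x ∈ C' ∨ x ∈ A ∨ x ∈ B) (hPU : P ⊆ U) (hP : P.Nonempty)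
    (hPC : P ⊆ C') : False := by
  obtain ⟨z, hz⟩ := hP
  have hU : ∀ x ∈ U, x ∉ C := fun x hx => Finset.mem_compl.1 (h.disj hx)
  refine Finset.mem_compl.1 (h.best C' hC' (fun x hx => ?_) (fun X hX hXc hm => ?_) (hPU hz))
    (hPC hz)
  · rcases hcov x (h.sub hx) with hx' | hx' | hx'
    · exact hx'
    · exact absurd hx (hA.1 x hx')
    · exact absurd hx (hB.1 x hx')
  · have hloc : ∀ x ∈ X, x ∈ U ∨ x ∈ Cᶜ \ U ∨ x ∈ A ∨ x ∈ B := by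
      intro x hx
      by_cases hxC : x ∈ C
      · exact Or.inr (Or.inr ((hcov x hxC).resolve_left (Finset.mem_compl.1 (hX hx))))
      · by_cases hxU : x ∈ U
        · exact Or.inl hxU
        · exact Or.inr (Or.inl (by simp [hxC, hxU]))
    have havoid : ∀ w ∈ X, w ∈ A ∨ w ∈ B → ∀ x ∈ X, x ∉ U := by
      intro w hw hwAB x hx
      refine hXc.notMem_of_separated (P := fun x => x ∈ U) (Q := fun x => x ∉ U)
        (fun x _ => Classical.em _) (fun x hx y hy hxU hxy hyU => ?_) hw
        (fun hwU => hU w hwU (hwAB.elim (fun h => hAC h) fun h => hBC h))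
        (fun x h1 h2 => h2 h1) hx
      have hxN : x ∈ nbhd G U := mem_nbhd.2 ⟨hxU, y, hyU, hxy⟩
      rcases hloc x hx with h1 | h1 | h1 | h1
      · exact hxU h1
      · exact (Finset.mem_compl.1 (Finset.mem_sdiff.1 h1).1) (h.nbhd_subset hxN)
      · exact hAU x h1 hxN
      · exact hBU x h1 hxN
    have hnotboth : ∀ a ∈ X, a ∈ A → ∀ b ∈ X, b ∉ B := by
      intro a haX haA b hbX hbB
      obtain ⟨a', ha', b', hb', hl⟩ := hXc.exists_linkVia (R := Cᶜ \ U) (A := A) (B := B)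
        (fun x hx => (hloc x hx).resolve_left (havoid a haX (Or.inl haA) x hx)) haX haA hbX hbB hAB
      exact hlink a' ha' b' hb' hl
    intro x hx
    rw [Finset.mem_compl]
    intro hxC
    rcases (hcov x hxC).resolve_left (Finset.mem_compl.1 (hX hx)) with hxA | hxB
    · refine Finset.disjoint_left.1 (hA.2 X (fun y hy => ?_) hXc hm) hx hxA
      have h1 := havoid x hx (Or.inl hxA) y hy
      have h2 := hnotboth x hx hxA y hy
      rcases hloc y hy with h | h | h | h
      · exact absurd h h1
      · exact Finset.mem_union_left _ h
      · exact Finset.mem_union_right _ h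
      · exact absurd h h2
    · refine Finset.disjoint_left.1 (hB.2 X (fun y hy => ?_) hXc hm) hx hxB
      have h1 := havoid x hx (Or.inr hxB) y hy
      have h2 : y ∉ A := fun hyA => hnotboth y hy hyA x hx hxB
      rcases hloc y hy with h | h | h | h
      · exact absurd h h1
      · exact Finset.mem_union_left _ h
      · exact absurd h h2
      · exact Finset.mem_union_right _ h

end Exchange
section Separation

variable {V : Type*} [Fintype V] [DecidableEq V] {G : SimpleGraph V}
  {K C U : Finset V} {m : ℕ} {N : ℤ} {f : ℤ → V}

omit [Fintype V] in
lemma CyclicEnum.arc_subset (hf : CyclicEnum G C N f) (i j : ℤ) : arc f i j ⊆ C := by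
  intro x hx
  obtain ⟨l, -, -, rfl⟩ := mem_arc.1 hx
  exact hf.mem l

lemma Extremal.exists_walk (h : Extremal G K C U m) {a b : V} (ha : a ∈ nbhd G U)
    (hb : b ∈ nbhd G U) :
    ∃ c d, ∃ p : G.Walk c d, G.Adj a c ∧ G.Adj d b ∧ ∀ z ∈ p.support, z ∈ U := by
  obtain ⟨-, c, hc, hac⟩ := mem_nbhd.1 ha
  obtain ⟨-, d, hd, hbd⟩ := mem_nbhd.1 hb
  obtain ⟨p, hp⟩ := h.conn.2 c hc d hd
  exact ⟨c, d, p, hac, hbd.symm, hp⟩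

omit [Fintype V] in
lemma safeArc_empty {R : Finset V} : SafeArc G K R m ∅ := by
  simp [SafeArc]

/-- The arc between two consecutive attachment vertices of `U` is not safe. -/
lemma Extremal.not_safeArc (h : Extremal G K C U m) (hf : CyclicEnum G C N f) {i g : ℤ}
    (hig : i < g) (hgi : g < i + N) (hi : f i ∈ nbhd G U) (hg : f g ∈ nbhd G U)
    (hfree : ∀ l, i < l → l < g → f l ∉ nbhd G U) :
    ¬ SafeArc G K (Cᶜ \ U) m (arc f (i + 1) (g - 1)) := by
  intro hsafe
  rw [← hf.periodic] at hi
  obtain ⟨c, d, p, hac, hdb, hp⟩ := h.exists_walk hi hg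
  have hCU : Disjoint C U := (Finset.subset_compl_iff_disjoint_left.1 h.disj)
  obtain ⟨P, hPU, hP, hcyc⟩ := (hf.pathOn_arc (i := g) (j := i + N) (by omega) (by omega)).close_walk
    hac p hp hdb (hCU.mono_left (hf.arc_subset _ _))
  refine h.no_better hsafe safeArc_empty (hf.arc_subset _ _) (Finset.empty_subset _) ?_ (by simp)
    (by simp) (by simp) hcyc ?_ hPU hP Finset.subset_union_right
  · intro x hx
    obtain ⟨l, h1, h2, rfl⟩ := mem_arc.1 hx
    exact hfree l (by omega) (by omega)
  · intro x hx
    obtain ⟨l, h1, h2, rfl⟩ := hf.surj i x hx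
    by_cases hl : l < g
    · exact Or.inr (Or.inl (mem_arc.2 ⟨l, by omega, by omega, rfl⟩))
    · exact Or.inl (Finset.mem_union_left _ (mem_arc.2 ⟨l, by omega, by omega, rfl⟩))

/-- Initial arcs after two attachment vertices of `U` are not linked outside the cycle, as long as
they are safe up to their last vertex. -/
lemma Extremal.not_linkVia (h : Extremal G K C U m) (hf : CyclicEnum G C N f) {i j q q' : ℤ}
    (hqj : q < j) (hqi : q' < i + N) (hi : f i ∈ nbhd G U)
    (hj : f j ∈ nbhd G U) (hfree : ∀ l, i < l → l ≤ q → f l ∉ nbhd G U)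
    (hfree' : ∀ l, j < l → l ≤ q' → f l ∉ nbhd G U)
    (hsafe : SafeArc G K (Cᶜ \ U) m (arc f (i + 1) (q - 1)))
    (hsafe' : SafeArc G K (Cᶜ \ U) m (arc f (j + 1) (q' - 1))) (k : ℕ) :
    ∀ α β, i < α → α ≤ q → j < β → β ≤ q' → α + β ≤ i + j + k →
      ¬ LinkVia G (Cᶜ \ U) (f α) (f β) := by
  induction k with
  | zero => intro α β h1 h2 h3 h4 h5; omega
  | succ k ih =>
    intro α β h1 h2 h3 h4 h5 hlink
    have hi' : f (i + N) ∈ nbhd G U := by rwa [hf.periodic]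
    obtain ⟨c, d, p, hac, hdb, hp⟩ := h.exists_walk hj hi'
    have hCU : Disjoint C U := (Finset.subset_compl_iff_disjoint_left.1 h.disj)
    have hCR : Disjoint C (Cᶜ \ U) :=
      Finset.subset_compl_iff_disjoint_left.1 Finset.sdiff_subset
    obtain ⟨P, hPU, hP, hpath⟩ :=
      (hf.pathOn_arc (i := α) (j := j) (by omega) (by omega)).trans_walk hac p hp hdb
        (hf.pathOn_arc (i := β) (j := i + N) (by omega) (by omega)).symm
        (hCU.mono_left (hf.arc_subset _ _)) (hCU.symm.mono_right (hf.arc_subset _ _))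
        (hf.disjoint_arc h3 (by omega))
    obtain ⟨Q, hQ, hcyc⟩ := hpath.close_link hlink.symm (by
      refine Finset.disjoint_union_left.2 ⟨Finset.disjoint_union_left.2
        ⟨hCR.mono_left (hf.arc_subset _ _), ?_⟩, hCR.mono_left (hf.arc_subset _ _)⟩
      exact Finset.disjoint_sdiff.mono_left hPU)
    refine h.no_better (hsafe.mono (arc_mono (by omega : α - 1 ≤ q - 1)))
      (hsafe'.mono (arc_mono (by omega : β - 1 ≤ q' - 1))) (hf.arc_subset _ _) (hf.arc_subset _ _)
      ?_ ?_ ?_ ?_ hcyc ?_ hPU hP ?_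
    · intro x hx
      obtain ⟨l, h6, h7, rfl⟩ := mem_arc.1 hx
      exact hfree l (by omega) (by omega)
    · intro x hx
      obtain ⟨l, h6, h7, rfl⟩ := mem_arc.1 hx
      exact hfree' l (by omega) (by omega)
    · exact fun x hx => Finset.disjoint_left.1 (hf.disjoint_arc (by omega) (by omega)) hx
    · intro a ha b hb
      obtain ⟨l, h6, h7, rfl⟩ := mem_arc.1 ha
      obtain ⟨l', h8, h9, rfl⟩ := mem_arc.1 hb
      exact ih l l' (by omega) (by omega) (by omega) (by omega) (by omega)
    · intro x hx
      obtain ⟨l, h6, h7, rfl⟩ := hf.surj i x hx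
      simp only [Finset.mem_union, mem_arc]
      rcases lt_or_ge l α with h8 | h8
      · exact Or.inr (Or.inl ⟨l, by omega, by omega, rfl⟩)
      rcases le_or_gt l j with h9 | h9
      · exact Or.inl (Or.inl (Or.inl (Or.inl ⟨l, h8, h9, rfl⟩)))
      rcases lt_or_ge l β with h10 | h10
      · exact Or.inr (Or.inr ⟨l, by omega, by omega, rfl⟩)
      · exact Or.inl (Or.inl (Or.inr ⟨l, h10, h7, rfl⟩))
    · intro x hx
      simp [hx]

/-- `Y` is a connected set ending the initial arc `f (i + 1), …, f q`, with `q` the first index at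
which this arc is not safe. -/
structure Blocker (G : SimpleGraph V) (K C U : Finset V) (m : ℕ) (f : ℤ → V) (i q : ℤ)
    (Y : Finset V) : Prop where
  lt : i < q
  free : ∀ l, i < l → l ≤ q → f l ∉ nbhd G U
  safeArc : SafeArc G K (Cᶜ \ U) m (arc f (i + 1) (q - 1))
  mem : f q ∈ Y
  conn : ConnOn G Y
  sub : Y ⊆ (Cᶜ \ U) ∪ arc f (i + 1) q
  large : f q ∈ K ∨ m ≤ Y.card

lemma Extremal.exists_blocker (h : Extremal G K C U m) (hf : CyclicEnum G C N f)
    (h2 : 2 ≤ (nbhd G U).card) {i : ℤ} (hi : f i ∈ nbhd G U) :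
    ∃ q Y, Blocker G K C U m f i q Y := by
  obtain ⟨v, hv, hvi⟩ := Finset.exists_mem_ne (s := nbhd G U) (by omega) (f i)
  obtain ⟨l, hil, hlN, rfl⟩ := hf.surj i v (h.nbhd_subset hv)
  have hlN' : l ≠ i + N := by
    rintro rfl
    exact hvi (hf.periodic i)
  have hex : ∃ r : ℕ, f (i + 1 + r) ∈ nbhd G U :=
    ⟨(l - i - 1).toNat, by rwa [show i + 1 + ((l - i - 1).toNat : ℤ) = l by omega]⟩
  classical
  obtain ⟨r, hr, hrmin, hrl⟩ : ∃ r : ℕ, f (i + 1 + r) ∈ nbhd G U ∧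
      (∀ s : ℕ, s < r → f (i + 1 + s) ∉ nbhd G U) ∧ i + 1 + r ≤ l := by
    refine ⟨Nat.find hex, Nat.find_spec hex, fun s hs => Nat.find_min hex hs, ?_⟩
    have := Nat.find_min' hex (m := (l - i - 1).toNat)
      (by rwa [show i + 1 + ((l - i - 1).toNat : ℤ) = l by omega])
    omega
  have hfree : ∀ k, i < k → k < i + 1 + r → f k ∉ nbhd G U := by
    intro k h1 h2
    have := hrmin (k - i - 1).toNat (by omega)
    rwa [show i + 1 + ((k - i - 1).toNat : ℤ) = k by omega] at this
  have hns := h.not_safeArc hf (by omega) (by omega) hi hr hfree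
  have hex2 : ∃ s : ℕ, ¬ SafeArc G K (Cᶜ \ U) m (arc f (i + 1) (i + s)) :=
    ⟨r, by rwa [show i + 1 + (r : ℤ) - 1 = i + r by ring] at hns⟩
  obtain ⟨s, hs, hsmin, hsr⟩ : ∃ s : ℕ, ¬ SafeArc G K (Cᶜ \ U) m (arc f (i + 1) (i + s)) ∧
      (∀ s' : ℕ, s' < s → SafeArc G K (Cᶜ \ U) m (arc f (i + 1) (i + s'))) ∧ s ≤ r := by
    refine ⟨Nat.find hex2, Nat.find_spec hex2, fun s hs => not_not.1 (Nat.find_min hex2 hs), ?_⟩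
    exact Nat.find_min' hex2 (by rwa [show i + 1 + (r : ℤ) - 1 = i + r by ring] at hns)
  have hs0 : s ≠ 0 := by
    rintro rfl
    refine hs ?_
    rw [show arc f (i + 1) (i + (0 : ℕ)) = ∅ by simp [arc]]
    exact safeArc_empty
  have hsafe : SafeArc G K (Cᶜ \ U) m (arc f (i + 1) (i + s - 1)) := by
    have := hsmin (s - 1) (by omega)
    rwa [show i + ((s - 1 : ℕ) : ℤ) = i + s - 1 by omega] at this
  have hlast : ∀ x ∈ arc f (i + 1) (i + s), x ∉ arc f (i + 1) (i + s - 1) → x = f (i + s) := by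
    intro x hx hx'
    obtain ⟨l, h1, h2, rfl⟩ := mem_arc.1 hx
    by_contra hne
    exact hx' (mem_arc.2 ⟨l, h1, by
      rcases eq_or_ne l (i + s) with rfl | h3
      · exact absurd rfl hne
      · omega, rfl⟩)
  have hmem : f (i + s) ∈ arc f (i + 1) (i + s) := mem_arc.2 ⟨_, by omega, le_rfl, rfl⟩
  have hfree' : ∀ l, i < l → l ≤ i + s → f l ∉ nbhd G U := fun l h1 h2 =>
    hfree l h1 (by omega)
  by_cases hK : f (i + s) ∈ K
  · exact ⟨i + s, {f (i + s)}, by omega, hfree', hsafe, by simp, connOn_singleton _,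
      by simpa using Or.inr hmem, Or.inl hK⟩
  · have hA : ∀ x ∈ arc f (i + 1) (i + s), x ∉ K := by
      intro x hx
      by_cases hx' : x ∈ arc f (i + 1) (i + s - 1)
      · exact hsafe.1 x hx'
      · rwa [hlast x hx hx']
    obtain ⟨Y, hY, hYc, hYm, hYd⟩ : ∃ X ⊆ (Cᶜ \ U) ∪ arc f (i + 1) (i + s),
        ConnOn G X ∧ m ≤ X.card ∧ ¬ Disjoint X (arc f (i + 1) (i + s)) := by
      by_contra! hcon
      exact hs ⟨hA, hcon⟩
    refine ⟨i + s, Y, by omega, hfree', hsafe, ?_, hYc, hY, Or.inr hYm⟩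
    by_contra hnot
    have hY' : ∀ x ∈ Y, x ∈ arc f (i + 1) (i + s) → x ∈ arc f (i + 1) (i + s - 1) := by
      intro x hx hxa
      by_contra hx'
      exact hnot (hlast x hxa hx' ▸ hx)
    obtain ⟨x, hx, hxa⟩ := Finset.not_disjoint_iff.1 hYd
    refine Finset.disjoint_left.1 (hsafe.2 Y (fun y hy => ?_) hYc hYm) hx (hY' x hx hxa)
    rcases Finset.mem_union.1 (hY hy) with h1 | h1
    · exact Finset.mem_union_left _ h1
    · exact Finset.mem_union_right _ (hY' y hy h1)

/-- Blockers of different attachment vertices are disjoint and not adjacent. -/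
lemma Extremal.blocker_separated_of_lt (h : Extremal G K C U m) (hf : CyclicEnum G C N f)
    {i j q q' : ℤ} {Y Y' : Finset V} (hij : i < j) (hji : j < i + N) (hi : f i ∈ nbhd G U)
    (hj : f j ∈ nbhd G U) (hY : Blocker G K C U m f i q Y) (hY' : Blocker G K C U m f j q' Y')
    {x y : V} (hx : x ∈ Y) (hy : y ∈ Y') : x ≠ y ∧ ¬ G.Adj x y := by
  have hqj : q < j := by
    by_contra! hcon
    exact hY.free j hij hcon hj
  have hqi : q' < i + N := by
    by_contra! hcon
    exact hY'.free (i + N) hji hcon (by rwa [hf.periodic])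
  by_contra hcon
  have hconn : ConnOn G (Y ∪ Y') := by
    by_cases hxy : x = y
    · subst hxy
      exact hY.conn.union_inter hY'.conn hx hy
    · exact hY.conn.union_adj hY'.conn hx hy (by tauto)
  have h1 := hY.lt
  have h2 := hY'.lt
  have hsub : ∀ z ∈ Y ∪ Y', z ∈ Cᶜ \ U ∨ z ∈ arc f (i + 1) q ∨ z ∈ arc f (j + 1) q' := by
    intro z hz
    rcases Finset.mem_union.1 hz with hz | hz
    · rcases Finset.mem_union.1 (hY.sub hz) with hz | hz
      · exact Or.inl hz
      · exact Or.inr (Or.inl hz)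
    · rcases Finset.mem_union.1 (hY'.sub hz) with hz | hz
      · exact Or.inl hz
      · exact Or.inr (Or.inr hz)
  obtain ⟨a, ha, b, hb, hl⟩ := hconn.exists_linkVia hsub (Finset.mem_union_left _ hY.mem)
    (mem_arc.2 ⟨q, by omega, le_rfl, rfl⟩) (Finset.mem_union_right _ hY'.mem)
    (mem_arc.2 ⟨q', by omega, le_rfl, rfl⟩)
    (fun x hx => Finset.disjoint_left.1 (hf.disjoint_arc (by omega) (by omega)) hx)
  obtain ⟨α, h3, h4, rfl⟩ := mem_arc.1 ha
  obtain ⟨β, h5, h6, rfl⟩ := mem_arc.1 hb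
  exact h.not_linkVia hf hqj hqi hi hj hY.free hY'.free hY.safeArc hY'.safeArc
    (α + β - i - j).toNat α β (by omega) h4 (by omega) h6 (by omega) hl

/-- Separating `U` and one blocker for each attachment vertex leaves many components. -/
lemma Extremal.exists_separator (h : Extremal G K C U m)
    (hK : ∀ x ∈ K, ∀ y ∈ K, x ≠ y → G.Adj x y) (h2 : 2 ≤ (nbhd G U).card) :
    ∃ S : Finset V, (nbhd G U).card + 1 ≤ numComp G (S : Set V) ∧
      S.card + (nbhd G U).card * m + 1 ≤ Fintype.card V := by
  obtain ⟨N, f, hf⟩ := h.cycle.exists_cyclicEnum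
  have hidx : ∀ v : nbhd G U, ∃ i, -1 < i ∧ i ≤ -1 + N ∧ f i = v :=
    fun v => hf.surj (-1) v (h.nbhd_subset v.2)
  choose idx hidx0 hidxN hidxv using hidx
  have hidxmem : ∀ v, f (idx v) ∈ nbhd G U := fun v => by rw [hidxv]; exact v.2
  have hblk := fun v => h.exists_blocker hf h2 (hidxmem v)
  choose q Y hY using hblk
  have hsepY : ∀ v w, v ≠ w → ∀ x ∈ Y v, ∀ y ∈ Y w, x ≠ y ∧ ¬ G.Adj x y := by
    intro v w hvw x hx y hy
    have hne : idx v ≠ idx w := fun he => hvw (Subtype.ext (by rw [← hidxv v, ← hidxv w, he]))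
    have h0 := hidx0 v
    have h1 := hidxN v
    have h3 := hidx0 w
    have h4 := hidxN w
    rcases lt_or_gt_of_ne hne with hlt | hlt
    · exact h.blocker_separated_of_lt hf hlt (by omega) (hidxmem v) (hidxmem w) (hY v) (hY w) hx hy
    · have := h.blocker_separated_of_lt hf hlt (by omega) (hidxmem w) (hidxmem v) (hY w) (hY v)
        hy hx
      exact ⟨this.1.symm, fun hadj => this.2 hadj.symm⟩
  have hsepU : ∀ v, ∀ x ∈ Y v, ∀ u ∈ U, x ≠ u ∧ ¬ G.Adj x u := by
    intro v x hx u hu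
    have hcase := Finset.mem_union.1 ((hY v).sub hx)
    have hxU : x ∉ U := by
      intro hxU
      rcases hcase with h1 | h1
      · exact (Finset.mem_sdiff.1 h1).2 hxU
      · exact Finset.mem_compl.1 (h.disj hxU) (hf.arc_subset _ _ h1)
    refine ⟨fun he => hxU (he ▸ hu), fun hadj => ?_⟩
    have hxN : x ∈ nbhd G U := mem_nbhd.2 ⟨hxU, u, hu, hadj⟩
    rcases hcase with h1 | h1
    · exact Finset.mem_compl.1 (Finset.mem_sdiff.1 h1).1 (h.nbhd_subset hxN)
    · obtain ⟨l, h3, h4, rfl⟩ := mem_arc.1 h1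
      exact (hY v).free l (by omega) h4 hxN
  let Z : Option (nbhd G U) → Finset V := fun o => o.elim U Y
  have hsep : ∀ a b, a ≠ b → ∀ x ∈ Z a, ∀ y ∈ Z b, x ≠ y ∧ ¬ G.Adj x y := by
    rintro (_ | v) (_ | w) hab x hx y hy
    · exact absurd rfl hab
    · have := hsepU w y hy x hx
      exact ⟨this.1.symm, fun hadj => this.2 hadj.symm⟩
    · exact hsepU v x hx y hy
    · exact hsepY v w (fun he => hab (by rw [he])) x hx y hy
  have hm1 : 1 ≤ m := by
    rw [← h.card]
    exact Finset.card_pos.2 h.conn.1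
  have hsum : (nbhd G U).card * m + 1 ≤ m + ∑ v, (Y v).card := by
    by_cases hall : ∀ v, m ≤ (Y v).card
    · have := Finset.card_nsmul_le_sum Finset.univ (fun v => (Y v).card) m fun v _ => hall v
      rw [Finset.card_univ, Fintype.card_coe, smul_eq_mul] at this
      omega
    · push Not at hall
      obtain ⟨v, hv⟩ := hall
      have hother : ∀ w ∈ Finset.univ.erase v, m ≤ (Y w).card := by
        intro w hw
        have hwv := Finset.ne_of_mem_erase hw
        refine (hY w).large.resolve_left fun hwK => ?_
        have hvK := (hY v).large.resolve_right (not_le.2 hv)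
        have := hsepY w v hwv _ (hY w).mem _ (hY v).mem
        exact this.2 (hK _ hwK _ hvK this.1)
      have h3 := Finset.card_nsmul_le_sum _ (fun v => (Y v).card) m hother
      rw [Finset.card_erase_of_mem (Finset.mem_univ v), Finset.card_univ, Fintype.card_coe,
        smul_eq_mul] at h3
      have h4 := Finset.add_sum_erase Finset.univ (fun v => (Y v).card) (Finset.mem_univ v)
      have h5 : 1 ≤ (Y v).card := Finset.card_pos.2 (hY v).conn.1
      have h6 : ((nbhd G U).card - 1) * m + m = (nbhd G U).card * m := by
        rw [← Nat.succ_mul]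
        congr 1
        omega
      omega
  refine ⟨(Finset.univ.biUnion Z)ᶜ, ?_, ?_⟩
  · have := card_le_numComp Z (Finset.univ.biUnion Z)ᶜ (fun x => by simp) ?_ hsep
    · simpa using this
    · rintro (_ | v)
      · exact h.conn.1
      · exact (hY v).conn.1
  · have hcard : (Finset.univ.biUnion Z).card = m + ∑ v, (Y v).card := by
      rw [Finset.card_biUnion, Fintype.sum_option]
      · simp [Z, h.card]
      · intro a _ b _ hab
        exact Finset.disjoint_left.2 fun x hx hy => (hsep a b hab x hx x hy).1 rfl
    have := Finset.card_compl_add_card (Finset.univ.biUnion Z)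
    omega

end Separation
section Counting

variable {V : Type*} [Fintype V] [DecidableEq V] {G : SimpleGraph V}

/-- A nonempty set whose neighborhood lies in `S` is cut off by `S` from any other vertex. -/
lemma two_le_numComp {A S : Finset V} (hA : A.Nonempty) (hAS : Disjoint A S)
    (hN : nbhd G A ⊆ S) {b : V} (hbA : b ∉ A) (hbS : b ∉ S) : 2 ≤ numComp G (S : Set V) := by
  have hsep : ∀ x ∈ A, ∀ y, y ∉ A → y ∉ S → x ≠ y ∧ ¬ G.Adj x y := fun x hx y hyA hyS =>
    ⟨fun he => hyA (he ▸ hx), fun hadj => hyS (hN (mem_nbhd.2 ⟨hyA, x, hx, hadj.symm⟩))⟩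
  let Z : Bool → Finset V := fun c => if c then A else (A ∪ S)ᶜ
  refine card_le_numComp (ι := Bool) Z S (fun x => ?_) ?_ ?_
  · have := fun hx : x ∈ A => Finset.disjoint_left.1 hAS hx
    simp only [Bool.exists_bool, Z]
    simp
    tauto
  · rintro (_ | _)
    · exact ⟨b, by simp [Z, hbA, hbS]⟩
    · simpa [Z] using hA
  · rintro (_ | _) (_ | _) hne x hx y hy
    · exact absurd rfl hne
    · simp [Z] at hx hy
      have := hsep y hy x hx.1 hx.2
      exact ⟨this.1.symm, fun h => this.2 h.symm⟩
    · simp [Z] at hx hy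
      exact hsep x hx y hy.1 hy.2
    · exact absurd rfl hne

omit [Fintype V] [DecidableEq V] in
lemma card_neighborSet_le {v : V} {S : Finset V} (h : ∀ w, G.Adj v w → w ∈ S) :
    Nat.card (G.neighborSet v) ≤ S.card := by
  rw [Nat.card_coe_set_eq, ← Set.ncard_coe_finset S]
  exact Set.ncard_le_ncard (fun w hw => h w hw) S.finite_toSet

lemma card_neighborSet_lt {U : Finset V} {v : V} (hv : v ∈ U) :
    Nat.card (G.neighborSet v) + 1 ≤ U.card + (nbhd G U).card := by
  have h1 : Nat.card (G.neighborSet v) ≤ (U.erase v ∪ nbhd G U).card := by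
    refine card_neighborSet_le fun w hw => ?_
    by_cases hwU : w ∈ U
    · exact Finset.mem_union_left _ (Finset.mem_erase.2 ⟨hw.ne', hwU⟩)
    · exact Finset.mem_union_right _ (mem_nbhd.2 ⟨hwU, v, hv, hw.symm⟩)
  have h2 := Finset.card_union_le (U.erase v) (nbhd G U)
  have h3 := Finset.card_erase_add_one hv
  omega

omit [Fintype V] in
lemma exists_cycleOn_superset [Nonempty V] {K : Finset V}
    (hK : ∀ x ∈ K, ∀ y ∈ K, x ≠ y → G.Adj x y) (hnbr : ∀ v, ∃ w, G.Adj v w) :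
    ∃ C, CycleOn G C ∧ K ⊆ C := by
  rcases le_or_gt 2 K.card with h2 | h2
  · exact ⟨K, cycleOn_of_clique hK h2, subset_rfl⟩
  · obtain ⟨v, hv⟩ : ∃ v, K ⊆ {v} :=
      Finset.card_le_one_iff_subset_singleton.1 (by omega)
    obtain ⟨w, hw⟩ := hnbr v
    refine ⟨{v, w}, cycleOn_of_clique ?_ (Finset.card_pair hw.ne).ge,
      hv.trans (by simp)⟩
    intro x hx y hy hxy
    simp only [Finset.mem_insert, Finset.mem_singleton] at hx hy
    rcases hx with rfl | rfl <;> rcases hy with rfl | rfl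
    · exact absurd rfl hxy
    · exact hw
    · exact hw.symm
    · exact absurd rfl hxy

lemma Extremal.exists_notMem_nbhd {K C U : Finset V} {m : ℕ} (h : Extremal G K C U m) :
    ∃ b ∈ C, b ∉ nbhd G U := by
  by_cases h2 : 2 ≤ (nbhd G U).card
  · obtain ⟨N, f, hf⟩ := h.cycle.exists_cyclicEnum
    obtain ⟨v, hv⟩ := Finset.card_pos.1 (by omega : 0 < (nbhd G U).card)
    obtain ⟨i, -, -, rfl⟩ := hf.surj 0 v (h.nbhd_subset hv)
    obtain ⟨q, Y, hY⟩ := h.exists_blocker hf h2 hv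
    exact ⟨f q, hf.mem q, hY.free q hY.lt le_rfl⟩
  · obtain ⟨u, v, hp, hvu⟩ := h.cycle
    by_contra! hall
    have h1 := hall u hp.left_mem
    have h3 := hall v hp.symm.left_mem
    exact hvu.ne (Finset.card_le_one.1 (by omega) v h3 u h1)

lemma Extremal.two_le_numComp_nbhd {K C U : Finset V} {m : ℕ} (h : Extremal G K C U m) :
    2 ≤ numComp G (nbhd G U : Set V) := by
  obtain ⟨b, hbC, hb⟩ := h.exists_notMem_nbhd
  exact two_le_numComp h.conn.1 (Finset.disjoint_left.2 fun x hx hxN => (mem_nbhd.1 hxN).1 hx)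
    subset_rfl (fun hbU => Finset.mem_compl.1 (h.disj hbU) hbC) hb

lemma Tough.exists_adj {t : ℝ} (ht : 0 < t) (h : Tough t G) (hn : 2 ≤ Fintype.card V) (v : V) :
    ∃ w, G.Adj v w := by
  by_contra! hv
  obtain ⟨b, hb⟩ := Fintype.exists_ne_of_one_lt_card (by omega) v
  have h2 : 2 ≤ numComp G ((∅ : Finset V) : Set V) := by
    refine two_le_numComp (A := {v}) (by simp) (by simp) (fun x hx => ?_) (b := b) (by simpa)
      (by simp)
    obtain ⟨-, u, hu, hxu⟩ := mem_nbhd.1 hx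
    rw [Finset.mem_singleton] at hu
    exact absurd (hu ▸ hxu.symm) (hv x)
  have := h ∅ h2
  have h3 : (2 : ℝ) ≤ numComp G ((∅ : Finset V) : Set V) := by exact_mod_cast h2
  simp only [Finset.card_empty, Nat.cast_zero] at this
  nlinarith

end Counting

/-- **Shan's Ore-type theorem for tough graphs.** If `G` is a `t`-tough graph on `n ≥ 3`
vertices with `σ₂(G) > 2n/(t+1) − 2`, then `G` is hamiltonian. -/
theorem stmt0 {V : Type*} [Fintype V] [DecidableEq V] (t : ℝ) (ht : 0 < t)
    (G : SimpleGraph V) (hn : 3 ≤ Fintype.card V) (htough : Tough t G)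
    (hsigma2 : ∀ u v : V, u ≠ v → ¬ G.Adj u v →
      2 * (Fintype.card V : ℝ) / (t + 1) - 2 <
        ((Nat.card (G.neighborSet u) + Nat.card (G.neighborSet v) : ℕ) : ℝ)) :
    G.IsHamiltonian := by
  classical
  have hV : Nonempty V := Fintype.card_pos_iff.1 (by omega)
  have ht1 : 0 < t + 1 := by linarith
  have hn' : (3 : ℝ) ≤ Fintype.card V := by exact_mod_cast hn
  set n : ℝ := (Fintype.card V : ℝ) with hndef
  let K : Finset V := Finset.univ.filter fun v =>
    ((Nat.card (G.neighborSet v) : ℝ) + 1) * (t + 1) ≤ n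
  have hore : ∀ u v : V, u ≠ v → ¬ G.Adj u v →
      2 * n < ((Nat.card (G.neighborSet u) : ℝ) + Nat.card (G.neighborSet v) + 2) * (t + 1) := by
    intro u v huv hadj
    have := hsigma2 u v huv hadj
    push_cast at this
    rw [← div_lt_iff₀ ht1]
    linarith
  have hK : ∀ x ∈ K, ∀ y ∈ K, x ≠ y → G.Adj x y := by
    intro x hx y hy hxy
    by_contra hadj
    have h1 := hore x y hxy hadj
    have h2 := (Finset.mem_filter.1 hx).2
    have h3 := (Finset.mem_filter.1 hy).2
    linarith
  refine isHamiltonian_of_cycleOn_univ hn ?_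
  by_contra hham
  obtain ⟨C₀, hC₀, hKC₀⟩ := exists_cycleOn_superset hK (htough.exists_adj ht (by omega))
  obtain ⟨C, U, m, h⟩ := exists_extremal hC₀ hKC₀ hham
  obtain ⟨a, ha⟩ := h.conn.1
  have haC : a ∉ C := Finset.mem_compl.1 (h.disj ha)
  have haK : n < ((Nat.card (G.neighborSet a) : ℝ) + 1) * (t + 1) := by
    by_contra! hle
    exact haC (h.sub (Finset.mem_filter.2 ⟨Finset.mem_univ a, hle⟩))
  have hda := card_neighborSet_lt (G := G) ha
  rw [h.card] at hda
  have hm1 : 1 ≤ m := by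
    rw [← h.card]
    exact Finset.card_pos.2 h.conn.1
  have hk2 := htough _ h.two_le_numComp_nbhd
  have hc2 : (2 : ℝ) ≤ numComp G (nbhd G U : Set V) := by exact_mod_cast h.two_le_numComp_nbhd
  set k := (nbhd G U).card with hk
  have hkt : 2 * t ≤ k := by nlinarith
  have hda' : (Nat.card (G.neighborSet a) : ℝ) + 1 ≤ m + k := by exact_mod_cast hda
  have hm1' : (1 : ℝ) ≤ m := by exact_mod_cast hm1
  rcases le_or_gt 2 k with h2 | h2
  · obtain ⟨S, hS, hcard⟩ := h.exists_separator hK h2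
    have hS' := htough S (by omega)
    have h3 : (k : ℝ) + 1 ≤ numComp G (S : Set V) := by exact_mod_cast hS
    have h4 : (S.card : ℝ) + k * m + 1 ≤ n := by
      rw [hndef]
      exact_mod_cast hcard
    have h5 : t * (k + 1) ≤ S.card := (mul_le_mul_of_nonneg_left h3 ht.le).trans hS'
    have h6 : n < (m + k) * (t + 1) :=
      haK.trans_le (mul_le_mul_of_nonneg_right hda' ht1.le)
    have h7 : (2 : ℝ) ≤ k := by exact_mod_cast h2
    have h8 : 0 ≤ (m - 1 : ℝ) * (k - t - 1) := mul_nonneg (by linarith) (by linarith)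
    nlinarith
  · obtain ⟨b, hbC, hb⟩ := h.exists_notMem_nbhd
    have hbU : b ∉ U := fun hbU => Finset.mem_compl.1 (h.disj hbU) hbC
    have hab : ¬ G.Adj a b := fun hadj => hb (mem_nbhd.2 ⟨hbU, a, ha, hadj.symm⟩)
    have hdb : Nat.card (G.neighborSet b) ≤ ((insert b U)ᶜ).card := by
      refine card_neighborSet_le fun w hw => Finset.mem_compl.2 fun hwU => ?_
      rcases Finset.mem_insert.1 hwU with rfl | hwU
      · exact hw.ne rfl
      · exact hb (mem_nbhd.2 ⟨hbU, w, hwU, hw⟩)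
    have hcompl := Finset.card_compl_add_card (insert b U)
    rw [Finset.card_insert_of_notMem hbU, h.card] at hcompl
    have hk1 : (k : ℝ) ≤ 1 := by exact_mod_cast Nat.lt_succ_iff.1 h2
    have hdb' : (Nat.card (G.neighborSet b) : ℝ) + m + 1 ≤ n := by
      rw [hndef]
      exact_mod_cast (by omega : Nat.card (G.neighborSet b) + m + 1 ≤ Fintype.card V)
    have h3 := hore a b (fun he => haC (he ▸ hbC)) hab
    have h4 : ((Nat.card (G.neighborSet a) : ℝ) + Nat.card (G.neighborSet b) + 2) * (t + 1) ≤
        (n + 1) * (t + 1) := mul_le_mul_of_nonneg_right (by linarith) ht1.le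
    nlinarith
end

section
/- Let t > 0 be a real number and let G be a t-tough graph on n ≥ 3 vertices. If σ₂(G) = 2n/(t+1) − 2 and G is not hamiltonian, then n is odd and G is the join H + K̄_{(n+1)/2} of some graph H on (n−1)/2 vertices with the edgeless graph on (n+1)/2 vertices. -/
open SimpleGraph

/-- The join `G₁ + G₂` of two graphs: the disjoint union of `G₁` and `G₂` together with all
edges between the two vertex sets. -/
def graphJoin {α β : Type*} (G₁ : SimpleGraph α) (G₂ : SimpleGraph β) :
    SimpleGraph (α ⊕ β) :=
  SimpleGraph.fromRel (fun x y =>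
    (∃ a b, x = Sum.inl a ∧ y = Sum.inl b ∧ G₁.Adj a b) ∨
    (∃ a b, x = Sum.inr a ∧ y = Sum.inr b ∧ G₂.Adj a b) ∨
    (∃ a b, x = Sum.inl a ∧ y = Sum.inr b))

section Segments

/-- The list `c s, c (s + 1), …, c e`. -/
def seg {α : Type*} (c : ℤ → α) (s e : ℤ) : List α :=
  (List.range (e + 1 - s).toNat).map fun k : ℕ => c (s + k)

variable {α : Type*} {c : ℤ → α} {s e : ℤ}

theorem mem_seg {v : α} : v ∈ seg c s e ↔ ∃ i, s ≤ i ∧ i ≤ e ∧ c i = v := by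
  simp only [seg, List.mem_map, List.mem_range]
  constructor
  · rintro ⟨k, hk, rfl⟩
    exact ⟨s + k, by omega, by omega, rfl⟩
  · rintro ⟨i, h1, h2, rfl⟩
    exact ⟨(i - s).toNat, by omega, by congr 1; omega⟩

@[simp] theorem length_seg : (seg c s e).length = (e + 1 - s).toNat := by simp [seg]

theorem head?_seg (h : s ≤ e) : (seg c s e).head? = some (c s) := by
  obtain ⟨k, hk⟩ : ∃ k : ℕ, (e + 1 - s).toNat = k + 1 := ⟨(e - s).toNat, by omega⟩
  simp [seg, hk, List.range_succ_eq_map]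

theorem getLast?_seg (h : s ≤ e) : (seg c s e).getLast? = some (c e) := by
  obtain ⟨k, hk⟩ : ∃ k : ℕ, (e + 1 - s).toNat = k + 1 := ⟨(e - s).toNat, by omega⟩
  simp only [seg, hk, List.range_succ, List.map_append, List.map_cons, List.map_nil,
    List.getLast?_append, List.getLast?_singleton, Option.some_or]
  congr 2; omega

theorem seg_append {m : ℤ} (h1 : s ≤ m + 1) (h2 : m ≤ e) :
    seg c s m ++ seg c (m + 1) e = seg c s e := by
  have : (e + 1 - s).toNat = (m + 1 - s).toNat + (e + 1 - (m + 1)).toNat := by omega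
  rw [seg, seg, seg, this, List.range_add, List.map_append, List.map_map]
  congr 1
  refine List.map_congr_left fun k _ => ?_
  simp only [Function.comp]
  congr 1; push_cast; omega

theorem nodup_seg {N : ℕ} (hinj : ∀ i j, c i = c j → (N : ℤ) ∣ i - j) (h : e < s + N) :
    (seg c s e).Nodup := by
  refine List.Nodup.map_on (fun x hx y hy hxy => ?_) List.nodup_range
  simp only [List.mem_range] at hx hy
  have h1 := hinj _ _ hxy
  obtain ⟨d, hd⟩ := h1
  have : d = 0 := by
    by_contra hne
    rcases lt_or_gt_of_ne hne with hlt | hlt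
    · have : (N : ℤ) * d ≤ N * (-1) := by gcongr; omega
      omega
    · have : (N : ℤ) * 1 ≤ N * d := by gcongr; omega
      omega
  subst this; omega

end Segments

section PathLists

variable {V : Type*} {G : SimpleGraph V}

/-- The list `l` runs from `a` to `b` along edges of `G`. -/
structure PathList (G : SimpleGraph V) (l : List V) (a b : V) : Prop where
  chain : l.IsChain G.Adj
  head : l.head? = some a
  last : l.getLast? = some b

namespace PathList

theorem singleton (a : V) : PathList G [a] a a := ⟨by simp, rfl, rfl⟩

theorem append {l l' : List V} {a b a' b' : V} (h : PathList G l a b) (h' : PathList G l' a' b')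
    (hadj : G.Adj b a') : PathList G (l ++ l') a b' := by
  refine ⟨?_, ?_, ?_⟩
  · rw [List.isChain_append]
    refine ⟨h.chain, h'.chain, ?_⟩
    rw [h.last, h'.head]
    rintro x ⟨⟩ y ⟨⟩
    exact hadj
  · simp [List.head?_append, h.head]
  · simp [List.getLast?_append, h'.last]

theorem cons {l : List V} {x a b : V} (hadj : G.Adj x a) (h : PathList G l a b) :
    PathList G (x :: l) x b := (singleton x).append h hadj

theorem reverse {l : List V} {a b : V} (h : PathList G l a b) : PathList G l.reverse b a := by
  refine ⟨?_, by simp [h.last], by simp [h.head]⟩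
  rw [List.isChain_reverse]
  exact h.chain.imp fun _ _ h => h.symm

theorem seg {c : ℤ → V} (hadj : ∀ i, G.Adj (c i) (c (i + 1))) {s e : ℤ} (h : s ≤ e) :
    PathList G (seg c s e) (c s) (c e) := by
  refine ⟨?_, head?_seg h, getLast?_seg h⟩
  rw [List.isChain_iff_getElem]
  intro i hi
  simp only [_root_.seg, List.getElem_map, List.getElem_range]
  have := hadj (s + i)
  push_cast
  rwa [← add_assoc]

end PathList

/-- The list `l` enumerates the vertices of a cycle of `G`, in order. -/
structure IsCyc (G : SimpleGraph V) (l : List V) : Prop where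
  three : 3 ≤ l.length
  nodup : l.Nodup
  chain : l.IsChain G.Adj
  close : ∀ a ∈ l.getLast?, ∀ b ∈ l.head?, G.Adj a b

theorem PathList.isCyc {l : List V} {a b : V} (h : PathList G l a b) (hadj : G.Adj b a)
    (h3 : 3 ≤ l.length) (hnd : l.Nodup) : IsCyc G l := by
  refine ⟨h3, hnd, h.chain, ?_⟩
  rw [h.last, h.head]
  rintro x ⟨⟩ y ⟨⟩
  exact hadj

theorem IsCyc.isHamiltonian [Fintype V] [DecidableEq V] {l : List V} (h : IsCyc G l)
    (hall : ∀ v, v ∈ l) : G.IsHamiltonian := by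
  intro _
  have hne : l ≠ [] := by rintro rfl; have := h.three; simp at this
  let p := Walk.ofSupport l hne h.chain
  have hs : p.support = l := Walk.support_ofSupport ..
  have hadj : G.Adj (l.getLast hne) (l.head hne) :=
    h.close _ (by simp [List.getLast?_eq_some_getLast hne])
      _ (by simp [List.head?_eq_some_head hne])
  have hp : p.IsPath := by rw [Walk.isPath_def, hs]; exact h.nodup
  refine ⟨_, Walk.cons hadj p, ?_⟩
  rw [Walk.isHamiltonianCycle_iff_isCycle_and_support_count_tail_eq_one]
  constructor
  · rw [Walk.cons_isCycle_iff]
    refine ⟨hp, fun hmem => ?_⟩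
    rw [Sym2.eq_swap] at hmem
    have h1 := hp.length_eq_one_of_mem_edges hmem
    have h2 := p.length_support
    rw [hs, h1] at h2
    have := h.three
    omega
  · intro a
    rw [Walk.support_cons, List.tail_cons, hs]
    exact List.count_eq_one_of_mem h.nodup (hall a)

/-- The function `c` traverses a cycle of length `N` periodically. -/
structure CycFn (G : SimpleGraph V) (c : ℤ → V) (N : ℕ) : Prop where
  three : 3 ≤ N
  per : ∀ i, c (i + N) = c i
  inj : ∀ i j, c i = c j → (N : ℤ) ∣ i - j
  adj : ∀ i, G.Adj (c i) (c (i + 1))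

namespace CycFn

variable {c : ℤ → V} {N : ℕ}

theorem per_sub (h : CycFn G c N) (i : ℤ) : c (i - N) = c i := by
  rw [← h.per (i - N), sub_add_cancel]

theorem per_mul (h : CycFn G c N) (i k : ℤ) : c (i + N * k) = c i := by
  induction k using Int.induction_on with
  | zero => simp
  | succ k ih => rw [mul_add, mul_one, ← add_assoc, h.per, ih]
  | pred k ih => rw [mul_sub, mul_one, ← add_sub_assoc, h.per_sub, ih]

theorem eq_of_close (h : CycFn G c N) {i j : ℤ} (hij : c i = c j) (h1 : i < j + N)
    (h2 : j < i + N) : i = j := by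
  obtain ⟨d, hd⟩ := h.inj _ _ hij
  have : d = 0 := by
    by_contra hne
    rcases lt_or_gt_of_ne hne with hlt | hlt
    · have : (N : ℤ) * d ≤ N * (-1) := by gcongr; omega
      omega
    · have : (N : ℤ) * 1 ≤ N * d := by gcongr; omega
      omega
  subst this; omega

theorem ne_of_lt (h : CycFn G c N) {i j : ℤ} (h1 : i < j) (h2 : j < i + N) : c i ≠ c j :=
  fun hij => by have := h.eq_of_close hij (by omega) h2; omega

/-- Every position has a representative in a given window of length `N`. -/
theorem exists_rep (h : CycFn G c N) (s i : ℤ) : ∃ j, s ≤ j ∧ j < s + N ∧ c j = c i := by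
  have hN : (0 : ℤ) < N := by have := h.three; omega
  refine ⟨s + (i - s) % N, ?_, ?_, ?_⟩
  · have := Int.emod_nonneg (i - s) hN.ne'; omega
  · have := Int.emod_lt_of_pos (i - s) hN; omega
  · rw [← h.per_mul (s + (i - s) % N) ((i - s) / N)]
    congr 1
    have := Int.emod_add_mul_ediv (i - s) N
    omega

theorem add_congr (h : CycFn G c N) {i j : ℤ} (hij : c i = c j) (m : ℤ) :
    c (i + m) = c (j + m) := by
  obtain ⟨d, hd⟩ := h.inj _ _ hij
  rw [← h.per_mul (j + m) d]
  congr 1; omega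

theorem neg (h : CycFn G c N) : CycFn G (fun i => c (-i)) N := by
  refine ⟨h.three, fun i => ?_, fun i j hij => ?_, fun i => ?_⟩
  · rw [← h.per (-(i + N))]; congr 1; omega
  · have := h.inj _ _ hij
    rw [← dvd_neg]
    rwa [show -(i - j) = -i - -j by ring]
  · have := (h.adj (-(i + 1))).symm
    convert this using 2; omega

end CycFn

theorem IsCyc.exists_cycFn {l : List V} (h : IsCyc G l) :
    ∃ c : ℤ → V, CycFn G c l.length ∧ (∀ i : ℕ, i < l.length → l[i]? = some (c i)) ∧
      l.getLast? = some (c (-1)) ∧ ∀ v, v ∈ l ↔ ∃ i, c i = v := by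
  have h3 := h.three
  have hN : (0 : ℤ) < l.length := by omega
  have hlt : ∀ i : ℤ, (i % l.length).toNat < l.length := fun i => by
    have h1 := Int.emod_nonneg i hN.ne'
    have h2 := Int.emod_lt_of_pos i hN
    omega
  let c : ℤ → V := fun i => l[(i % l.length).toNat]'(hlt i)
  have hc : ∀ i : ℕ, ∀ hi : i < l.length, c i = l[i] := fun i hi => by
    have : ((i : ℤ) % l.length).toNat = i := by rw [Int.emod_eq_of_lt] <;> omega
    simp only [c, this]
  have hper : ∀ i, c (i + l.length) = c i := fun i => by simp only [c, Int.add_emod_right]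
  have hlast : l.getLast? = some (c (-1)) := by
    rw [← hper (-1), List.getLast?_eq_getElem?, List.getElem?_eq_getElem (by omega), ← hc]
    congr 2; omega
  refine ⟨c, ⟨h3, hper, fun i j hij => ?_, fun i => ?_⟩, fun i hi => ?_, hlast, fun v => ?_⟩
  · have h1 := (List.Nodup.getElem_inj_iff h.nodup).1 hij
    have h2 := Int.emod_nonneg i hN.ne'
    have h3 := Int.emod_nonneg j hN.ne'
    exact Int.ModEq.dvd (show j ≡ i [ZMOD l.length] by unfold Int.ModEq; omega)
  · have h1 := Int.emod_nonneg i hN.ne'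
    have h2 := Int.emod_lt_of_pos i hN
    by_cases hi : i % l.length + 1 < l.length
    · have h4 : ((i + 1) % l.length) = i % l.length + 1 := by
        rw [Int.add_emod, Int.emod_eq_of_lt (a := 1) (by omega) (by omega),
          Int.emod_eq_of_lt (by omega) hi]
      have := (List.isChain_iff_getElem.1 h.chain) (i % l.length).toNat (by omega)
      simp only [c, h4]
      convert this using 2
      omega
    · have h4 : ((i + 1) % l.length) = 0 := by
        have : i % l.length + 1 = l.length := by omega
        rw [Int.add_emod, Int.emod_eq_of_lt (a := 1) (by omega) (by omega), this, Int.emod_self]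
      refine h.close _ ?_ _ ?_
      · rw [List.getLast?_eq_getElem?, List.getElem?_eq_getElem (by omega)]
        simp only [c, Option.mem_def, Option.some.injEq]
        congr 1; omega
      · rw [List.head?_eq_getElem?, List.getElem?_eq_getElem (by omega)]
        simp [c, h4]
  · rw [List.getElem?_eq_getElem hi, hc]
  · constructor
    · intro hv
      obtain ⟨i, hi, rfl⟩ := List.getElem_of_mem hv
      exact ⟨i, hc i hi⟩
    · rintro ⟨i, rfl⟩
      exact List.getElem_mem _

end PathLists

/-- Pairwise nonadjacent disjoint nonempty sets `P i` leave at least `t` vertices per set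
outside their union. -/
theorem Tough.mul_card_add_sum_le {V : Type*} [Fintype V] {t : ℝ} {G : SimpleGraph V}
    (h : Tough t G) (ht : 0 < t) {ι : Type*} [Fintype ι] (hι : 2 ≤ Fintype.card ι)
    (P : ι → Finset V) (hne : ∀ i, (P i).Nonempty)
    (hsep : ∀ i j, i ≠ j → ∀ u ∈ P i, ∀ v ∈ P j, u ≠ v ∧ ¬ G.Adj u v) :
    t * Fintype.card ι + ((∑ i, (P i).card : ℕ) : ℝ) ≤ Fintype.card V := by
  classical
  have hdisj : ∀ i j, i ≠ j → Disjoint (P i) (P j) := fun i j hij =>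
    Finset.disjoint_left.2 fun v hi hj => (hsep i j hij v hi v hj).1 rfl
  let S : Finset V := (Finset.univ.biUnion P)ᶜ
  have hS : ∀ v, v ∈ (S : Set V)ᶜ ↔ ∃ i, v ∈ P i := by simp [S]
  have hcard : S.card + ∑ i, (P i).card = Fintype.card V := by
    rw [← Finset.card_biUnion fun i _ j _ hij => hdisj i j hij, Finset.card_compl_add_card]
  choose f hf using fun v : ((S : Set V)ᶜ : Set V) => (hS v).1 v.2
  have hreach : ∀ u v, (G.induce (S : Set V)ᶜ).Reachable u v → f u = f v := by
    rintro u v ⟨w⟩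
    induction w with
    | nil => rfl
    | cons hadj _ ih =>
      rw [← ih]
      by_contra hne
      exact (hsep _ _ hne _ (hf _) _ (hf _)).2 hadj
  choose r hr using hne
  let g : ι → (G.induce (S : Set V)ᶜ).ConnectedComponent := fun i =>
    (G.induce (S : Set V)ᶜ).connectedComponentMk ⟨r i, (hS _).2 ⟨i, hr i⟩⟩
  have hfr : ∀ i, f ⟨r i, (hS _).2 ⟨i, hr i⟩⟩ = i := fun i => by
    by_contra hne
    exact (hsep _ _ hne _ (hf _) _ (hr i)).1 rfl
  have hg : Function.Injective g := fun i j hij => by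
    have := hreach _ _ (ConnectedComponent.exact hij)
    rwa [hfr, hfr] at this
  have hle : Fintype.card ι ≤ numComp G (S : Set V) := by
    rw [← Nat.card_eq_fintype_card]
    exact Nat.card_le_card_of_injective g hg
  have h1 := h S (hι.trans hle)
  have h2 : t * Fintype.card ι ≤ t * numComp G (S : Set V) := by gcongr
  have h3 : (S.card : ℝ) + ((∑ i, (P i).card : ℕ) : ℝ) = Fintype.card V := by exact_mod_cast hcard
  linarith

/-- If all vertices outside `A` have neighborhood `A`, then `G` is the join of the subgraph
on `A` with an edgeless graph. -/
theorem exists_iso_graphJoin {V : Type*} [Fintype V] {G : SimpleGraph V} (A : Finset V) {m : ℕ}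
    (hA : A.card = m) (hV : Fintype.card V = 2 * m + 1)
    (hN : ∀ v ∉ A, ∀ u, G.Adj v u ↔ u ∈ A) :
    ∃ H : SimpleGraph (Fin m), Nonempty (G ≃g graphJoin H (⊥ : SimpleGraph (Fin (m + 1)))) := by
  classical
  have h1 : Fintype.card {v // v ∈ A} = m := by simpa using hA
  have h2 : Fintype.card {v // v ∉ A} = m + 1 := by
    rw [Fintype.card_subtype_compl, h1, hV]; omega
  let e₁ := (Fintype.equivFinOfCardEq h1).symm
  let e₂ := (Fintype.equivFinOfCardEq h2).symm
  let f : Fin m ⊕ Fin (m + 1) ≃ V := (e₁.sumCongr e₂).trans (Equiv.sumCompl (· ∈ A))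
  have hl : ∀ i, f (Sum.inl i) = e₁ i := fun i => by simp [f]
  have hr : ∀ i, f (Sum.inr i) = e₂ i := fun i => by simp [f]
  refine ⟨G.comap fun i => (e₁ i : V), ⟨RelIso.symm ⟨f, ?_⟩⟩⟩
  rintro (i | i) (j | j)
  · simp only [hl]
    simp only [graphJoin, fromRel_adj]
    constructor
    · intro h
      refine ⟨fun hij => ?_, Or.inl (Or.inl ⟨i, j, rfl, rfl, h⟩)⟩
      cases hij
      exact G.irrefl h
    · rintro ⟨-, (⟨a, b, ha, hb, h⟩ | ⟨a, b, ha, hb, h⟩ | ⟨a, b, ha, hb⟩) |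
        (⟨a, b, ha, hb, h⟩ | ⟨a, b, ha, hb, h⟩ | ⟨a, b, ha, hb⟩)⟩ <;> cases ha <;> cases hb
      · exact h
      · exact h.symm
  · simp only [hl, hr]
    have := (hN _ (e₂ j).2 (e₁ i)).2 (e₁ i).2
    simp [graphJoin, this.symm]
  · simp only [hl, hr]
    have := (hN _ (e₂ i).2 (e₁ j)).2 (e₁ j).2
    simp [graphJoin, this]
  · simp only [hr]
    have : ¬ G.Adj (e₂ i) (e₂ j) := fun h => (e₂ j).2 ((hN _ (e₂ i).2 _).1 h)
    simp [graphJoin, this]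

/-- `b < b'` are consecutive positions of neighbors of `x` on `c`. -/
structure Next {V : Type*} (G : SimpleGraph V) (c : ℤ → V) (x : V) (b b' : ℤ) : Prop where
  left : G.Adj x (c b)
  right : G.Adj x (c b')
  lt : b < b'
  not_adj : ∀ i, b < i → i < b' → ¬ G.Adj x (c i)

theorem Next.neg {V : Type*} {G : SimpleGraph V} {c : ℤ → V} {x : V} {b b' : ℤ}
    (h : Next G c x b b') :
    Next G (fun i => c (-i)) x (-b') (-b) where
  left := by simpa using h.right
  right := by simpa using h.left
  lt := by have := h.lt; omega
  not_adj := fun i h1 h2 => h.not_adj _ (by omega) (by omega)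

theorem Next.le_of_adj {V : Type*} {G : SimpleGraph V} {c : ℤ → V} {x : V} {b b' : ℤ}
    (hb : Next G c x b b') {i : ℤ} (hi : G.Adj x (c i)) (h : b < i) :
    b' ≤ i := by
  by_contra hlt
  exact hb.not_adj i h (by omega) hi

theorem Next.le_of_adj' {V : Type*} {G : SimpleGraph V} {c : ℤ → V} {x : V} {b b' : ℤ}
    (hb : Next G c x b b') {i : ℤ} (hi : G.Adj x (c i)) (h : i < b') :
    i ≤ b := by
  by_contra hlt
  exact hb.not_adj i (by omega) h hi

theorem Next.add_period {V : Type*} {G : SimpleGraph V} {c : ℤ → V} {x : V} {b b' : ℤ} {N : ℕ}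
    (hb : Next G c x b b') (h : CycFn G c N) :
    Next G c x (b + N) (b' + N) where
  left := by rw [h.per]; exact hb.left
  right := by rw [h.per]; exact hb.right
  lt := by have := hb.lt; omega
  not_adj := fun i h1 h2 hi => hb.not_adj (i - N) (by omega) (by omega) (by rwa [h.per_sub])

theorem Next.sub_period {V : Type*} {G : SimpleGraph V} {c : ℤ → V} {x : V} {b b' : ℤ} {N : ℕ}
    (hb : Next G c x b b') (h : CycFn G c N) :
    Next G c x (b - N) (b' - N) where
  left := by rw [h.per_sub]; exact hb.left
  right := by rw [h.per_sub]; exact hb.right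
  lt := by have := hb.lt; omega
  not_adj := fun i h1 h2 hi => hb.not_adj (i + N) (by omega) (by omega) (by rwa [h.per])

section TightCycles

variable {V : Type*} [Fintype V] [DecidableEq V] {G : SimpleGraph V} {t : ℝ}

/-- If `I` is independent and `z ∉ I` has at most one neighbor `w` in `I`, then a tough graph has
more than `(t + 1) * |I|` vertices. -/
theorem Tough.lt_card_of_attached (h : Tough t G) (ht : 0 < t) {I : Finset V} (hI : 2 ≤ I.card)
    (hind : ∀ u ∈ I, ∀ v ∈ I, ¬ G.Adj u v) {z w : V} (hz : z ∉ I) (hw : w ∈ I)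
    (hzw : ∀ u ∈ I, u ≠ w → ¬ G.Adj z u) : (t + 1) * (I.card : ℝ) < Fintype.card V := by
  let P : I → Finset V := fun i => if (i : V) = w then {(i : V), z} else {(i : V)}
  have hP : ∀ i : I, ∀ u, u ∈ P i ↔ u = i ∨ ((i : V) = w ∧ u = z) := by
    intro i u
    by_cases hi : (i : V) = w <;> simp [P, hi]
  have hcard : ∑ i, (P i).card = I.card + 1 := by
    have : ∀ i : I, (P i).card = 1 + if i = ⟨w, hw⟩ then 1 else 0 := by
      rintro ⟨i, hi⟩
      by_cases hiw : i = w
      · subst hiw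
        have : i ≠ z := fun h => hz (h ▸ hi)
        simp [P, this]
      · simp [P, hiw]
    simp [this, Finset.sum_add_distrib]
  have key := h.mul_card_add_sum_le ht (by simpa using hI) P
    (fun i => ⟨i, (hP _ _).2 (Or.inl rfl)⟩) (by
      rintro ⟨i, hi⟩ ⟨j, hj⟩ hij u hu v hv
      have hij : i ≠ j := fun h => hij (Subtype.ext h)
      rw [hP] at hu hv
      rcases hu with rfl | ⟨rfl, rfl⟩ <;> rcases hv with rfl | ⟨rfl, rfl⟩
      · exact ⟨hij, hind _ hi _ hj⟩
      · exact ⟨fun h => hz (h ▸ hi), fun h => hzw _ hi hij h.symm⟩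
      · exact ⟨fun h => hz (h ▸ hj), hzw _ hj hij.symm⟩
      · exact absurd rfl hij)
  rw [hcard] at key
  simp only [Fintype.card_coe] at key
  push_cast at key
  linarith

/-- The situation of an almost spanning cycle `c` avoiding only `x`, in the boundary case of the
degree condition. -/
structure Tight (G : SimpleGraph V) (t : ℝ) (c : ℤ → V) (N : ℕ) (x : V) (k : ℕ) : Prop where
  tpos : 0 < t
  tough : Tough t G
  nonham : ¬ G.IsHamiltonian
  sigma : ∀ u v, u ≠ v → ¬ G.Adj u v →
    2 * k ≤ Nat.card (G.neighborSet u) + Nat.card (G.neighborSet v)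
  two_le : 2 ≤ k
  card_eq : (Fintype.card V : ℝ) = (t + 1) * (k + 1)
  cyc : CycFn G c N
  ne_x : ∀ i, c i ≠ x
  cover : ∀ v, v ≠ x → ∃ i, c i = v
  deg : Nat.card (G.neighborSet x) = k

namespace Tight

variable {c : ℤ → V} {N : ℕ} {x : V} {k : ℕ}

theorem neg (h : Tight G t c N x k) : Tight G t (fun i => c (-i)) N x k :=
  { h with
    cyc := h.cyc.neg
    ne_x := fun i => h.ne_x _
    cover := fun v hv => by
      obtain ⟨i, hi⟩ := h.cover v hv
      exact ⟨-i, by simpa using hi⟩ }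

theorem le_degree (h : Tight G t c N x k) {y : V} (hy : y ≠ x) (hxy : ¬ G.Adj x y) :
    k ≤ Nat.card (G.neighborSet y) := by
  have := h.sigma x y hy.symm hxy
  have := h.deg
  omega

theorem adj_per (h : Tight G t c N x k) {i : ℤ} (hi : G.Adj x (c i)) :
    G.Adj x (c (i + N)) := by rwa [h.cyc.per]

theorem adj_per_sub (h : Tight G t c N x k) {i : ℤ} (hi : G.Adj x (c i)) :
    G.Adj x (c (i - N)) := by rwa [h.cyc.per_sub]

theorem nodup_cons_seg (h : Tight G t c N x k) (s : ℤ) :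
    (x :: seg c (s + 1) (s + N)).Nodup := by
  rw [List.nodup_cons, mem_seg]
  refine ⟨?_, nodup_seg h.cyc.inj (by omega)⟩
  rintro ⟨i, -, -, hi⟩
  exact h.ne_x i hi

theorem mem_cons_seg (h : Tight G t c N x k) (s : ℤ) (v : V) :
    v ∈ x :: seg c (s + 1) (s + N) := by
  rw [List.mem_cons, mem_seg]
  by_cases hv : v = x
  · exact Or.inl hv
  · obtain ⟨i, rfl⟩ := h.cover v hv
    obtain ⟨j, h1, h2, h3⟩ := h.cyc.exists_rep (s + 1) i
    exact Or.inr ⟨j, h1, by omega, h3⟩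

/-- No rearrangement of all vertices closes up to a cycle. -/
theorem not_perm (h : Tight G t c N x k) {l : List V} {a b : V} (hl : PathList G l a b)
    (hadj : G.Adj b a) (s : ℤ) (hperm : l.Perm (x :: seg c (s + 1) (s + N))) : False := by
  refine h.nonham (IsCyc.isHamiltonian (hl.isCyc hadj ?_ ?_) fun v => ?_)
  · rw [hperm.length_eq]
    have := h.cyc.three
    simp; omega
  · exact hperm.nodup_iff.2 (h.nodup_cons_seg s)
  · exact hperm.mem_iff.2 (h.mem_cons_seg s v)

theorem card_eq_succ (h : Tight G t c N x k) : Fintype.card V = N + 1 := by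
  have h1 := List.toFinset_card_of_nodup (h.nodup_cons_seg 0)
  have h2 : (x :: seg c (0 + 1) (0 + N)).toFinset = Finset.univ := by
    ext v
    rw [List.mem_toFinset]
    simp only [Finset.mem_univ, iff_true]
    exact h.mem_cons_seg 0 v
  rw [h2, Finset.card_univ] at h1
  simp at h1
  omega

theorem not_adj_succ (h : Tight G t c N x k) {p : ℤ} (hp : G.Adj x (c p)) :
    ¬ G.Adj x (c (p + 1)) := by
  intro hp'
  have h3 := h.cyc.three
  have hl : PathList G (x :: seg c (p + 1) (p + N)) x (c (p + N)) :=
    (PathList.seg h.cyc.adj (by omega)).cons hp'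
  exact h.not_perm hl (by rw [h.cyc.per]; exact hp.symm) p (List.Perm.refl _)

theorem not_adj_pred (h : Tight G t c N x k) {p : ℤ} (hp : G.Adj x (c p)) :
    ¬ G.Adj x (c (p - 1)) := fun h' => h.not_adj_succ h' (by rwa [sub_add_cancel])

theorem not_adj_succ_succ (h : Tight G t c N x k) {p q : ℤ} (hp : G.Adj x (c p))
    (hq : G.Adj x (c q)) (h1 : p < q) (h2 : q < p + N) : ¬ G.Adj (c (p + 1)) (c (q + 1)) := by
  intro hadj
  have hX := PathList.seg h.cyc.adj (s := p + 1) (e := q) (by omega)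
  have hY := PathList.seg h.cyc.adj (s := q + 1) (e := p + N) (by omega)
  refine h.not_perm ((hX.reverse.append hY hadj).cons hq)
    (by rw [h.cyc.per]; exact hp.symm) p ?_
  rw [← seg_append (s := p + 1) (m := q) (e := p + N) (by omega) (by omega), List.perm_iff_count]
  intro a
  simp [List.count_cons]

theorem not_adj_succ_succ' (h : Tight G t c N x k) {p q : ℤ} (hp : G.Adj x (c p))
    (hq : G.Adj x (c q)) : ¬ G.Adj (c (p + 1)) (c (q + 1)) := by
  intro hadj
  obtain ⟨j, h1, h2, h3⟩ := h.cyc.exists_rep p q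
  rcases h1.eq_or_lt with rfl | h1
  · rw [h.cyc.add_congr h3] at hadj
    exact G.irrefl hadj
  · exact h.not_adj_succ_succ hp (h3 ▸ hq) h1 h2 (by rwa [h.cyc.add_congr h3])

/-- Rerouting through `x` with one chord crossing. -/
theorem reroute_one (h : Tight G t c N x k) {s p q : ℤ} (h1 : s < p) (h2 : p < q)
    (h3 : q < s + N) (hp : G.Adj x (c p)) (hq : G.Adj x (c q))
    (ha : G.Adj (c (s + 1)) (c (q + 1))) (hb : G.Adj (c s) (c (p + 1))) : False := by
  have hX := PathList.seg h.cyc.adj (s := s + 1) (e := p) (by omega)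
  have hY := PathList.seg h.cyc.adj (s := p + 1) (e := q) (by omega)
  have hZ := PathList.seg h.cyc.adj (s := q + 1) (e := s + N) (by omega)
  refine h.not_perm ((hX.reverse.append (hZ.append hY (by rwa [h.cyc.per])) ha).cons hp)
    hq.symm s ?_
  rw [← seg_append (s := s + 1) (m := p) (e := s + N) (by omega) (by omega),
    ← seg_append (s := p + 1) (m := q) (e := s + N) (by omega) (by omega), List.perm_iff_count]
  intro a
  simp [List.count_cons]; omega

theorem reroute_two (h : Tight G t c N x k) {s p q : ℤ} (h1 : s < p) (h2 : p < q)
    (h3 : q < s + N) (hp : G.Adj x (c p)) (hq : G.Adj x (c (q + 1)))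
    (ha : G.Adj (c (s + 1)) (c q)) (hb : G.Adj (c s) (c (p + 1))) : False := by
  have hX := PathList.seg h.cyc.adj (s := s + 1) (e := p) (by omega)
  have hY := PathList.seg h.cyc.adj (s := p + 1) (e := q) (by omega)
  have hZ := PathList.seg h.cyc.adj (s := q + 1) (e := s + N) (by omega)
  refine h.not_perm ((hX.reverse.append
    (hY.reverse.append hZ.reverse (by rw [h.cyc.per]; exact hb.symm)) ha).cons hp) hq.symm s ?_
  rw [← seg_append (s := s + 1) (m := p) (e := s + N) (by omega) (by omega),
    ← seg_append (s := p + 1) (m := q) (e := s + N) (by omega) (by omega), List.perm_iff_count]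
  intro a
  simp [List.count_cons]

theorem reroute_three (h : Tight G t c N x k) {s p q : ℤ} (h1 : s < p) (h2 : p < q)
    (h3 : q < s + N) (hp : G.Adj x (c p)) (hq : G.Adj x (c (q + 1)))
    (ha : G.Adj (c (s + 1)) (c (p + 1))) (hb : G.Adj (c s) (c q)) : False := by
  have hX := PathList.seg h.cyc.adj (s := s + 1) (e := p) (by omega)
  have hY := PathList.seg h.cyc.adj (s := p + 1) (e := q) (by omega)
  have hZ := PathList.seg h.cyc.adj (s := q + 1) (e := s + N) (by omega)
  refine h.not_perm ((hX.reverse.append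
    (hY.append hZ.reverse (by rw [h.cyc.per]; exact hb.symm)) ha).cons hp) hq.symm s ?_
  rw [← seg_append (s := s + 1) (m := p) (e := s + N) (by omega) (by omega),
    ← seg_append (s := p + 1) (m := q) (e := s + N) (by omega) (by omega), List.perm_iff_count]
  intro a
  simp [List.count_cons]

/-- The vertex `x` together with the successors of its neighbors. -/
theorem exists_finset_succ (h : Tight G t c N x k) : ∃ I : Finset V, I.card = k + 1 ∧
    ∀ v, v ∈ I ↔ v = x ∨ ∃ p, G.Adj x (c p) ∧ c (p + 1) = v := by
  classical
  choose pos hpos using fun v : G.neighborSet x => h.cover v v.2.ne'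
  let f : G.neighborSet x → V := fun v => c (pos v + 1)
  have hf : Function.Injective f := fun u v huv => by
    have := h.cyc.add_congr huv (-1)
    simp only [add_neg_cancel_right, hpos] at this
    exact Subtype.ext this
  have hmem : ∀ v, v ∈ Finset.univ.image f ↔ ∃ p, G.Adj x (c p) ∧ c (p + 1) = v := by
    intro v
    simp only [Finset.mem_image, Finset.mem_univ, true_and]
    constructor
    · rintro ⟨a, rfl⟩
      exact ⟨pos a, by rw [hpos]; exact a.2, rfl⟩
    · rintro ⟨p, hp, rfl⟩
      exact ⟨⟨c p, hp⟩, h.cyc.add_congr (hpos ⟨c p, hp⟩) 1⟩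
  refine ⟨insert x (Finset.univ.image f), ?_, fun v => ?_⟩
  · rw [Finset.card_insert_of_notMem, Finset.card_image_of_injective _ hf, Finset.card_univ,
      ← Nat.card_eq_fintype_card, h.deg]
    rw [hmem]
    rintro ⟨p, -, hp⟩
    exact h.ne_x _ hp
  · rw [Finset.mem_insert, hmem]

theorem not_adj_of_mem_succ (h : Tight G t c N x k) {u v : V}
    (hu : u = x ∨ ∃ p, G.Adj x (c p) ∧ c (p + 1) = u)
    (hv : v = x ∨ ∃ p, G.Adj x (c p) ∧ c (p + 1) = v) : ¬ G.Adj u v := by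
  rcases hu with rfl | ⟨p, hp, rfl⟩ <;> rcases hv with rfl | ⟨q, hq, rfl⟩
  · exact G.irrefl
  · exact h.not_adj_succ hq
  · exact fun h' => h.not_adj_succ hp h'.symm
  · exact h.not_adj_succ_succ' hp hq

theorem exists_adj_succ (h : Tight G t c N x k) {s : ℤ} (hs : ¬ G.Adj x (c s))
    (hs' : ¬ G.Adj x (c (s - 1))) (w : V) (lo : ℤ) :
    ∃ p, lo ≤ p ∧ p < lo + N ∧ G.Adj x (c p) ∧ G.Adj (c s) (c (p + 1)) ∧ c (p + 1) ≠ w := by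
  suffices ∃ p, G.Adj x (c p) ∧ G.Adj (c s) (c (p + 1)) ∧ c (p + 1) ≠ w by
    obtain ⟨p, h1, h2, h3⟩ := this
    obtain ⟨j, hj1, hj2, hj3⟩ := h.cyc.exists_rep lo p
    refine ⟨j, hj1, hj2, ?_⟩
    rw [h.cyc.add_congr hj3, hj3]
    exact ⟨h1, h2, h3⟩
  by_contra hcon
  push Not at hcon
  obtain ⟨I, hIc, hI⟩ := h.exists_finset_succ
  have hk := h.two_le
  have hsI : c s ∉ I := by
    rw [hI]
    rintro (h' | ⟨p, hp, hps⟩)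
    · exact h.ne_x _ h'
    · have := h.cyc.add_congr hps (-1)
      rw [add_neg_cancel_right, ← sub_eq_add_neg] at this
      exact hs' (this ▸ hp)
  have key : ∃ w' ∈ I, ∀ u ∈ I, u ≠ w' → ¬ G.Adj (c s) u := by
    by_cases hw : w ∈ I
    · refine ⟨w, hw, fun u hu huw hadj => ?_⟩
      rcases (hI u).1 hu with rfl | ⟨p, hp, rfl⟩
      · exact hs hadj.symm
      · exact huw (hcon p hp hadj)
    · refine ⟨x, (hI x).2 (Or.inl rfl), fun u hu hux hadj => ?_⟩
      rcases (hI u).1 hu with rfl | ⟨p, hp, rfl⟩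
      · exact hux rfl
      · exact hw (hcon p hp hadj ▸ hu)
  obtain ⟨w', hw', hzw⟩ := key
  have := h.tough.lt_card_of_attached h.tpos (I := I) (by omega)
    (fun u hu v hv => h.not_adj_of_mem_succ ((hI u).1 hu) ((hI v).1 hv)) hsI hw' hzw
  rw [hIc, h.card_eq] at this
  push_cast at this
  exact lt_irrefl _ this

end Tight

end TightCycles

section TightCycles

variable {V : Type*} [Fintype V] [DecidableEq V] {G : SimpleGraph V} {t : ℝ}

namespace Tight

variable {c : ℤ → V} {N : ℕ} {x : V} {k : ℕ}

/-- The successor of a neighbor of `x` has no two consecutive neighbors on the cycle. -/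
theorem not_adj_consecutive (h : Tight G t c N x k) {p w : ℤ} (hp : G.Adj x (c p))
    (h1 : p + 2 ≤ w) (h2 : w < p + N) (hw : G.Adj (c (p + 1)) (c w))
    (hw' : G.Adj (c (p + 1)) (c (w + 1))) : False := by
  have hU := PathList.seg h.cyc.adj (s := p + 1) (e := p + 1) le_rfl
  by_cases hp2 : G.Adj x (c (p + 2))
  · have hX := PathList.seg h.cyc.adj (s := p + 2) (e := w) h1
    have hY := PathList.seg h.cyc.adj (s := w + 1) (e := p + N) (by omega)
    refine h.not_perm ((hX.append (hU.append hY hw') hw.symm).cons hp2)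
      (by rw [h.cyc.per]; exact hp.symm) p ?_
    rw [← seg_append (s := p + 1) (m := p + 1) (e := p + N) (by omega) (by omega),
      show p + 1 + 1 = p + 2 by ring,
      ← seg_append (s := p + 2) (m := w) (e := p + N) (by omega) (by omega), List.perm_iff_count]
    intro a
    simp only [List.count_cons, List.count_append]; omega
  · have hp1 := h.not_adj_succ hp
    obtain ⟨q, hq1, hq2, hq, hqa, hqn⟩ := h.exists_adj_succ hp2
      (by rwa [show p + 2 - 1 = p + 1 by ring]) (c (p + 1)) p
    have hqp : q ≠ p := by rintro rfl; exact hqn rfl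
    have hqp1 : q ≠ p + 1 := by rintro rfl; exact hp1 hq
    have hqp2 : q ≠ p + 2 := by rintro rfl; exact hp2 hq
    have hnadj := h.not_adj_succ_succ' hp hq
    have hwq : w ≠ q := by rintro rfl; exact hnadj hw'
    rcases lt_or_gt_of_ne hwq with hlt | hlt
    · have hX := PathList.seg h.cyc.adj (s := p + 2) (e := w) h1
      have hY := PathList.seg h.cyc.adj (s := w + 1) (e := q) (by omega)
      have hZ := PathList.seg h.cyc.adj (s := q + 1) (e := p + N) (by omega)
      refine h.not_perm (hX.append (hU.append (hY.append ((hZ.reverse).cons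
        (by rwa [h.cyc.per])) hq.symm) hw') hw.symm) hqa.symm p ?_
      rw [← seg_append (s := p + 1) (m := p + 1) (e := p + N) (by omega) (by omega),
        show p + 1 + 1 = p + 2 by ring,
        ← seg_append (s := p + 2) (m := w) (e := p + N) (by omega) (by omega),
        ← seg_append (s := w + 1) (m := q) (e := p + N) (by omega) (by omega),
        List.perm_iff_count]
      intro a
      simp only [List.count_cons, List.count_append, List.count_reverse]; omega
    · have hX := PathList.seg h.cyc.adj (s := p + 2) (e := q) (by omega)
      have hY := PathList.seg h.cyc.adj (s := q + 1) (e := w) (by omega)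
      have hZ := PathList.seg h.cyc.adj (s := w + 1) (e := p + N) (by omega)
      refine h.not_perm (hX.append (((hZ.reverse).append (hU.append hY.reverse hw)
        hw'.symm).cons (by rwa [h.cyc.per])) hq.symm) hqa.symm p ?_
      rw [← seg_append (s := p + 1) (m := p + 1) (e := p + N) (by omega) (by omega),
        show p + 1 + 1 = p + 2 by ring,
        ← seg_append (s := p + 2) (m := q) (e := p + N) (by omega) (by omega),
        ← seg_append (s := q + 1) (m := w) (e := p + N) (by omega) (by omega),
        List.perm_iff_count]
      intro a
      simp only [List.count_cons, List.count_append, List.count_reverse]; omega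

section Block

variable {b b' : ℤ}

theorem next_le (h : Tight G t c N x k) (hb : Next G c x b b') : b' ≤ b + N :=
  hb.le_of_adj (h.adj_per hb.left) (by have := h.cyc.three; omega)

theorem add_two_le_next (h : Tight G t c N x k) (hb : Next G c x b b') : b + 2 ≤ b' := by
  have := hb.lt
  have : b' ≠ b + 1 := by rintro rfl; exact h.not_adj_succ hb.left hb.right
  omega

theorem next_lt (h : Tight G t c N x k) (hb : Next G c x b b') : b' < b + N := by
  have hk : 1 < (G.neighborSet x).ncard := by
    have := h.deg
    have := h.two_le
    rw [← Nat.card_coe_set_eq]; omega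
  obtain ⟨y, hy, hyb⟩ := (Set.one_lt_ncard_iff_nontrivial.1 hk).exists_ne (c b)
  obtain ⟨i, rfl⟩ := h.cover y (G.ne_of_adj hy).symm
  obtain ⟨j, h1, h2, h3⟩ := h.cyc.exists_rep b i
  have hjb : j ≠ b := by rintro rfl; exact hyb h3.symm
  have := hb.le_of_adj (i := j) (by rw [h3]; exact hy) (by omega)
  omega

theorem exists_next (h : Tight G t c N x k) (hb : G.Adj x (c b)) : ∃ b', Next G c x b b' := by
  have h3 := h.cyc.three
  obtain ⟨b', ⟨h1, h2⟩, hmin⟩ := Int.exists_least_of_bdd (P := fun i => b < i ∧ G.Adj x (c i))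
    ⟨b, fun z hz => hz.1.le⟩ ⟨b + N, by omega, h.adj_per hb⟩
  exact ⟨b', hb, h2, h1, fun i hi1 hi2 hi => by have := hmin i ⟨hi1, hi⟩; omega⟩

theorem exists_prev (h : Tight G t c N x k) (hb : G.Adj x (c b)) : ∃ b0, Next G c x b0 b := by
  have h3 := h.cyc.three
  obtain ⟨b', ⟨h1, h2⟩, hmax⟩ := Int.exists_greatest_of_bdd
    (P := fun i => i < b ∧ G.Adj x (c i)) ⟨b, fun z hz => hz.1.le⟩
    ⟨b - N, by omega, h.adj_per_sub hb⟩
  exact ⟨b', h2, hb, h1, fun i hi1 hi2 hi => by have := hmax i ⟨hi2, hi⟩; omega⟩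

theorem mono_succ (h : Tight G t c N x k) {s p q : ℤ} (hs : b + 2 ≤ s)
    (hs' : s + 1 ≤ b') (hp : G.Adj x (c p)) (hq : G.Adj x (c q)) (hp1 : b' - N ≤ p)
    (hq2 : q ≤ b) (hsp : G.Adj (c s) (c (p + 1))) (hsq : G.Adj (c (s + 1)) (c (q + 1))) :
    q ≤ p := by
  by_contra hlt
  refine h.reroute_one (s := s) (p := p + N) (q := q + N) (by omega) (by omega) (by omega)
    (h.adj_per hp) (h.adj_per hq) ?_ ?_
  · rwa [show q + N + 1 = q + 1 + N by ring, h.cyc.per]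
  · rwa [show p + N + 1 = p + 1 + N by ring, h.cyc.per]

theorem exists_adj_succ_block (h : Tight G t c N x k) (hb : Next G c x b b') {s : ℤ}
    (hs : b + 2 ≤ s) (hs' : s ≤ b') :
    ∃ p, b' - N ≤ p ∧ p ≤ b ∧ G.Adj x (c p) ∧ G.Adj (c s) (c (p + 1)) := by
  rcases hs'.eq_or_lt with rfl | hlt
  · refine ⟨s - N, le_rfl, by have := h.next_le hb; omega, h.adj_per_sub hb.right, ?_⟩
    rw [show s - N + 1 = s + 1 - N by ring, h.cyc.per_sub]
    exact h.cyc.adj s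
  · obtain ⟨p, h1, h2, h3, h4, -⟩ := h.exists_adj_succ (hb.not_adj s (by omega) hlt)
      (hb.not_adj _ (by omega) (by omega)) x (b' - N)
    exact ⟨p, h1, hb.le_of_adj' h3 (by omega), h3, h4⟩

theorem mono (h : Tight G t c N x k) (hb : Next G c x b b') {s s' p q : ℤ} (hs : b + 2 ≤ s)
    (hss' : s < s') (hs' : s' ≤ b') (hp : G.Adj x (c p)) (hq : G.Adj x (c q)) (hp1 : b' - N ≤ p)
    (hq2 : q ≤ b) (hsp : G.Adj (c s) (c (p + 1))) (hsq : G.Adj (c s') (c (q + 1))) :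
    q ≤ p := by
  obtain ⟨m, rfl⟩ : ∃ m : ℕ, s' = s + 1 + m := ⟨(s' - s - 1).toNat, by omega⟩
  induction m generalizing q with
  | zero => exact h.mono_succ hs (by simpa using hs') hp hq hp1 hq2 hsp (by simpa using hsq)
  | succ m ih =>
    push_cast at hs' hsq
    obtain ⟨r, hr1, hr2, hr, hra⟩ := h.exists_adj_succ_block hb (s := s + 1 + m) (by omega)
      (by omega)
    have h1 := ih hr hr2 (by omega) (by omega) hra
    have h2 := h.mono_succ (s := s + 1 + m) (by omega) (by omega) hr hq hr1 hq2 hra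
      (by rwa [← add_assoc] at hsq)
    omega

theorem adj_succ_unique (h : Tight G t c N x k) (hb : Next G c x b b') {s s' p : ℤ}
    (hs : b + 2 ≤ s) (hss' : s < s') (hs' : s' ≤ b') (hp : G.Adj x (c p)) (hp1 : b' - N ≤ p)
    (hp2 : p ≤ b) (hsp : G.Adj (c s) (c (p + 1))) (hsp' : G.Adj (c s') (c (p + 1))) : False := by
  suffices G.Adj (c (s + 1)) (c (p + 1)) from
    h.not_adj_consecutive hp (w := s) (by omega) (by omega) hsp.symm this.symm
  rcases (Int.add_one_le_of_lt hss').eq_or_lt with rfl | hlt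
  · exact hsp'
  · obtain ⟨r, hr1, hr2, hr, hra⟩ := h.exists_adj_succ_block hb (s := s + 1) (by omega)
      (by omega)
    have h1 := h.mono hb hs (by omega) (by omega) hp hr hp1 hr2 hsp hra
    have h2 := h.mono hb (by omega) hlt hs' hr hp hr1 hp2 hra hsp'
    obtain rfl : r = p := by omega
    exact hra

/-- Neighbors of the successor of a neighbor of `x` can be located relative to the blocks. -/
theorem exists_base (h : Tight G t c N x k) {p : ℤ} (hp : G.Adj x (c p)) {y : V}
    (hy : G.Adj (c (p + 1)) y) : ∃ s β β', Next G c x β β' ∧ p ≤ β ∧ β < p + N ∧ β + 2 ≤ s ∧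
      s ≤ β' ∧ c s = y := by
  have hyx : y ≠ x := by
    rintro rfl
    exact h.not_adj_succ hp hy.symm
  obtain ⟨i, rfl⟩ := h.cover y hyx
  obtain ⟨s, hs1, hs2, hs⟩ := h.cyc.exists_rep (p + 1) i
  have hsp : s ≠ p + 1 := by rintro rfl; rw [hs] at hy; exact G.irrefl hy
  obtain ⟨β, ⟨h1, h2⟩, hmax⟩ := Int.exists_greatest_of_bdd
    (P := fun i => i < s ∧ G.Adj x (c i)) ⟨s, fun z hz => hz.1.le⟩ ⟨p, by omega, hp⟩
  have hβ := hmax p ⟨by omega, hp⟩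
  obtain ⟨β', hβ'⟩ := h.exists_next h2
  refine ⟨s, β, β', hβ', hβ, by omega, ?_, ?_, hs⟩
  · have : s ≠ β + 1 := by
      rintro rfl
      rw [← hs] at hy
      exact h.not_adj_succ_succ' hp h2 hy
    omega
  · by_contra hlt
    have := hmax β' ⟨by omega, hβ'.right⟩
    have := hβ'.lt
    omega

theorem exists_adj_and_degree (h : Tight G t c N x k) (hb : Next G c x b b') {p : ℤ}
    (hp : G.Adj x (c p)) (hp1 : b' - N ≤ p) (hp2 : p ≤ b) :
    (∃ s, b + 2 ≤ s ∧ s ≤ b' ∧ G.Adj (c s) (c (p + 1))) ∧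
      Nat.card (G.neighborSet (c (p + 1))) = k := by
  choose S B B' hN h1 h2 h3 h4 hS using
    fun y : G.neighborSet (c (p + 1)) => h.exists_base hp y.2
  let f : G.neighborSet (c (p + 1)) → G.neighborSet x := fun y => ⟨c (B y), (hN y).left⟩
  have hf : Function.Injective f := by
    intro y y' hyy
    have hB : B y = B y' := h.cyc.eq_of_close (congrArg Subtype.val hyy)
      (by have := h2 y; have := h1 y'; omega) (by have := h2 y'; have := h1 y; omega)
    have key : ∀ y y', B y = B y' → ¬ S y < S y' := by
      intro y y' hB hlt
      have hle := (hN y').le_of_adj (h.adj_per hp) (h2 y')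
      refine h.adj_succ_unique (hN y') (hB ▸ h3 y) hlt (h4 y') hp (by omega) (h1 y') ?_ ?_
      · rw [hS]; exact y.2.symm
      · rw [hS]; exact y'.2.symm
    have hSS : S y = S y' := le_antisymm (not_lt.1 (key y' y hB.symm)) (not_lt.1 (key y y' hB))
    exact Subtype.ext (by rw [← hS y, ← hS y', hSS])
  have hdeg := h.le_degree (h.ne_x (p + 1)) (h.not_adj_succ hp)
  have hbij := hf.bijective_of_nat_card_le (by rw [h.deg]; exact hdeg)
  refine ⟨?_, by rw [Nat.card_congr (Equiv.ofBijective f hbij), h.deg]⟩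
  obtain ⟨y, hy⟩ := hbij.2 ⟨c b, hb.left⟩
  have hyb : c (B y) = c b := congrArg Subtype.val hy
  have hle := h.next_lt hb
  have hB : B y = b := h.cyc.eq_of_close hyb
      (by have := h2 y; omega) (by have := h1 y; have := hb.lt; omega)
  have hB' : B' y = b' := by
    have e1 := hb.le_of_adj (hN y).right (hB ▸ (hN y).lt)
    have e2 := (hN y).le_of_adj hb.right (hB.symm ▸ hb.lt)
    omega
  refine ⟨S y, hB ▸ h3 y, hB' ▸ h4 y, ?_⟩
  rw [hS]; exact y.2.symm

end Block

end Tight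

end TightCycles

section TightCycles

variable {V : Type*} [Fintype V] [DecidableEq V] {G : SimpleGraph V} {t : ℝ}

namespace Tight

variable {c : ℤ → V} {N : ℕ} {x : V} {k : ℕ} {b b' : ℤ}

theorem adj_pred_unique (h : Tight G t c N x k) (hb : Next G c x b b') {s s' q : ℤ}
    (hs : b ≤ s) (hss' : s < s') (hs' : s' ≤ b' - 2) (hq : G.Adj x (c q)) (hq1 : b' ≤ q)
    (hq2 : q ≤ b + N) (hsq : G.Adj (c s) (c (q - 1))) (hsq' : G.Adj (c s') (c (q - 1))) :
    False := by
  refine h.neg.adj_succ_unique hb.neg (s := -s') (s' := -s) (p := -q) (by omega) (by omega)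
    (by omega) (by simpa using hq) (by omega) (by omega) ?_ ?_
  · simpa [sub_eq_add_neg, add_comm] using hsq'
  · simpa [sub_eq_add_neg, add_comm] using hsq

theorem mono_pred (h : Tight G t c N x k) (hb : Next G c x b b') {s s' q r : ℤ} (hs : b ≤ s)
    (hss' : s < s') (hs' : s' ≤ b' - 2) (hq : G.Adj x (c q)) (hr : G.Adj x (c r))
    (hq1 : b' ≤ q) (hr2 : r ≤ b + N) (hsq : G.Adj (c s) (c (q - 1)))
    (hsr : G.Adj (c s') (c (r - 1))) : r ≤ q := by
  have := h.neg.mono hb.neg (s := -s') (s' := -s) (p := -r) (q := -q) (by omega) (by omega)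
    (by omega) (by simpa using hr) (by simpa using hq) (by omega) (by omega)
    (by simpa [sub_eq_add_neg, add_comm] using hsr)
    (by simpa [sub_eq_add_neg, add_comm] using hsq)
  omega

theorem exists_adj_pred_block (h : Tight G t c N x k) (hb : Next G c x b b') {q : ℤ}
    (hq : G.Adj x (c q)) (hq1 : b' ≤ q) (hq2 : q ≤ b + N) :
    ∃ s, b ≤ s ∧ s ≤ b' - 2 ∧ G.Adj (c s) (c (q - 1)) := by
  obtain ⟨⟨s, h1, h2, h3⟩, -⟩ := h.neg.exists_adj_and_degree hb.neg (p := -q)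
    (by simpa using hq) (by omega) (by omega)
  exact ⟨-s, by omega, by omega, by simpa [sub_eq_add_neg, add_comm] using h3⟩

theorem exists_adj_pred (h : Tight G t c N x k) {s : ℤ} (hs : ¬ G.Adj x (c s))
    (hs' : ¬ G.Adj x (c (s + 1))) (w : V) (hi : ℤ) :
    ∃ q, hi - N < q ∧ q ≤ hi ∧ G.Adj x (c q) ∧ G.Adj (c s) (c (q - 1)) ∧ c (q - 1) ≠ w := by
  obtain ⟨p, h1, h2, h3, h4, h5⟩ := h.neg.exists_adj_succ (s := -s) (by simpa using hs)
    (by simpa [sub_eq_add_neg, add_comm] using hs') w (-hi)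
  refine ⟨-p, by omega, by omega, h3, ?_, ?_⟩
  · simpa [sub_eq_add_neg, add_comm] using h4
  · simpa [sub_eq_add_neg, add_comm] using h5

theorem not_adj_pred_next (h : Tight G t c N x k) (hb : Next G c x b b') (hlong : b + 3 ≤ b') :
    ¬ G.Adj (c (b - 1)) (c b') := by
  intro hadj
  obtain ⟨p, h1, h2, hp, hpa, hpn⟩ := h.exists_adj_succ (hb.not_adj (b' - 1) (by omega) (by omega))
    (hb.not_adj _ (by omega) (by omega)) (c (b + 1)) b'
  have hpb : p ≤ b + N := (hb.add_period h.cyc).le_of_adj' hp h2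
  have hpb' : p ≠ b + N := by
    rintro rfl
    rw [show b + N + 1 = b + 1 + N by ring, h.cyc.per] at hpn
    exact hpn rfl
  have hpb'' : p ≠ b + N - 1 := by
    rintro rfl
    exact h.not_adj_pred (h.adj_per hb.left) hp
  refine h.reroute_two (s := b' - 1) (p := p) (q := b + N - 1) (by omega) (by omega)
    (by omega) hp (by rw [sub_add_cancel]; exact h.adj_per hb.left) ?_ hpa
  rw [sub_add_cancel, show b + N - 1 = b - 1 + N by ring, h.cyc.per]
  exact hadj.symm

theorem not_adj_next_succ (h : Tight G t c N x k) (hb : Next G c x b b') (hlong : b + 3 ≤ b') :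
    ¬ G.Adj (c (b' + 1)) (c b) := by
  have := h.neg.not_adj_pred_next hb.neg (by omega)
  simpa [sub_eq_add_neg, add_comm] using this

theorem long_next (h : Tight G t c N x k) (hb : Next G c x b b') (hlong : b + 3 ≤ b') {b'' : ℤ}
    (hb' : Next G c x b' b'') : b' + 3 ≤ b'' := by
  have h2 := h.add_two_le_next hb'
  by_contra hlt
  obtain rfl : b'' = b' + 2 := by omega
  have hlt := h.next_lt hb
  have hle := hb'.le_of_adj (h.adj_per hb.left) hlt
  obtain ⟨s, h3, h4, h5⟩ := h.exists_adj_pred_block hb' (h.adj_per hb.left) hle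
    (by have := hb.lt; omega)
  obtain rfl : s = b' := by omega
  rw [show b + N - 1 = b - 1 + N by ring, h.cyc.per] at h5
  exact h.not_adj_pred_next hb hlong h5.symm

theorem long_prev (h : Tight G t c N x k) (hb : Next G c x b b') (hlong : b + 3 ≤ b') {b₀ : ℤ}
    (hb₀ : Next G c x b₀ b) : b₀ + 3 ≤ b := by
  have := h.neg.long_next hb.neg (by omega) hb₀.neg
  omega

theorem next_of_adj_add_three (h : Tight G t c N x k) (hb : G.Adj x (c b))
    (hb' : G.Adj x (c (b + 3))) : Next G c x b (b + 3) := by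
  refine ⟨hb, hb', by omega, fun i h1 h2 => ?_⟩
  obtain rfl | rfl : i = b + 1 ∨ i = b + 3 - 1 := by omega
  · exact h.not_adj_succ hb
  · exact h.not_adj_pred hb'

theorem short_adj_succ (h : Tight G t c N x k) (hb : Next G c x b (b + 3)) {p : ℤ}
    (hp : G.Adj x (c p)) (hp1 : b + 3 - N < p) (hp2 : p ≤ b) :
    G.Adj (c (b + 2)) (c (p + 1)) := by
  obtain ⟨b'', hb''⟩ := h.exists_next hb.right
  have hlt := h.next_lt hb
  have hlong := h.long_next hb le_rfl hb''
  have hle : b'' ≤ b + N := hb''.le_of_adj (h.adj_per hb.left) hlt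
  have hb₁ := hb''.sub_period h.cyc
  have hfirst : G.Adj (c (b + 2)) (c (b'' - N + 1)) := by
    obtain ⟨⟨s, h1, h2, h3⟩, -⟩ := h.exists_adj_and_degree hb hb₁.right
      (by have := hb''.lt; omega) (by omega)
    have hs : s ≠ b + 3 := by
      rintro rfl
      rw [show b'' - N + 1 = b'' + 1 - N by ring, h.cyc.per_sub] at h3
      exact h.not_adj_next_succ hb'' hlong h3.symm
    obtain rfl : s = b + 2 := by omega
    exact h3
  have hple := hb₁.le_of_adj hp hp1
  rcases hple.eq_or_lt with rfl | hlt'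
  · exact hfirst
  · obtain ⟨⟨s, h1, h2, h3⟩, -⟩ := h.exists_adj_and_degree hb hp (by omega) hp2
    have hs : s ≠ b + 3 := by
      rintro rfl
      have := h.mono hb (s := b + 2) le_rfl (by omega) le_rfl hb₁.right hp
        (by have := hb''.lt; omega) hp2 hfirst h3
      omega
    obtain rfl : s = b + 2 := by omega
    exact h3

theorem short_adj_pred (h : Tight G t c N x k) (hb : Next G c x b (b + 3)) {q : ℤ}
    (hq : G.Adj x (c q)) (hq1 : b + 3 ≤ q) (hq2 : q < b + N) :
    G.Adj (c (b + 1)) (c (q - 1)) := by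
  have := h.neg.short_adj_succ (b := -(b + 3)) (p := -q)
    (by have := hb.neg; rwa [show -b = -(b + 3) + 3 by ring] at this) (by simpa using hq)
    (by omega) (by omega)
  simp only [neg_add, neg_neg] at this
  convert this using 2 <;> omega

/-- With three neighbors of `x`, no block has length at least four. -/
theorem next_le_add_three (h : Tight G t c N x k) {b'' : ℤ} (hb : Next G c x b b')
    (hb' : Next G c x b' b'') (hb'' : Next G c x b'' (b + N)) : b' ≤ b + 3 := by
  by_contra hlt
  have n1 := hb.not_adj (b + 1) (by omega) (by omega)
  have n2 := hb.not_adj (b + 2) (by omega) (by omega)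
  have n3 := hb.not_adj (b + 3) (by omega) (by omega)
  have l1 := hb'.lt
  have l2 := hb''.lt
  have r1 : G.Adj (c b') (c (b' - N + 1)) := by
    rw [show b' - N + 1 = b' + 1 - N by ring, h.cyc.per_sub]
    exact h.cyc.adj b'
  have hpos : ∀ p, G.Adj x (c p) → b' - N ≤ p → p < b' → p = b' - N ∨ p = b'' - N ∨ p = b := by
    intro p hp h1 h2
    have h3 := hb.le_of_adj' hp h2
    by_contra hne
    push Not at hne
    have h4 := (hb'.sub_period h.cyc).le_of_adj hp (by omega)
    have h5 := (hb''.sub_period h.cyc).le_of_adj hp (by omega)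
    omega
  have hadj : ∀ w, ∃ p, (p = b'' - N ∨ p = b) ∧ G.Adj (c (b + 2)) (c (p + 1)) ∧
      c (p + 1) ≠ w := by
    intro w
    obtain ⟨p, h1, h2, h3, h4, h5⟩ := h.exists_adj_succ n2
      (by rwa [show b + 2 - 1 = b + 1 by ring]) w (b' - N)
    rcases hpos p h3 h1 (by omega) with rfl | hp
    · exact (h.adj_succ_unique hb (s := b + 2) (s' := b') le_rfl (by omega) le_rfl h3 h1
        (by omega) h4 r1).elim
    · exact ⟨p, hp, h4, h5⟩
  have e1 : G.Adj (c (b + 2)) (c (b'' - N + 1)) := by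
    obtain ⟨p, rfl | rfl, h1, h2⟩ := hadj (c (b + 1))
    · exact h1
    · exact absurd rfl h2
  have e2 : G.Adj (c (b + 2)) (c (b + 1)) := by
    rw [show b + 2 = b + 1 + 1 by ring]
    exact (h.cyc.adj _).symm
  obtain ⟨p, h1, h2, h3, h4, -⟩ := h.exists_adj_succ n3
    (by rwa [show b + 3 - 1 = b + 2 by ring]) x (b' - N)
  rcases hpos p h3 h1 (by omega) with rfl | rfl | rfl
  · exact h.adj_succ_unique hb (s := b + 3) (s' := b') (by omega) (by omega) le_rfl h3 h1
      (by omega) h4 r1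
  · exact h.adj_succ_unique hb (s := b + 2) (s' := b + 3) le_rfl (by omega) (by omega) h3 h1
      (by omega) e1 h4
  · exact h.adj_succ_unique hb (s := p + 2) (s' := p + 3) le_rfl (by omega) (by omega) h3 h1
      le_rfl e2 h4

theorem not_three_short (h : Tight G t c 9 x k) (h0 : Next G c x b (b + 3))
    (h3 : Next G c x (b + 3) (b + 6)) (h6 : Next G c x (b + 6) (b + 9)) : False := by
  have hper : ∀ i, c (i + 9) = c i := h.cyc.per
  have hV := h.card_eq_succ
  have hk : k ≤ 3 := by
    have hsub : G.neighborSet x ⊆ ({c b, c (b + 3), c (b + 6)} : Finset V) := by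
      intro y hy
      obtain ⟨i, rfl⟩ := h.cover y (G.ne_of_adj hy).symm
      obtain ⟨j, h1, h2, hj⟩ := h.cyc.exists_rep b i
      have hy : G.Adj x (c j) := by rw [hj]; exact hy
      rw [← hj]
      obtain rfl | rfl | rfl : j = b ∨ j = b + 3 ∨ j = b + 6 := by
        by_contra hne
        push Not at hne
        have h4 := h0.le_of_adj hy (by omega)
        have h5 := h3.le_of_adj hy (by omega)
        have h6 := h6.le_of_adj hy (by omega)
        push_cast at h2
        omega
      all_goals simp
    have h1 := Set.ncard_le_ncard hsub
    rw [Set.ncard_coe_finset, ← Nat.card_coe_set_eq, h.deg] at h1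
    exact h1.trans Finset.card_le_three
  have a0 := h0.left
  have a3 := h3.left
  have a6 := h6.left
  have am6 : G.Adj x (c (b - 6)) := by
    rw [← hper, show b - 6 + 9 = b + 3 by ring]; exact a3
  have a15 : G.Adj x (c (b + 15)) := by
    rw [show b + 15 = b + 6 + 9 by ring, hper]; exact a6
  have e07 : ¬ G.Adj (c b) (c (b + 7)) := fun h' =>
    h.adj_succ_unique h6 (s := b + 8) (s' := b + 9) (p := b + 6) (by omega) (by omega) le_rfl a6
      (by push_cast; omega) le_rfl
      (by convert (h.cyc.adj (b + 7)).symm using 2; omega; omega)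
      (by rw [hper]; convert h' using 2; omega)
  have e04 : ¬ G.Adj (c b) (c (b + 4)) := fun h' =>
    h.adj_succ_unique h6 (s := b + 8) (s' := b + 9) (p := b + 3) (by omega) (by omega) le_rfl a3
      (by push_cast; omega) (by omega)
      (by
        have h6' : Next G c x (b + 6) (b + 6 + 3) := by rwa [show b + 6 + 3 = b + 9 by ring]
        convert h.short_adj_succ h6' (p := b + 3) a3 (by push_cast; omega) (by omega) using 2
        omega)
      (by rw [hper]; convert h' using 2; omega)
  have e02 : ¬ G.Adj (c b) (c (b + 2)) := fun h' =>
    h.adj_pred_unique h0 (s := b) (s' := b + 1) (q := b + 3) le_rfl (by omega) (by omega) a3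
      le_rfl (by push_cast; omega) (by convert h' using 2; omega)
      (by convert h.cyc.adj (b + 1) using 2; omega)
  have e05 : ¬ G.Adj (c b) (c (b + 5)) := fun h' =>
    h.adj_pred_unique h0 (s := b) (s' := b + 1) (q := b + 6) le_rfl (by omega) (by omega) a6
      (by omega) (by push_cast; omega) (by convert h' using 2; omega)
      (h.short_adj_pred h0 a6 (by omega) (by push_cast; omega))
  have e24 : ¬ G.Adj (c (b + 2)) (c (b + 4)) := fun h' =>
    h.adj_succ_unique h0 (s := b + 2) (s' := b + 3) (p := b - 6) le_rfl (by omega) le_rfl am6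
      (by push_cast; omega) (by omega)
      (by rw [← hper (b - 6 + 1)]; convert h' using 2; omega)
      (by rw [← hper (b - 6 + 1)]; convert h.cyc.adj (b + 3) using 2; omega)
  have e25 : ¬ G.Adj (c (b + 2)) (c (b + 5)) := fun h' =>
    h.neg.not_adj_succ_succ' (p := -(b + 3)) (q := -(b + 6)) (by simpa using a3)
      (by simpa using a6) (by convert h' using 2 <;> omega)
  have e47 : ¬ G.Adj (c (b + 4)) (c (b + 7)) := fun h' =>
    h.not_adj_succ_succ' a3 a6 (by convert h' using 2 <;> omega)
  have e57 : ¬ G.Adj (c (b + 5)) (c (b + 7)) := fun h' =>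
    h.adj_pred_unique h6 (s := b + 6) (s' := b + 7) (q := b + 15) le_rfl (by omega) (by omega) a15
      (by omega) (by push_cast; omega)
      (by rw [show b + 15 - 1 = b + 5 + 9 by ring, hper]
          convert (h.cyc.adj (b + 5)).symm using 2; omega)
      (by rw [show b + 15 - 1 = b + 5 + 9 by ring, hper]; exact h'.symm)
  have x2 := h0.not_adj (b + 2) (by omega) (by omega)
  have x4 := h3.not_adj (b + 4) (by omega) (by omega)
  have x5 := h3.not_adj (b + 5) (by omega) (by omega)
  have x7 := h6.not_adj (b + 7) (by omega) (by omega)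
  have hne : ∀ i j : ℤ, 0 ≤ i → i < j → j < 9 → c (b + i) ≠ c (b + j) := fun i j h1 h2 h3 =>
    h.cyc.ne_of_lt (by omega) (by push_cast; omega)
  have d02 := hne 0 2 (by omega) (by omega) (by omega)
  have d04 := hne 0 4 (by omega) (by omega) (by omega)
  have d05 := hne 0 5 (by omega) (by omega) (by omega)
  have d07 := hne 0 7 (by omega) (by omega) (by omega)
  have d24 := hne 2 4 (by omega) (by omega) (by omega)
  have d25 := hne 2 5 (by omega) (by omega) (by omega)
  have d27 := hne 2 7 (by omega) (by omega) (by omega)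
  have d45 := hne 4 5 (by omega) (by omega) (by omega)
  have d47 := hne 4 7 (by omega) (by omega) (by omega)
  have d57 := hne 5 7 (by omega) (by omega) (by omega)
  rw [add_zero] at d02 d04 d05 d07
  have y0 := (h.ne_x b).symm
  have y2 := (h.ne_x (b + 2)).symm
  have y4 := (h.ne_x (b + 4)).symm
  have y5 := (h.ne_x (b + 5)).symm
  have y7 := (h.ne_x (b + 7)).symm
  have p1 : ∀ u ∈ ({x, c b} : Finset V), ∀ v ∈ ({c (b + 2), c (b + 7)} : Finset V),
      u ≠ v ∧ ¬ G.Adj u v := by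
    simp only [Finset.mem_insert, Finset.mem_singleton]
    rintro u (rfl | rfl) v (rfl | rfl) <;> exact ⟨by assumption, by assumption⟩
  have p2 : ∀ u ∈ ({x, c b} : Finset V), ∀ v ∈ ({c (b + 4), c (b + 5)} : Finset V),
      u ≠ v ∧ ¬ G.Adj u v := by
    simp only [Finset.mem_insert, Finset.mem_singleton]
    rintro u (rfl | rfl) v (rfl | rfl) <;> exact ⟨by assumption, by assumption⟩
  have p3 : ∀ u ∈ ({c (b + 2), c (b + 7)} : Finset V),
      ∀ v ∈ ({c (b + 4), c (b + 5)} : Finset V), u ≠ v ∧ ¬ G.Adj u v := by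
    simp only [Finset.mem_insert, Finset.mem_singleton]
    rintro u (rfl | rfl) v (rfl | rfl)
    · exact ⟨d24, e24⟩
    · exact ⟨d25, e25⟩
    · exact ⟨d47.symm, fun h' => e47 h'.symm⟩
    · exact ⟨d57.symm, fun h' => e57 h'.symm⟩
  let P : Fin 3 → Finset V := ![{x, c b}, {c (b + 2), c (b + 7)}, {c (b + 4), c (b + 5)}]
  have key := h.tough.mul_card_add_sum_le h.tpos (by simp) P
    (by intro i; fin_cases i <;> simp [P]) (by
      intro i j hij u hu v hv
      fin_cases i <;> fin_cases j <;> first | exact absurd rfl hij | skip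
      · exact p1 u hu v hv
      · exact p2 u hu v hv
      · exact (p1 v hv u hu).imp Ne.symm fun h h' => h h'.symm
      · exact p3 u hu v hv
      · exact (p2 v hv u hu).imp Ne.symm fun h h' => h h'.symm
      · exact (p3 v hv u hu).imp Ne.symm fun h h' => h h'.symm)
  have hsum : ∑ i, (P i).card = 6 := by
    simp [P, Fin.sum_univ_three, Finset.card_pair y0, Finset.card_pair d27,
      Finset.card_pair d45]
  have hn := h.card_eq
  rw [hsum] at key
  rw [hV] at key hn
  push_cast [Fintype.card_fin] at key hn
  have hk' : (k : ℝ) ≤ 3 := by exact_mod_cast hk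
  nlinarith [h.tpos]

theorem not_short (h : Tight G t c N x k) (hb : G.Adj x (c b)) (hb' : G.Adj x (c (b + 3))) :
    False := by
  have h0 := h.next_of_adj_add_three hb hb'
  obtain ⟨b₂, h3⟩ := h.exists_next hb'
  have hlong := h.long_next h0 le_rfl h3
  have hle₂ := h3.le_of_adj (h.adj_per hb) (h.next_lt h0)
  rcases hle₂.eq_or_lt with rfl | hlt₂
  · obtain ⟨p, p1, p2, p3, p4, p5⟩ := h.exists_adj_succ (h0.not_adj (b + 2) (by omega) (by omega))
      (h0.not_adj _ (by omega) (by omega)) (c (b + 1)) (b + 3 - N)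
    have hp := h0.le_of_adj' p3 (by omega)
    obtain rfl : p = b + 3 - N := by
      by_contra hne
      have := (h3.sub_period h.cyc).le_of_adj p3 (by omega)
      obtain rfl : p = b := by omega
      exact p5 rfl
    refine h.adj_succ_unique h0 (s := b + 2) (s' := b + 3) le_rfl (by omega) le_rfl p3 le_rfl
      hp p4 ?_
    rw [show b + 3 - N + 1 = b + 3 + 1 - N by ring, h.cyc.per_sub]
    exact h.cyc.adj _
  · obtain ⟨b₃, h6⟩ := h.exists_next h3.right
    have hle₃ := h6.le_of_adj (h.adj_per hb) hlt₂
    have htwo := h.add_two_le_next h6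
    rcases hle₃.eq_or_lt with rfl | hlt₃
    · have h0' := h0.add_period h.cyc
      have g1 := h.next_le_add_three h3 h6 h0'
      have g2 := h.long_next h3 hlong h6
      have g3 := h.next_le_add_three h6 h0' (h3.add_period h.cyc)
      obtain rfl : b₂ = b + 6 := by omega
      obtain rfl : N = 9 := by omega
      exact h.not_three_short h0 h3 h6
    · refine h.reroute_three (s := b + 1) (p := b₂) (q := b₃ - 1) (by omega) (by omega)
        (by omega) h3.right (by rw [sub_add_cancel]; exact h6.right) ?_ ?_
      · have := h.short_adj_succ h0 (p := b₂ - N) (h.adj_per_sub h3.right) (by omega) (by omega)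
        rwa [show b₂ - N + 1 = b₂ + 1 - N by ring, h.cyc.per_sub,
          show b + 2 = b + 1 + 1 by ring] at this
      · exact h.short_adj_pred h0 h6.right (by omega) hlt₃

end Tight

end TightCycles

section TightCycles

variable {V : Type*} [Fintype V] [DecidableEq V] {G : SimpleGraph V} {t : ℝ}

namespace Tight

variable {c : ℤ → V} {N : ℕ} {x : V} {k : ℕ} {b b' : ℤ}

theorem next_eq (h : Tight G t c N x k) (hb : Next G c x b b') : b' = b + 2 := by
  by_contra hne
  have h2 := h.add_two_le_next hb
  have hlong : b + 3 ≤ b' := by omega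
  obtain ⟨b₀, hb₀⟩ := h.exists_prev hb.left
  have hlong₀ := h.long_prev hb hlong hb₀
  have hlt₀ := h.next_lt hb₀
  have hle₀ : b' ≤ b₀ + N := hb.le_of_adj (h.adj_per hb₀.left) hlt₀
  have n1 := hb.not_adj (b + 1) (by omega) (by omega)
  have n2 := hb.not_adj (b + 2) (by omega) (by omega)
  have e1 : G.Adj (c (b + 1)) (c (b₀ + N - 1)) := by
    obtain ⟨s, s1, s2, s3⟩ := h.exists_adj_pred_block hb (h.adj_per hb₀.left) hle₀ (by omega)
    have hsb : s ≠ b := by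
      rintro rfl
      rw [show b₀ + N - 1 = b₀ - 1 + N by ring, h.cyc.per] at s3
      exact h.not_adj_pred_next hb₀ hlong₀ s3.symm
    rcases (show b + 1 ≤ s by omega).eq_or_lt with rfl | hlt
    · exact s3
    · obtain ⟨q, q1, q2, q3, q4, -⟩ := h.exists_adj_pred n1
        (by rwa [show b + 1 + 1 = b + 2 by ring]) x (b + N)
      have hq := hb.le_of_adj q3 (by omega)
      have hqb : q ≠ b + N := by
        rintro rfl
        refine h.adj_pred_unique hb (s := b) (s' := b + 1) le_rfl (by omega) (by omega) q3 hq
          le_rfl ?_ q4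
        rw [show b + N - 1 = b - 1 + N by ring, h.cyc.per]
        simpa using (h.cyc.adj (b - 1)).symm
      have hqb' := (hb₀.add_period h.cyc).le_of_adj' q3 (by omega)
      have := h.mono_pred hb (s := b + 1) (by omega) hlt s2 q3 (h.adj_per hb₀.left) hq (by omega)
        q4 s3
      obtain rfl : q = b₀ + N := by omega
      exact q4
  have e2 : G.Adj (c (b + 2)) (c (b₀ + 1)) := by
    obtain ⟨⟨s, s1, s2, s3⟩, -⟩ := h.exists_adj_and_degree hb hb₀.left (by omega) hb₀.lt.le
    rcases s1.eq_or_lt with rfl | hlt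
    · exact s3
    · obtain ⟨p, p1, p2, p3, p4, p5⟩ := h.exists_adj_succ n2
        (by rwa [show b + 2 - 1 = b + 1 by ring]) (c (b + 1)) (b' - N)
      have hp := hb.le_of_adj' p3 (by omega)
      have hpb : p ≠ b := by rintro rfl; exact p5 rfl
      have hp' := hb₀.le_of_adj' p3 (by omega)
      have := h.mono hb le_rfl hlt s2 p3 hb₀.left p1 hb₀.lt.le p4 s3
      obtain rfl : p = b₀ := by omega
      exact p4
  obtain ⟨-, hdeg⟩ := h.exists_adj_and_degree hb hb.left (by omega) le_rfl
  have hX := PathList.seg h.cyc.adj (s := b₀ + N + 1) (e := b + N) (by omega)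
  have hY := PathList.seg h.cyc.adj (s := b + 2) (e := b₀ + N - 1) (by omega)
  have hl : PathList G (c (b₀ + N) :: x ::
      ((seg c (b₀ + N + 1) (b + N)).reverse ++ seg c (b + 2) (b₀ + N - 1)))
      (c (b₀ + N)) (c (b₀ + N - 1)) :=
    ((hX.reverse.append hY (by
      rw [show b₀ + N + 1 = b₀ + 1 + N by ring, h.cyc.per]; exact e2.symm)).cons
        (h.adj_per hb.left)).cons (h.adj_per hb₀.left).symm
  set l := c (b₀ + N) :: x ::
      ((seg c (b₀ + N + 1) (b + N)).reverse ++ seg c (b + 2) (b₀ + N - 1)) with hldef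
  have hperm : (c (b + 1) :: l).Perm (x :: seg c (b + 1) (b + N)) := by
    have hs : ∀ i, seg c i i = [c i] := fun i => by simp [seg]
    rw [← seg_append (s := b + 1) (m := b + 1) (e := b + N) (by omega) (by omega),
      show b + 1 + 1 = b + 2 by ring,
      ← seg_append (s := b + 2) (m := b₀ + N - 1) (e := b + N) (by omega) (by omega),
      sub_add_cancel,
      ← seg_append (s := b₀ + N) (m := b₀ + N) (e := b + N) (by omega) (by omega),
      List.perm_iff_count, hs, hs]
    intro a
    simp only [hldef, List.count_cons, List.count_append, List.count_reverse, List.count_nil]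
    omega
  have hnd := hperm.nodup_iff.2 (h.nodup_cons_seg b)
  rw [List.nodup_cons] at hnd
  have hlen : l.length = N := by
    have := hperm.length_eq
    simp only [List.length_cons, length_seg] at this
    omega
  have hcyc : IsCyc G l := hl.isCyc
    (by have := h.cyc.adj (b₀ + N - 1); rwa [sub_add_cancel] at this)
    (by rw [hlen]; exact h.cyc.three) hnd.2
  obtain ⟨c', hc', hget, hlast, hmem⟩ := hcyc.exists_cycFn
  have hT : Tight G t c' l.length (c (b + 1)) k :=
    { h with
      cyc := hc'
      ne_x := fun i hi => hnd.1 ((hmem _).2 ⟨i, hi⟩)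
      cover := fun v hv => by
        rw [← hmem]
        have := hperm.mem_iff.2 (h.mem_cons_seg b v)
        exact (List.mem_cons.1 this).resolve_left hv
      deg := hdeg }
  have g1 : c' (-1) = c (b₀ + N - 1) := by
    have := hl.last
    rw [hlast] at this
    exact Option.some_injective _ this
  have g2 : c' (-1 + 3) = c (b + N) := by
    have hh := hget 2 (by rw [hlen]; exact h.cyc.three)
    have h3 : l[2]? = some (c (b + N)) := by
      have := (hX.reverse.append hY (by
        rw [show b₀ + N + 1 = b₀ + 1 + N by ring, h.cyc.per]; exact e2.symm)).head
      rw [hldef, List.getElem?_cons_succ, List.getElem?_cons_succ, ← List.head?_eq_getElem?, this]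
    rw [h3] at hh
    exact (Option.some_injective _ hh).symm
  refine hT.not_short (b := -1) ?_ ?_
  · rw [g1]; exact e1
  · rw [g2, h.cyc.per]; exact (h.cyc.adj b).symm

/-- A tight situation forces the extremal structure. -/
theorem exists_iso (h : Tight G t c N x k) : ∃ m : ℕ, Fintype.card V = 2 * m + 1 ∧
    ∃ H : SimpleGraph (Fin m), Nonempty (G ≃g graphJoin H (⊥ : SimpleGraph (Fin (m + 1)))) := by
  classical
  have hadj : ∀ s, G.Adj x (c s) ∨ G.Adj x (c (s - 1)) := by
    intro s
    have hk : (G.neighborSet x).Nonempty := by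
      rw [Set.nonempty_iff_ne_empty]
      intro he
      have h1 := h.deg
      have h2 := h.two_le
      rw [he] at h1
      simp at h1
      omega
    obtain ⟨y, hy⟩ := hk
    obtain ⟨i, rfl⟩ := h.cover y (G.ne_of_adj hy).symm
    obtain ⟨j, h1, h2, h3⟩ := h.cyc.exists_rep (s + 1 - N) i
    obtain ⟨β, ⟨g1, g2⟩, hmax⟩ := Int.exists_greatest_of_bdd
      (P := fun i => i ≤ s ∧ G.Adj x (c i)) ⟨s, fun z hz => hz.1⟩
      ⟨j, by omega, by rw [h3]; exact hy⟩
    obtain ⟨β', hβ⟩ := h.exists_next g2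
    have e := h.next_eq hβ
    have : s < β' := by
      by_contra hle
      have := hmax β' ⟨by omega, hβ.right⟩
      omega
    obtain rfl | rfl : s = β ∨ s = β + 1 := by omega
    · exact Or.inl g2
    · exact Or.inr (by rwa [add_sub_cancel_right])
  obtain ⟨I, hIc, hI⟩ := h.exists_finset_succ
  let A : Finset V := G.neighborFinset x
  have hAc : A.card = k := by
    rw [card_neighborFinset_eq_degree, ← card_neighborSet_eq_degree, ← Nat.card_eq_fintype_card,
      h.deg]
  have hA : ∀ v, v ∈ A ↔ G.Adj x v := fun v => mem_neighborFinset ..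
  have hIA : I = Aᶜ := by
    ext v
    rw [Finset.mem_compl, hA, hI]
    constructor
    · intro hv
      exact h.not_adj_of_mem_succ (Or.inl rfl) hv
    · intro hv
      by_cases hvx : v = x
      · exact Or.inl hvx
      · obtain ⟨i, rfl⟩ := h.cover v hvx
        exact Or.inr ⟨i - 1, (hadj i).resolve_left hv, by rw [sub_add_cancel]⟩
  have hn := Finset.card_compl_add_card A
  rw [← hIA, hIc, hAc] at hn
  refine ⟨k, by omega, exists_iso_graphJoin A hAc (by omega) fun v hv u => ?_⟩
  have hvI : v ∈ I := by rw [hIA, Finset.mem_compl]; exact hv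
  have hsub : G.neighborSet v ⊆ G.neighborSet x := by
    intro u hu
    by_contra hux
    have huI : u ∈ I := by
      rw [hIA, Finset.mem_compl, hA]; exact hux
    exact h.not_adj_of_mem_succ ((hI v).1 hvI) ((hI u).1 huI) hu
  have hle : (G.neighborSet x).ncard ≤ (G.neighborSet v).ncard := by
    by_cases hvx : v = x
    · rw [hvx]
    · rw [← Nat.card_coe_set_eq, ← Nat.card_coe_set_eq, h.deg]
      exact h.le_degree hvx (by rwa [hA] at hv)
  have heq := Set.eq_of_subset_of_ncard_le hsub hle
  rw [hA, ← mem_neighborSet, ← mem_neighborSet, heq]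

end Tight

end TightCycles

section Reach

variable {V : Type*} {G : SimpleGraph V} {W W' : Set V} {a b d : V}

/-- `b` can be reached from `a` inside the vertex set `W`. -/
def Reach (G : SimpleGraph V) (W : Set V) (a b : V) : Prop :=
  a ∈ W ∧ Relation.ReflTransGen (fun u v => G.Adj u v ∧ v ∈ W) a b

namespace Reach

theorem refl (ha : a ∈ W) : Reach G W a a := ⟨ha, .refl⟩

theorem tail (h : Reach G W a b) (hbd : G.Adj b d) (hd : d ∈ W) : Reach G W a d :=
  ⟨h.1, h.2.tail ⟨hbd, hd⟩⟩

theorem trans (h : Reach G W a b) (h' : Reach G W b d) : Reach G W a d := ⟨h.1, h.2.trans h'.2⟩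

theorem induction {P : V → Prop} (h : Reach G W a b) (ha : P a)
    (step : ∀ u v, Reach G W a u → P u → G.Adj u v → v ∈ W → P v) : P b := by
  obtain ⟨haW, h⟩ := h
  induction h with
  | refl => exact ha
  | tail hab hbd ih => exact step _ _ ⟨haW, hab⟩ ih hbd.1 hbd.2

theorem right_mem (h : Reach G W a b) : b ∈ W := h.induction h.1 fun _ _ _ _ _ hv => hv

theorem mono (h : Reach G W a b) (hW : W ⊆ W') : Reach G W' a b :=
  h.induction (refl (hW h.1)) fun _ _ _ hu huv hv => hu.tail huv (hW hv)

theorem symm (h : Reach G W a b) : Reach G W b a :=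
  h.induction (P := fun b => Reach G W b a) (refl h.1) fun _ _ hau hu huv hv =>
    ((refl hv).tail huv.symm hau.right_mem).trans hu

theorem exists_path (h : Reach G W a b) :
    ∃ l, PathList G l a b ∧ l.Nodup ∧ ∀ v ∈ l, v ∈ W := by
  refine h.induction (P := fun b => ∃ l, PathList G l a b ∧ l.Nodup ∧ ∀ v ∈ l, v ∈ W)
    ⟨[a], PathList.singleton a, by simp, by simpa using h.1⟩ ?_
  rintro u v - ⟨l, hl, hnd, hlW⟩ huv hv
  by_cases hvl : v ∈ l
  · obtain ⟨l₁, l₂, rfl⟩ := List.append_of_mem hvl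
    rw [show l₁ ++ v :: l₂ = (l₁ ++ [v]) ++ l₂ by simp] at hl hnd hlW
    refine ⟨l₁ ++ [v], ⟨(List.isChain_append.1 hl.chain).1, ?_, by simp⟩, hnd.of_append_left,
      fun w hw => hlW w (List.mem_append_left _ hw)⟩
    have := hl.head
    cases l₁ <;> simpa using this
  · refine ⟨l ++ [v], hl.append (PathList.singleton v) huv, ?_, ?_⟩
    · rw [List.nodup_append]
      refine ⟨hnd, by simp, ?_⟩
      rintro w hw w' hw' rfl
      rw [List.mem_singleton] at hw'
      exact hvl (hw' ▸ hw)
    · intro w hw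
      rcases List.mem_append.1 hw with hw | hw
      · exact hlW w hw
      · rw [List.mem_singleton.1 hw]; exact hv

end Reach

/-- The vertices attached to `D` through `O`. -/
def attached (G : SimpleGraph V) (O D : Set V) : Set V :=
  {v | ∃ q ∈ D, Reach G (insert q O) q v}

variable {O D D' : Set V}

theorem subset_attached : D ⊆ attached G O D := fun q hq => ⟨q, hq, Reach.refl (by simp)⟩

theorem attached_subset : attached G O D ⊆ D ∪ O := by
  rintro v ⟨q, hq, hr⟩
  rcases hr.right_mem with rfl | hv
  · exact Or.inl hq
  · exact Or.inr hv

theorem attached_tail {u v : V} (hu : u ∈ attached G O D) (huv : G.Adj u v) (hv : v ∈ O) :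
    v ∈ attached G O D := by
  obtain ⟨q, hq, hr⟩ := hu
  exact ⟨q, hq, hr.tail huv (Or.inr hv)⟩

theorem exists_reach_of_attached {u v : V} (hu : u ∈ attached G O D) (hv : v ∈ attached G O D')
    (huv : u = v ∨ G.Adj u v) : ∃ q ∈ D, ∃ q' ∈ D', Reach G (insert q (insert q' O)) q q' := by
  obtain ⟨q, hq, hr⟩ := hu
  obtain ⟨q', hq', hr'⟩ := hv
  have h1 : Reach G (insert q (insert q' O)) q u :=
    hr.mono (Set.insert_subset_insert (Set.subset_insert _ _))
  have h2 : Reach G (insert q (insert q' O)) v q' := (hr'.mono (Set.subset_insert _ _)).symm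
  refine ⟨q, hq, q', hq', ?_⟩
  rcases huv with rfl | huv
  · exact h1.trans h2
  · exact (h1.tail huv h2.1).trans h2

end Reach

section Potential

variable {V : Type*} [Fintype V] {G : SimpleGraph V}

/-- A potential weighing the components of the subgraph induced on `W`. -/
noncomputable def potential (G : SimpleGraph V) (W : Finset V) : ℕ :=
  ∑ v ∈ W, (Fintype.card V + 1) ^ {u | Reach G W v u}.ncard

theorem potential_lt {W W' : Finset V} {x : V} (hx : x ∈ W)
    (h : ∀ v ∈ W', (v ∈ W ∧ ¬ Reach G W x v ∧ {u | Reach G W' v u} ⊆ {u | Reach G W v u}) ∨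
      {u | Reach G W' v u}.ncard < {u | Reach G W x u}.ncard) :
    potential G W' < potential G W := by
  classical
  set M := Fintype.card V + 1
  set r := {u | Reach G W x u}.ncard with hr
  have hr0 : 0 < r := (Set.ncard_pos).2 ⟨x, Reach.refl hx⟩
  let g : V → ℕ := fun v => M ^ {u | Reach G W v u}.ncard
  have hM : 0 < M := Nat.succ_pos _
  have hterm : ∀ v ∈ W', M ^ {u | Reach G W' v u}.ncard ≤
      (if v ∈ W ∧ v ≠ x then g v else 0) + M ^ (r - 1) := by
    intro v hv
    rcases h v hv with ⟨h1, h2, h3⟩ | h1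
    · have hvx : v ≠ x := by rintro rfl; exact h2 (Reach.refl hx)
      rw [if_pos ⟨h1, hvx⟩]
      exact (Nat.pow_le_pow_right hM (Set.ncard_le_ncard h3)).trans (Nat.le_add_right _ _)
    · exact (Nat.pow_le_pow_right hM (by omega)).trans (Nat.le_add_left _ _)
  have h1 : ∑ v ∈ W', (if v ∈ W ∧ v ≠ x then g v else 0) ≤ ∑ v ∈ W.erase x, g v := by
    rw [← Finset.sum_filter]
    refine Finset.sum_le_sum_of_subset fun v hv => ?_
    rw [Finset.mem_filter] at hv
    exact Finset.mem_erase.2 ⟨hv.2.2, hv.2.1⟩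
  have h2 : W'.card * M ^ (r - 1) < g x := by
    have : W'.card < M := Nat.lt_succ_of_le (Finset.card_le_univ _)
    calc W'.card * M ^ (r - 1) < M * M ^ (r - 1) := by
          gcongr
      _ = g x := by rw [← pow_succ']; simp only [g, ← hr]; congr 1; omega
  calc potential G W' ≤ ∑ v ∈ W', ((if v ∈ W ∧ v ≠ x then g v else 0) + M ^ (r - 1)) :=
        Finset.sum_le_sum hterm
    _ ≤ (∑ v ∈ W.erase x, g v) + W'.card * M ^ (r - 1) := by
        rw [Finset.sum_add_distrib, Finset.sum_const, smul_eq_mul]; gcongr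
    _ < (∑ v ∈ W.erase x, g v) + g x := by gcongr
    _ = potential G W := Finset.sum_erase_add _ _ hx

/-- The potential decreases when a component `H` of `W` loses a vertex and vertex sets `D i` are
added, none of them adjacent to `H`, that are separated and each attached to few vertices. -/
theorem potential_lt_of_attached {W W' : Finset V} {x : V} (hx : x ∈ W) {H O : Set V}
    (hH : H = {u | Reach G W x u}) (hO : O = ↑W \ H) {ι : Type*} {D : ι → Set V}
    (hW' : ∀ v ∈ W', v ∈ H ∨ v ∈ O ∨ ∃ i, v ∈ D i) {y : V} (hy : y ∈ H) (hyW' : y ∉ W')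
    (hDH : ∀ i, ∀ u ∈ D i, ∀ w ∈ H, u ≠ w ∧ ¬ G.Adj u w)
    (hlink : ∀ i j, i ≠ j → ∀ q ∈ D i, ∀ q' ∈ D j, ¬ Reach G (insert q (insert q' O)) q q')
    (hsmall : ∀ i, (attached G O (D i)).ncard < H.ncard) :
    potential G W' < potential G W := by
  have hHO : ∀ u ∈ H, ∀ v ∈ O, ¬ G.Adj u v := by
    intro u hu v hv huv
    rw [hO] at hv
    rw [hH] at hu hv
    exact hv.2 (Reach.tail hu huv hv.1)
  have hHO' : ∀ u ∈ O, u ∉ H := fun u hu => by rw [hO] at hu; exact hu.2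
  have hOW : O ⊆ W := fun v hv => by rw [hO] at hv; exact hv.1
  refine potential_lt hx fun v hv => ?_
  rw [← hH]
  by_cases hvH : v ∈ H
  · right
    refine Set.ncard_lt_ncard ⟨?_, fun hle => hyW' (hle hy).right_mem⟩
    intro u hu
    refine hu.induction hvH fun a b _ ha hab hb => ?_
    rcases hW' b hb with h | h | ⟨i, h⟩
    · exact h
    · exact (hHO a ha b h hab).elim
    · exact ((hDH i b h a ha).2 hab.symm).elim
  by_cases hvK : ∃ i, v ∈ attached G O (D i)
  · right
    obtain ⟨i, hi⟩ := hvK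
    refine lt_of_le_of_lt (Set.ncard_le_ncard ?_) (hsmall i)
    intro u hu
    refine hu.induction hi fun a b _ ha hab hb => ?_
    rcases hW' b hb with h | h | ⟨j, h⟩
    · rcases attached_subset ha with h' | h'
      · exact ((hDH i a h' b h).2 hab).elim
      · exact (hHO b h a h' hab.symm).elim
    · exact attached_tail ha hab h
    · by_cases hij : i = j
      · subst hij; exact subset_attached h
      · obtain ⟨q, hq, q', hq', hr⟩ := exists_reach_of_attached ha (subset_attached h) (Or.inr hab)
        exact (hlink i j hij q hq q' hq' hr).elim
  · left
    push Not at hvK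
    have hvO : v ∈ O := by
      rcases hW' v hv with h | h | ⟨j, h⟩
      · exact (hvH h).elim
      · exact h
      · exact (hvK j (subset_attached h)).elim
    refine ⟨hOW hvO, fun h => hvH (by rw [hH]; exact h), fun u hu => ?_⟩
    have key : u ∈ O ∧ Reach G W v u ∧ ∀ i, u ∉ attached G O (D i) := by
      refine hu.induction (P := fun u => u ∈ O ∧ Reach G W v u ∧ ∀ i, u ∉ attached G O (D i))
        ⟨hvO, Reach.refl (hOW hvO), hvK⟩ ?_
      rintro a b - ⟨ha, har, hak⟩ hab hb
      rcases hW' b hb with h | h | ⟨i, h⟩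
      · exact (hHO b h a ha hab.symm).elim
      · exact ⟨h, har.tail hab (hOW h), fun i hi => hak i (attached_tail hi hab.symm ha)⟩
      · exact (hak i (attached_tail (subset_attached h) hab.symm ha)).elim
    exact key.2.1

end Potential

/-- The hypotheses of the theorem together with the negation of its conclusion. -/
structure Counterexample {V : Type*} [Fintype V] [DecidableEq V] (G : SimpleGraph V) (t : ℝ) :
    Prop where
  tpos : 0 < t
  three : 3 ≤ Fintype.card V
  tough : Tough t G
  sigma : ∀ u v : V, u ≠ v → ¬ G.Adj u v → 2 * (Fintype.card V : ℝ) / (t + 1) - 2 ≤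
    ((Nat.card (G.neighborSet u) + Nat.card (G.neighborSet v) : ℕ) : ℝ)
  nonham : ¬ G.IsHamiltonian
  nonext : ¬ ∃ m : ℕ, Fintype.card V = 2 * m + 1 ∧ ∃ H : SimpleGraph (Fin m),
    Nonempty (G ≃g graphJoin H (⊥ : SimpleGraph (Fin (m + 1))))

namespace Counterexample

variable {V : Type*} [Fintype V] [DecidableEq V] {G : SimpleGraph V} {t : ℝ}

theorem tough_pair (h : Counterexample G t) {Y Z : Finset V} (hY : Y.Nonempty)
    (hZ : Z.Nonempty) (hsep : ∀ u ∈ Y, ∀ v ∈ Z, u ≠ v ∧ ¬ G.Adj u v) :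
    2 * t ≤ (Y ∪ Z)ᶜ.card := by
  have h1 := h.tough.mul_card_add_sum_le h.tpos (ι := Bool) (by simp) (fun b => bif b then Y else Z)
    (by rintro (_ | _) <;> simpa) (by
      rintro (_ | _) (_ | _) hij u hu v hv
      · exact (hij rfl).elim
      · exact ⟨(hsep v hv u hu).1.symm, fun h => (hsep v hv u hu).2 h.symm⟩
      · exact hsep u hu v hv
      · exact (hij rfl).elim)
  have h2 : (Y ∪ Z).card = Y.card + Z.card :=
    Finset.card_union_of_disjoint (Finset.disjoint_left.2 fun v hy hz => (hsep v hy v hz).1 rfl)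
  have h3 := Finset.card_compl_add_card (Y ∪ Z)
  simp only [Fintype.univ_bool, Finset.mem_singleton, Bool.true_eq_false, not_false_eq_true,
    Finset.sum_insert, Finset.sum_singleton, cond_true, cond_false, Fintype.card_bool,
    ← h3, h2] at h1
  push_cast at h1
  linarith

theorem two_connected (h : Counterexample G t) {Y Z : Finset V} (hY : Y.Nonempty)
    (hZ : Z.Nonempty) (hsep : ∀ u ∈ Y, ∀ v ∈ Z, u ≠ v ∧ ¬ G.Adj u v) :
    2 ≤ (Y ∪ Z)ᶜ.card := by
  by_contra hlt
  have ht := h.tpos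
  have h1 := h.tough_pair hY hZ hsep
  have h2 : (Y ∪ Z).card = Y.card + Z.card :=
    Finset.card_union_of_disjoint (Finset.disjoint_left.2 fun v hy hz => (hsep v hy v hz).1 rfl)
  have h3 := Finset.card_compl_add_card (Y ∪ Z)
  have h4 : (Y ∪ Z)ᶜ.card = 1 := by
    have : (Y ∪ Z)ᶜ.card ≠ 0 := by
      intro h0
      rw [h0] at h1
      norm_num at h1
      linarith
    omega
  obtain ⟨s, hs⟩ := Finset.card_eq_one.1 h4
  have hmem : ∀ v, v ∈ Y ∨ v ∈ Z ∨ v = s := by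
    intro v
    by_contra hv
    push Not at hv
    have : v ∈ (Y ∪ Z)ᶜ := by simp [hv.1, hv.2.1]
    rw [hs, Finset.mem_singleton] at this
    exact hv.2.2 this
  have hNY : ∀ y ∈ Y, G.neighborSet y ⊆ ↑(insert s (Y.erase y)) := by
    intro y hy v hv
    have hvy : v ≠ y := (G.ne_of_adj hv).symm
    rcases hmem v with h' | h' | h'
    · simp [h', hvy]
    · exact ((hsep y hy v h').2 hv).elim
    · simp [h']
  have hNZ : ∀ z ∈ Z, G.neighborSet z ⊆ ↑(insert s (Z.erase z)) := by
    intro z hz v hv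
    have hvz : v ≠ z := (G.ne_of_adj hv).symm
    rcases hmem v with h' | h' | h'
    · exact ((hsep v h' z hz).2 (G.adj_symm hv)).elim
    · simp [h', hvz]
    · simp [h']
  have hdeg : ∀ (T : Finset V) (y : V), y ∈ T → G.neighborSet y ⊆ ↑(insert s (T.erase y)) →
      Nat.card (G.neighborSet y) ≤ T.card := by
    intro T y hy hN
    have := Set.ncard_le_ncard hN
    rw [Set.ncard_coe_finset] at this
    have h5 := Finset.card_insert_le s (T.erase y)
    have h6 := Finset.card_erase_add_one hy
    change (G.neighborSet y).ncard ≤ _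
    omega
  have hn : Fintype.card V = 3 := by
    obtain ⟨y, hy⟩ := hY
    obtain ⟨z, hz⟩ := hZ
    have h5 := h.sigma y z (hsep y hy z hz).1 (hsep y hy z hz).2
    have h6 : ((Nat.card (G.neighborSet y) + Nat.card (G.neighborSet z) : ℕ) : ℝ)
        ≤ Fintype.card V - 1 := by
      have : Nat.card (G.neighborSet y) + Nat.card (G.neighborSet z) + 1 ≤ Fintype.card V := by
        have := hdeg Y y hy (hNY y hy)
        have := hdeg Z z hz (hNZ z hz)
        omega
      have : ((Nat.card (G.neighborSet y) + Nat.card (G.neighborSet z) + 1 : ℕ) : ℝ)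
        ≤ Fintype.card V := by exact_mod_cast this
      push_cast at this ⊢
      linarith
    have h7 : 2 * (Fintype.card V : ℝ) / (t + 1) ≤ Fintype.card V + 1 := by linarith
    rw [div_le_iff₀ (by linarith)] at h7
    rw [h4] at h1
    push_cast at h1
    have h8 : (Fintype.card V : ℝ) ≤ 3 := by nlinarith
    have : Fintype.card V ≤ 3 := by exact_mod_cast h8
    have := h.three
    omega
  have hYc := hY.card_pos
  have hZc := hZ.card_pos
  obtain ⟨y, rfl⟩ := Finset.card_eq_one.1 (show Y.card = 1 by omega)
  obtain ⟨z, rfl⟩ := Finset.card_eq_one.1 (show Z.card = 1 by omega)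
  have hy := hNY y (by simp)
  have hz := hNZ z (by simp)
  have hyc := hdeg {y} y (by simp) hy
  have hzc := hdeg {z} z (by simp) hz
  have hyz := hsep y (by simp) z (by simp)
  have h5 := h.sigma y z hyz.1 hyz.2
  have h6 : 2 ≤ Nat.card (G.neighborSet y) + Nat.card (G.neighborSet z) := by
    have h7 : (4 : ℝ) ≤ 2 * (Fintype.card V : ℝ) / (t + 1) := by
      rw [le_div_iff₀ (by linarith), hn]
      rw [h4] at h1
      push_cast at h1 ⊢
      linarith
    have h8 : ((2 : ℕ) : ℝ) ≤ (Nat.card (G.neighborSet y) + Nat.card (G.neighborSet z) : ℕ) := by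
      push_cast at h5 ⊢
      linarith
    exact_mod_cast h8
  have hN : ∀ w, G.neighborSet w ⊆ {s} → 1 ≤ Nat.card (G.neighborSet w) →
      ∀ u, G.Adj w u ↔ u ∈ ({s} : Finset V) := by
    intro w hw hc u
    have : G.neighborSet w = {s} := Set.eq_of_subset_of_ncard_le hw (by
      rw [Set.ncard_singleton]; exact hc)
    rw [← mem_neighborSet, this]
    simp
  rw [Finset.card_singleton] at hyc hzc
  refine h.nonext ⟨1, by omega, exists_iso_graphJoin {s} (by simp) (by omega) fun w hw => ?_⟩
  rcases hmem w with h' | h' | h'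
  · rw [Finset.mem_singleton] at h'
    subst h'
    exact hN w (by simpa using hy) (by omega)
  · rw [Finset.mem_singleton] at h'
    subst h'
    exact hN w (by simpa using hz) (by omega)
  · exact (hw (by simp [h'])).elim

theorem exists_adj (h : Counterexample G t) (u : V) : ∃ v, G.Adj u v := by
  by_contra! hu
  have h2 := h.two_connected (Y := {u}) (Z := {u}ᶜ) (by simp)
    (Finset.card_pos.1 (by rw [Finset.card_compl, Finset.card_singleton]; have := h.three; omega))
    (by
      intro a ha b hb
      rw [Finset.mem_singleton] at ha
      rw [Finset.mem_compl, Finset.mem_singleton] at hb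
      subst ha
      exact ⟨fun h => hb h.symm, hu b⟩)
  simp at h2

theorem exists_isCyc_of_adj (h : Counterexample G t) {u v : V} (huv : G.Adj u v) :
    ∃ l, IsCyc G l ∧ u ∈ l ∧ v ∈ l := by
  classical
  have hne := G.ne_of_adj huv
  by_cases hw : ∃ w, Reach G {u}ᶜ v w ∧ w ≠ v ∧ G.Adj w u
  · obtain ⟨w, hr, hwv, hwu⟩ := hw
    obtain ⟨l, hl, hnd, hlu⟩ := hr.exists_path
    have hvl : v ∈ l := List.mem_of_head? hl.head
    have hwl : w ∈ l := List.mem_of_getLast? hl.last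
    refine ⟨u :: l, (PathList.cons huv hl).isCyc hwu ?_ ?_, by simp, by simp [hvl]⟩
    · have : 2 ≤ l.toFinset.card :=
        Finset.one_lt_card.2 ⟨v, by simpa, w, by simpa, hwv.symm⟩
      have := l.toFinset_card_le
      rw [List.length_cons]
      omega
    · exact List.nodup_cons.2 ⟨fun h => hlu u h rfl, hnd⟩
  · push Not at hw
    exfalso
    let Y : Finset V := Finset.univ.filter fun w => Reach G {u}ᶜ v w
    have hvY : v ∈ Y := by simpa [Y] using Reach.refl (by simpa using hne.symm)
    have huY : u ∉ Y := fun hu => by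
      have : Reach G {u}ᶜ v u := by simpa [Y] using hu
      exact this.right_mem rfl
    by_cases hZ : (insert u Y)ᶜ.Nonempty
    · have := h.two_connected (Y := Y) ⟨v, hvY⟩ hZ (by
        intro a ha b hb
        rw [Finset.mem_compl, Finset.mem_insert, not_or] at hb
        refine ⟨by rintro rfl; exact hb.2 ha, fun hab => hb.2 ?_⟩
        simp only [Y, Finset.mem_filter_univ] at ha ⊢
        exact ha.tail hab (by simpa using hb.1))
      have h2 : (Y ∪ (insert u Y)ᶜ)ᶜ ⊆ {u} := by
        intro a ha
        simp at ha ⊢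
        tauto
      have := Finset.card_le_card h2
      rw [Finset.card_singleton] at this
      omega
    · have hall : ∀ w, w ≠ u → w ∈ Y := by
        intro w hwu
        by_contra hwY
        exact hZ ⟨w, by simp [hwu, hwY]⟩
      have := h.two_connected (Y := {u}) (Z := {u, v}ᶜ) (by simp)
        (Finset.card_pos.1 (by
          rw [Finset.card_compl, Finset.card_pair hne]; have := h.three; omega)) (by
        intro a ha b hb
        rw [Finset.mem_singleton] at ha
        subst ha
        simp only [Finset.mem_compl, Finset.mem_insert, Finset.mem_singleton, not_or] at hb
        refine ⟨fun h => hb.1 h.symm, fun hab => hw b ?_ hb.2 hab.symm⟩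
        simpa [Y] using hall b hb.1)
      have h2 : ({u} ∪ ({u, v} : Finset V)ᶜ)ᶜ ⊆ {v} := by
        intro a ha
        simp at ha ⊢
        tauto
      have := Finset.card_le_card h2
      rw [Finset.card_singleton] at this
      omega

/-- Every clique lies on a cycle. -/
theorem exists_isCyc (h : Counterexample G t) (L : Finset V)
    (hL : ∀ u ∈ L, ∀ v ∈ L, u ≠ v → G.Adj u v) : ∃ l, IsCyc G l ∧ ∀ v ∈ L, v ∈ l := by
  by_cases h3 : 3 ≤ L.card
  · have hp : L.toList.Pairwise G.Adj :=
      L.nodup_toList.pairwise_of_forall_ne fun a ha b hb hab =>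
        hL a (by simpa using ha) b (by simpa using hb) hab
    refine ⟨L.toList, ⟨by simpa, L.nodup_toList, hp.isChain, ?_⟩, by simp⟩
    intro a ha b hb
    have hab : a ≠ b := by
      rintro rfl
      obtain ⟨x, y, r, hl⟩ : ∃ x y r, L.toList = x :: y :: r := by
        have : 3 ≤ L.toList.length := by simpa
        match L.toList, this with
        | x :: y :: r, _ => exact ⟨x, y, r, rfl⟩
      have hnd := L.nodup_toList
      rw [hl] at ha hb hnd
      simp only [List.head?_cons, Option.mem_def, Option.some.injEq] at hb
      subst hb
      rw [List.getLast?_cons_cons] at ha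
      exact (List.nodup_cons.1 hnd).1 (List.mem_of_getLast? ha)
    exact hL a (by simpa using List.mem_of_getLast? ha) b (by simpa using List.mem_of_head? hb) hab
  · obtain ⟨u, v, huv, hLuv⟩ : ∃ u v, G.Adj u v ∧ ∀ w ∈ L, w = u ∨ w = v := by
      by_cases h2 : L.card = 2
      · obtain ⟨u, v, huv, rfl⟩ := Finset.card_eq_two.1 h2
        exact ⟨u, v, hL u (by simp) v (by simp) huv, by simp⟩
      · have : Nonempty V := Fintype.card_pos_iff.1 (by have := h.three; omega)
        obtain ⟨u, hu⟩ := Finset.card_le_one_iff_subset_singleton.1 (show L.card ≤ 1 by omega)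
        obtain ⟨v, huv⟩ := h.exists_adj u
        exact ⟨u, v, huv, fun w hw => Or.inl (by simpa using hu hw)⟩
    obtain ⟨l, hl, hu, hv⟩ := h.exists_isCyc_of_adj huv
    refine ⟨l, hl, fun w hw => ?_⟩
    rcases hLuv w hw with rfl | rfl <;> assumption

end Counterexample

section LowDegree

variable {V : Type*} [Fintype V]

/-- The degree of `v` is less than `n / (t + 1) - 1`. -/
def Low (G : SimpleGraph V) (t : ℝ) (v : V) : Prop :=
  (Nat.card (G.neighborSet v) : ℝ) < Fintype.card V / (t + 1) - 1

theorem Counterexample.adj_of_low [DecidableEq V] {G : SimpleGraph V} {t : ℝ}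
    (h : Counterexample G t) {u v : V} (hu : Low G t u) (hv : Low G t v) (huv : u ≠ v) :
    G.Adj u v := by
  by_contra hadj
  have h1 := h.sigma u v huv hadj
  rw [Low] at hu hv
  push_cast at h1
  rw [mul_div_assoc] at h1
  linarith

end LowDegree

theorem Reach.within {V : Type*} {G : SimpleGraph V} {W : Set V} {a b : V}
    (h : Reach G W a b) : Reach G {u | Reach G W a u} a b :=
  h.induction (P := fun b => Reach G {u | Reach G W a u} a b) (Reach.refl (Reach.refl h.1))
    fun _ _ hau hu huv hv => hu.tail huv (hau.tail huv hv)

/-- A cycle through all vertices of low degree such that the potential of the set `W` of remaining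
vertices is minimal. -/
structure MinCycle (G : SimpleGraph V) (t : ℝ) (c : ℤ → V) (N : ℕ) (W : Finset V) (x : V)
    [Fintype V] [DecidableEq V] : Prop where
  base : Counterexample G t
  cyc : CycFn G c N
  mem_iff : ∀ v, v ∈ W ↔ ∀ i, c i ≠ v
  mem : x ∈ W
  low : ∀ v, Low G t v → ∃ i, c i = v
  le : ∀ l, IsCyc G l → (∀ v, Low G t v → v ∈ l) → potential G W ≤ potential G l.toFinsetᶜ

theorem Counterexample.exists_minimal {V : Type*} [Fintype V] [DecidableEq V]
    {G : SimpleGraph V} {t : ℝ} (h : Counterexample G t) :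
    ∃ c N W x, MinCycle G t c N W x := by
  classical
  have hex : ∃ n l, IsCyc G l ∧ (∀ v, Low G t v → v ∈ l) ∧ potential G l.toFinsetᶜ = n := by
    obtain ⟨l, hl, hlow⟩ := h.exists_isCyc (Finset.univ.filter fun v => Low G t v)
      fun u hu v hv huv => h.adj_of_low (by simpa using hu) (by simpa using hv) huv
    exact ⟨_, l, hl, fun v hv => hlow v (by simpa using hv), rfl⟩
  obtain ⟨l, hl, hlow, hpot⟩ := Nat.find_spec hex
  obtain ⟨c, hc, -, -, hlc⟩ := hl.exists_cycFn
  obtain ⟨x, hx⟩ : ∃ x, x ∉ l := by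
    by_contra! hall
    exact h.nonham (hl.isHamiltonian hall)
  refine ⟨c, l.length, l.toFinsetᶜ, x, h, hc, fun v => ?_, by simpa, fun v hv => ?_, ?_⟩
  · simp [hlc]
  · exact (hlc v).1 (hlow v hv)
  · intro l' hl' hlow'
    rw [hpot]
    exact Nat.find_min' hex ⟨l', hl', hlow', rfl⟩

namespace MinCycle

section Piece

variable {V : Type*} {G : SimpleGraph V} {c : ℤ → V} {W : Finset V} {x : V}

/-- The component of `x` in the subgraph induced on `W`. -/
def comp (G : SimpleGraph V) (W : Finset V) (x : V) : Set V := {u | Reach G W x u}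

/-- The vertices of `W` outside the component of `x`. -/
def rest (G : SimpleGraph V) (W : Finset V) (x : V) : Set V := ↑W \ comp G W x

/-- Position `i` of the cycle is adjacent to the component of `x`. -/
def Foot (G : SimpleGraph V) (c : ℤ → V) (W : Finset V) (x : V) (i : ℤ) : Prop :=
  ∃ y ∈ comp G W x, G.Adj (c i) y

/-- The vertices attached to the positions `b + 1, …, e`. -/
def piece (G : SimpleGraph V) (c : ℤ → V) (W : Finset V) (x : V) (b e : ℤ) : Set V :=
  attached G (rest G W x) (c '' Set.Icc (b + 1) e)

theorem comp_subset : comp G W x ⊆ W := fun _ hu => Reach.right_mem hu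

theorem rest_subset : rest G W x ⊆ W := fun _ hu => hu.1

theorem not_adj_rest {u v : V} (hu : u ∈ comp G W x) (hv : v ∈ rest G W x) : ¬ G.Adj u v :=
  fun huv => hv.2 (Reach.tail hu huv hv.1)

theorem exists_path {y z : V} (hy : y ∈ comp G W x) (hz : z ∈ comp G W x) :
    ∃ l, PathList G l y z ∧ l.Nodup ∧ ∀ v ∈ l, v ∈ comp G W x := by
  obtain ⟨l, hl, hnd, hlW⟩ := (Reach.trans (Reach.symm hy) hz).within.exists_path
  exact ⟨l, hl, hnd, fun v hv => Reach.trans hy (hlW v hv)⟩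

theorem foot_congr {i j : ℤ} (hij : c i = c j) (hi : Foot G c W x i) : Foot G c W x j := by
  rwa [Foot, ← hij]

end Piece

variable {V : Type*} [Fintype V] {G : SimpleGraph V} {t : ℝ} {c : ℤ → V} {N : ℕ}
  {W : Finset V} {x : V}

/-- The positions `b + 1, …, e` cannot be skipped cheaply. -/
def Barrier (G : SimpleGraph V) (t : ℝ) (c : ℤ → V) (W : Finset V) (x : V) (b e : ℤ) : Prop :=
  (comp G W x).ncard ≤ (piece G c W x b e).ncard ∨ Low G t (c e)

variable [DecidableEq V]

theorem mem_comp (h : MinCycle G t c N W x) : x ∈ comp G W x := Reach.refl h.mem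

theorem not_mem (h : MinCycle G t c N W x) (i : ℤ) : c i ∉ W :=
  fun hi => (h.mem_iff _).1 hi i rfl

theorem ncard_attached_lt (h : MinCycle G t c N W x) {b e : ℤ}
    (hbarrier : ∀ i, b < i → i < e → ¬ Barrier G t c W x b i) :
    (attached G (rest G W x) (c '' Set.Icc (b + 1) (e - 1))).ncard < (comp G W x).ncard := by
  by_cases hbe : b + 1 ≤ e - 1
  · have := hbarrier (e - 1) (by omega) (by omega)
    rw [Barrier, not_or, not_le] at this
    exact this.1
  · rw [Set.Icc_eq_empty hbe, Set.image_empty]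
    have : attached G (rest G W x) (∅ : Set V) = ∅ := by
      ext v; simp [attached]
    rw [this, Set.ncard_empty]
    exact (Set.ncard_pos).2 ⟨x, h.mem_comp⟩

/-- Rerouting the cycle through the component of `x` skips all positions between two feet. -/
theorem exists_barrier_of_feet (h : MinCycle G t c N W x) {b b' : ℤ} (hb : Foot G c W x b)
    (hb' : Foot G c W x b') (h1 : b < b') (h2 : b' < b + N)
    (hfoot : ∀ i, b < i → i < b' → ¬ Foot G c W x i) :
    ∃ e, b < e ∧ e < b' ∧ Barrier G t c W x b e := by
  by_contra! hbarrier
  obtain ⟨y, hy, hby⟩ := hb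
  obtain ⟨z, hz, hbz⟩ := hb'
  obtain ⟨p, hp, hpnd, hpH⟩ := exists_path hy hz
  have hN := h.cyc.three
  have hyp : y ∈ p := List.mem_of_head? hp.head
  have hl : IsCyc G (p ++ seg c b' (b + N)) := by
    refine (hp.append (PathList.seg h.cyc.adj (by omega)) hbz.symm).isCyc ?_ ?_ ?_
    · rw [h.cyc.per]; exact hby
    · have := List.length_pos_of_mem hyp
      rw [List.length_append, length_seg]
      omega
    · rw [List.nodup_append]
      refine ⟨hpnd, nodup_seg h.cyc.inj (by omega), ?_⟩
      rintro v hv w hw rfl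
      obtain ⟨i, -, -, rfl⟩ := mem_seg.1 hw
      exact h.not_mem i (comp_subset (hpH _ hv))
  have hmem : ∀ v, v ∉ p ++ seg c b' (b + N) → v ∉ W → ∃ i, b < i ∧ i < b' ∧ c i = v := by
    intro v hv hvW
    rw [h.mem_iff] at hvW
    push Not at hvW
    obtain ⟨j, rfl⟩ := hvW
    obtain ⟨i, hi1, hi2, hij⟩ := h.cyc.exists_rep (b + 1) j
    refine ⟨i, by omega, ?_, hij⟩
    by_contra hi
    exact hv (List.mem_append_right _ (mem_seg.2 ⟨i, by omega, by omega, hij⟩))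
  refine absurd (h.le _ hl fun v hv => ?_) (not_le.2 ?_)
  · by_contra hvl
    have hvW : v ∉ W := by
      obtain ⟨i, rfl⟩ := h.low v hv
      exact h.not_mem i
    obtain ⟨i, hi1, hi2, rfl⟩ := hmem v hvl hvW
    exact hbarrier i hi1 hi2 (Or.inr hv)
  · refine potential_lt_of_attached h.mem (H := comp G W x) (O := rest G W x) rfl rfl
      (ι := Unit) (D := fun _ => c '' Set.Icc (b + 1) (b' - 1)) ?_ hy (by simp [hyp]) ?_ ?_ ?_
    · intro v hv
      rw [Finset.mem_compl, List.mem_toFinset] at hv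
      by_cases hvW : v ∈ W
      · by_cases hvH : v ∈ comp G W x
        · exact Or.inl hvH
        · exact Or.inr (Or.inl ⟨hvW, hvH⟩)
      · obtain ⟨i, hi1, hi2, rfl⟩ := hmem v hv hvW
        exact Or.inr (Or.inr ⟨(), i, ⟨by omega, by omega⟩, rfl⟩)
    · rintro - _ ⟨i, ⟨hi1, hi2⟩, rfl⟩ w hw
      exact ⟨fun hiw => h.not_mem i (hiw ▸ comp_subset hw),
        fun hiw => hfoot i (by omega) (by omega) ⟨w, hw, hiw⟩⟩
    · intro i j hij
      exact (hij rfl).elim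
    · exact fun _ => h.ncard_attached_lt fun i hi1 hi2 => hbarrier i hi1 hi2

/-- Segments following two distinct feet are not linked through the rest. -/
theorem not_reach (h : MinCycle G t c N W x) {b b₂ : ℤ} (hb : Foot G c W x b)
    (hb₂ : Foot G c W x b₂) {i j : ℤ} (hbi : b < i) (hib : i < b₂) (hbj : b₂ < j)
    (hjb : j < b + N)
    (hfoot : ∀ k, b < k → k ≤ i → ¬ Foot G c W x k)
    (hfoot₂ : ∀ k, b₂ < k → k ≤ j → ¬ Foot G c W x k)
    (hbarrier : ∀ k, b < k → k < i → ¬ Barrier G t c W x b k)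
    (hbarrier₂ : ∀ k, b₂ < k → k < j → ¬ Barrier G t c W x b₂ k) :
    ¬ Reach G (insert (c i) (insert (c j) (rest G W x))) (c i) (c j) := by
  induction hm : (i + j - b - b₂).toNat using Nat.strong_induction_on generalizing i j with
  | _ m ih =>
  intro hr
  have hIH : ∀ i' j', b < i' → i' < i → b₂ < j' → j' < j →
      ¬ Reach G (insert (c i') (insert (c j') (rest G W x))) (c i') (c j') := by
    intro i' j' h1 h2 h3 h4
    exact ih (i' + j' - b - b₂).toNat (by omega) h1 (by omega) h3 (by omega)
      (fun k hk hk' => hfoot k hk (by omega)) (fun k hk hk' => hfoot₂ k hk (by omega))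
      (fun k hk hk' => hbarrier k hk (by omega)) (fun k hk hk' => hbarrier₂ k hk (by omega)) rfl
  obtain ⟨y, hy, hby⟩ := hb
  obtain ⟨z, hz, hbz⟩ := hb₂
  obtain ⟨p, hp, hpnd, hpH⟩ := exists_path hy hz
  obtain ⟨q, hq, hqnd, hqO⟩ := hr.exists_path
  have hN := h.cyc.three
  have hyp : y ∈ p := List.mem_of_head? hp.head
  have hiq : c i ∈ q := List.mem_of_head? hq.head
  have hjq : c j ∈ q := List.mem_of_getLast? hq.last
  have hpc : ∀ k, c k ∉ p := fun k hk => h.not_mem k (comp_subset (hpH _ hk))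
  have hqc : ∀ k, c k ∈ q → c k = c i ∨ c k = c j := by
    intro k hk
    rcases hqO _ hk with h' | h' | h'
    · exact Or.inl h'
    · exact Or.inr h'
    · exact (h.not_mem k (rest_subset h')).elim
  have hl : IsCyc G (p ++ ((seg c (i + 1) b₂).reverse ++ (q ++ seg c (j + 1) (b + N)))) := by
    refine (hp.append ((PathList.seg h.cyc.adj (show i + 1 ≤ b₂ by omega)).reverse.append
      (hq.append (PathList.seg h.cyc.adj (show j + 1 ≤ b + N by omega)) (h.cyc.adj j))
      (h.cyc.adj i).symm) hbz.symm).isCyc ?_ ?_ ?_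
    · rw [h.cyc.per]; exact hby
    · have h1 := List.length_pos_of_mem hyp
      have h2 := List.length_pos_of_mem hiq
      simp only [List.length_append, List.length_reverse, length_seg]
      omega
    · rw [List.nodup_append, List.nodup_append, List.nodup_append, List.nodup_reverse]
      refine ⟨hpnd, ⟨nodup_seg h.cyc.inj (by omega), ⟨hqnd, nodup_seg h.cyc.inj (by omega), ?_⟩,
        ?_⟩, ?_⟩
      · rintro v hv w hw rfl
        obtain ⟨k, hk1, hk2, rfl⟩ := mem_seg.1 hw
        rcases hqc k hv with h' | h'
        · have := h.cyc.eq_of_close h' (by omega) (by omega); omega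
        · have := h.cyc.eq_of_close h' (by omega) (by omega); omega
      · rintro v hv w hw rfl
        rw [List.mem_reverse] at hv
        obtain ⟨k, hk1, hk2, rfl⟩ := mem_seg.1 hv
        rcases List.mem_append.1 hw with hw | hw
        · rcases hqc k hw with h' | h'
          · have := h.cyc.eq_of_close h' (by omega) (by omega); omega
          · have := h.cyc.eq_of_close h' (by omega) (by omega); omega
        · obtain ⟨k', hk1', hk2', hk'⟩ := mem_seg.1 hw
          have := h.cyc.eq_of_close hk' (by omega) (by omega); omega
      · rintro v hv w hw rfl
        rcases List.mem_append.1 hw with hw | hw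
        · rw [List.mem_reverse] at hw
          obtain ⟨k, -, -, rfl⟩ := mem_seg.1 hw
          exact hpc k hv
        · rcases List.mem_append.1 hw with hw | hw
          · rcases hqO _ hw with h' | h' | h'
            · exact hpc i (h' ▸ hv)
            · exact hpc j (h' ▸ hv)
            · exact h'.2 (hpH _ hv)
          · obtain ⟨k, -, -, rfl⟩ := mem_seg.1 hw
            exact hpc k hv
  generalize hl' : p ++ ((seg c (i + 1) b₂).reverse ++ (q ++ seg c (j + 1) (b + N))) = l at hl
  have hmem : ∀ v, v ∉ l → v ∉ W →
      ∃ k, c k = v ∧ (b < k ∧ k < i ∨ b₂ < k ∧ k < j) := by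
    intro v hv hvW
    rw [h.mem_iff] at hvW
    push Not at hvW
    obtain ⟨k', rfl⟩ := hvW
    obtain ⟨k, hk1, hk2, hk⟩ := h.cyc.exists_rep (b + 1) k'
    simp only [← hl', List.mem_append, List.mem_reverse, mem_seg, not_or] at hv
    refine ⟨k, hk, ?_⟩
    by_contra hcon
    rcases lt_trichotomy k i with h' | rfl | h'
    · omega
    · exact hv.2.2.1 (hk ▸ hiq)
    by_cases h'' : k ≤ b₂
    · exact hv.2.1 ⟨k, by omega, h'', hk⟩
    rcases lt_trichotomy k j with h' | rfl | h'
    · omega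
    · exact hv.2.2.1 (hk ▸ hjq)
    · exact hv.2.2.2 ⟨k, by omega, by omega, hk⟩
  refine absurd (h.le _ hl fun v hv => ?_) (not_le.2 ?_)
  · by_contra hvl
    have hvW : v ∉ W := by
      obtain ⟨i, rfl⟩ := h.low v hv
      exact h.not_mem i
    obtain ⟨k, rfl, ⟨hk1, hk2⟩ | ⟨hk1, hk2⟩⟩ := hmem v hvl hvW
    · exact hbarrier k hk1 hk2 (Or.inr hv)
    · exact hbarrier₂ k hk1 hk2 (Or.inr hv)
  · refine potential_lt_of_attached h.mem (H := comp G W x) (O := rest G W x) rfl rfl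
      (ι := Bool) (D := fun s => bif s then c '' Set.Icc (b + 1) (i - 1)
        else c '' Set.Icc (b₂ + 1) (j - 1)) ?_ hy (by simp [← hl', hyp]) ?_ ?_ ?_
    · intro v hv
      rw [Finset.mem_compl, List.mem_toFinset] at hv
      by_cases hvW : v ∈ W
      · by_cases hvH : v ∈ comp G W x
        · exact Or.inl hvH
        · exact Or.inr (Or.inl ⟨hvW, hvH⟩)
      · obtain ⟨k, rfl, ⟨hk1, hk2⟩ | ⟨hk1, hk2⟩⟩ := hmem v hv hvW
        · exact Or.inr (Or.inr ⟨true, k, ⟨by omega, by omega⟩, rfl⟩)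
        · exact Or.inr (Or.inr ⟨false, k, ⟨by omega, by omega⟩, rfl⟩)
    · rintro (_ | _) _ ⟨k, ⟨hk1, hk2⟩, rfl⟩ w hw
      · exact ⟨fun hkw => h.not_mem k (hkw ▸ comp_subset hw),
          fun hkw => hfoot₂ k (by omega) (by omega) ⟨w, hw, hkw⟩⟩
      · exact ⟨fun hkw => h.not_mem k (hkw ▸ comp_subset hw),
          fun hkw => hfoot k (by omega) (by omega) ⟨w, hw, hkw⟩⟩
    · rintro (_ | _) (_ | _) hss
      · exact (hss rfl).elim
      · rintro _ ⟨k, ⟨hk1, hk2⟩, rfl⟩ _ ⟨k', ⟨hk1', hk2'⟩, rfl⟩ hr'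
        rw [Set.insert_comm] at hr'
        exact hIH k' k (by omega) (by omega) (by omega) (by omega) hr'.symm
      · rintro _ ⟨k, ⟨hk1, hk2⟩, rfl⟩ _ ⟨k', ⟨hk1', hk2'⟩, rfl⟩
        exact hIH k k' (by omega) (by omega) (by omega) (by omega)
      · exact (hss rfl).elim
    · rintro (_ | _)
      · exact h.ncard_attached_lt hbarrier₂
      · exact h.ncard_attached_lt hbarrier

end MinCycle

namespace MinCycle

variable {V : Type*} [Fintype V] {G : SimpleGraph V} {t : ℝ} {c : ℤ → V} {N : ℕ}
  {W : Finset V} {x : V}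

open Classical in
/-- The vertices of the cycle adjacent to the component of `x`. -/
noncomputable def feet (G : SimpleGraph V) (W : Finset V) (x : V) : Finset V :=
  Finset.univ.filter fun v => v ∉ comp G W x ∧ ∃ y ∈ comp G W x, G.Adj v y

theorem mem_feet {v : V} :
    v ∈ feet G W x ↔ v ∉ comp G W x ∧ ∃ y ∈ comp G W x, G.Adj v y := by
  simp [feet]

variable [DecidableEq V]

theorem mem_feet_iff (h : MinCycle G t c N W x) (i : ℤ) :
    c i ∈ feet G W x ↔ Foot G c W x i := by
  rw [mem_feet, Foot, and_iff_right]
  exact fun hi => h.not_mem i (comp_subset hi)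

theorem exists_pos (h : MinCycle G t c N W x) {v : V} (hv : v ∈ feet G W x) (s : ℤ) :
    ∃ i, s ≤ i ∧ i < s + N ∧ c i = v := by
  have hvW : v ∉ W := by
    rw [mem_feet] at hv
    obtain ⟨hvH, y, hy, hvy⟩ := hv
    intro hvW
    exact not_adj_rest hy ⟨hvW, hvH⟩ hvy.symm
  rw [h.mem_iff] at hvW
  push Not at hvW
  obtain ⟨i, rfl⟩ := hvW
  exact h.cyc.exists_rep s i

theorem card_feet (h : MinCycle G t c N W x)
    (hZ : ∃ v, v ∉ comp G W x ∧ v ∉ feet G W x) :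
    2 ≤ (feet G W x).card ∧ 2 * t ≤ (feet G W x).card := by
  classical
  obtain ⟨v, hv⟩ := hZ
  let Y : Finset V := (comp G W x).toFinset
  let Z : Finset V := (Y ∪ feet G W x)ᶜ
  have hY : Y.Nonempty := ⟨x, by simpa [Y] using h.mem_comp⟩
  have hZ : Z.Nonempty := ⟨v, by simpa [Z, Y] using hv⟩
  have hsep : ∀ u ∈ Y, ∀ v ∈ Z, u ≠ v ∧ ¬ G.Adj u v := by
    intro u hu v hv
    simp only [Z, Y, Finset.mem_compl, Finset.mem_union, not_or, Set.mem_toFinset,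
      mem_feet] at hu hv
    exact ⟨fun huv => hv.1 (huv ▸ hu), fun huv => hv.2 ⟨hv.1, u, hu, huv.symm⟩⟩
  have hsub : (Y ∪ Z)ᶜ ⊆ feet G W x := by
    intro a ha
    simp only [Z, Finset.mem_compl, Finset.mem_union, not_or] at ha
    tauto
  have hcard := Finset.card_le_card hsub
  refine ⟨(h.base.two_connected hY hZ hsep).trans hcard, (h.base.tough_pair hY hZ hsep).trans ?_⟩
  exact_mod_cast hcard

theorem two_le_card_feet (h : MinCycle G t c N W x) : 2 ≤ (feet G W x).card := by
  by_cases hZ : ∃ v, v ∉ comp G W x ∧ v ∉ feet G W x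
  · exact (h.card_feet hZ).1
  · push Not at hZ
    have hN := h.cyc.three
    refine Finset.one_lt_card.2 ⟨c 0, hZ _ ?_, c 1, hZ _ ?_, h.cyc.ne_of_lt (by omega) (by omega)⟩
    · exact fun hi => h.not_mem _ (comp_subset hi)
    · exact fun hi => h.not_mem _ (comp_subset hi)

theorem exists_barrier (h : MinCycle G t c N W x) {b : ℤ} (hb : Foot G c W x b) :
    ∃ e, b < e ∧ (∀ i, b < i → i ≤ e → ¬ Foot G c W x i) ∧ Barrier G t c W x b e ∧
      ∀ i, b < i → i < e → ¬ Barrier G t c W x b i := by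
  obtain ⟨v, hv, hvb⟩ := Finset.exists_mem_ne h.two_le_card_feet (c b)
  obtain ⟨i, hi1, hi2, rfl⟩ := h.exists_pos hv b
  have hib : b < i := lt_of_le_of_ne hi1 (by rintro rfl; exact hvb rfl)
  obtain ⟨b', ⟨hb1, hb2⟩, hb3⟩ := Int.exists_least_of_bdd (P := fun i => b < i ∧ Foot G c W x i)
    ⟨b, fun z hz => hz.1.le⟩ ⟨i, hib, (h.mem_feet_iff i).1 hv⟩
  have hb'i := hb3 i ⟨hib, (h.mem_feet_iff i).1 hv⟩
  have hfoot : ∀ i, b < i → i < b' → ¬ Foot G c W x i :=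
    fun i h1 h2 h3 => absurd (hb3 i ⟨h1, h3⟩) (by omega)
  obtain ⟨e₀, h1, h2, h3⟩ := h.exists_barrier_of_feet hb hb2 hb1 (by omega) hfoot
  obtain ⟨e, ⟨he1, he2⟩, he3⟩ :=
    Int.exists_least_of_bdd (P := fun i => b < i ∧ Barrier G t c W x b i)
    ⟨b, fun z hz => hz.1.le⟩ ⟨e₀, h1, h3⟩
  have hee := he3 e₀ ⟨h1, h3⟩
  exact ⟨e, he1, fun i hi1 hi2 => hfoot i hi1 (by omega), he2,
    fun i hi1 hi2 hi3 => absurd (he3 i ⟨hi1, hi3⟩) (by omega)⟩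

/-- The pieces following two distinct feet are separated. -/
theorem piece_separated (h : MinCycle G t c N W x) {b b₂ e e₂ : ℤ} (hb : Foot G c W x b)
    (hb₂ : Foot G c W x b₂) (hbb : b < b₂) (hbN : b₂ < b + N)
    (hfoot : ∀ i, b < i → i ≤ e → ¬ Foot G c W x i)
    (hbarrier : ∀ i, b < i → i < e → ¬ Barrier G t c W x b i)
    (hfoot₂ : ∀ i, b₂ < i → i ≤ e₂ → ¬ Foot G c W x i)
    (hbarrier₂ : ∀ i, b₂ < i → i < e₂ → ¬ Barrier G t c W x b₂ i)
    {u v : V} (hu : u ∈ piece G c W x b e) (hv : v ∈ piece G c W x b₂ e₂) :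
    u ≠ v ∧ ¬ G.Adj u v := by
  rw [← not_or]
  intro huv
  obtain ⟨_, ⟨i, ⟨hi1, hi2⟩, rfl⟩, _, ⟨j, ⟨hj1, hj2⟩, rfl⟩, hr⟩ :=
    exists_reach_of_attached hu hv huv
  have hbN' : Foot G c W x (b + N) := foot_congr (h.cyc.per b).symm hb
  have h1 : e < b₂ := by
    by_contra hcon
    exact hfoot b₂ hbb (by omega) hb₂
  have h2 : e₂ < b + N := by
    by_contra hcon
    exact hfoot₂ (b + N) hbN (by omega) hbN'
  exact h.not_reach hb hb₂ (by omega) (by omega) (by omega) (by omega)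
    (fun k hk hk' => hfoot k hk (by omega)) (fun k hk hk' => hfoot₂ k hk (by omega))
    (fun k hk hk' => hbarrier k hk (by omega)) (fun k hk hk' => hbarrier₂ k hk (by omega)) hr

/-- There are pairwise separated sets `P a`, one for each foot, such that each of them is
either as large as the component of `x` or contains a vertex of low degree. -/
theorem exists_pieces (h : MinCycle G t c N W x) :
    ∃ P : feet G W x → Finset V, ∃ f : feet G W x → V,
      (∀ a, f a ∈ P a ∧ f a ∉ comp G W x ∧ f a ∉ feet G W x ∧ f a ∉ W) ∧
      (∀ a, ∀ u ∈ P a, u ∉ comp G W x) ∧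
      (∀ a, (comp G W x).ncard ≤ (P a).card ∨ Low G t (f a)) ∧
      (∀ a a', a ≠ a' → ∀ u ∈ P a, ∀ v ∈ P a', u ≠ v ∧ ¬ G.Adj u v) ∧
      ∀ a, ∀ u ∈ P a, ∀ v ∈ W, v ∉ P a → u ≠ v ∧ ¬ G.Adj u v := by
  classical
  choose pos hpos1 hpos2 hpos using fun a : feet G W x => h.exists_pos a.2 0
  have hpf : ∀ a, Foot G c W x (pos a) := fun a =>
    (h.mem_feet_iff _).1 (by rw [hpos]; exact a.2)
  choose e he hfoot hbarrier hmin using fun a => h.exists_barrier (hpf a)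
  refine ⟨fun a => (piece G c W x (pos a) (e a)).toFinset, fun a => c (e a), ?_, ?_, ?_, ?_, ?_⟩
  · intro a
    refine ⟨?_, fun hi => h.not_mem _ (comp_subset hi), ?_, h.not_mem _⟩
    · rw [Set.mem_toFinset]
      exact subset_attached ⟨e a, ⟨he a, le_rfl⟩, rfl⟩
    · rw [h.mem_feet_iff]
      exact hfoot a _ (he a) le_rfl
  · intro a u hu huH
    rw [Set.mem_toFinset] at hu
    rcases attached_subset hu with ⟨i, -, rfl⟩ | hu
    · exact h.not_mem _ (comp_subset huH)
    · exact hu.2 huH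
  · intro a
    rw [← Set.ncard_eq_toFinset_card']
    exact hbarrier a
  · have key : ∀ a a', pos a < pos a' → ∀ u ∈ piece G c W x (pos a) (e a),
        ∀ v ∈ piece G c W x (pos a') (e a'), u ≠ v ∧ ¬ G.Adj u v := by
      intro a a' hlt u hu v hv
      have := hpos1 a
      have := hpos2 a'
      exact h.piece_separated (hpf a) (hpf a') hlt (by omega) (hfoot a) (hmin a) (hfoot a')
        (hmin a') hu hv
    intro a a' haa u hu v hv
    rw [Set.mem_toFinset] at hu hv
    rcases lt_trichotomy (pos a) (pos a') with hlt | heq | hlt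
    · exact key a a' hlt u hu v hv
    · exact (haa (Subtype.ext (by rw [← hpos, heq, hpos]))).elim
    · have := key a' a hlt v hv u hu
      exact ⟨this.1.symm, fun huv => this.2 huv.symm⟩
  · intro a u hu v hv hvP
    refine ⟨fun huv => hvP (huv ▸ hu), fun huv => ?_⟩
    rw [Set.mem_toFinset] at hu hvP
    by_cases hvH : v ∈ comp G W x
    · rcases attached_subset hu with ⟨i, ⟨hi1, hi2⟩, rfl⟩ | hu
      · exact hfoot a i (by omega) hi2 ⟨v, hvH, huv⟩
      · exact not_adj_rest hvH hu huv.symm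
    · exact hvP (attached_tail hu huv ⟨hv, hvH⟩)

end MinCycle

namespace MinCycle

variable {V : Type*} [Fintype V] {G : SimpleGraph V} {t : ℝ} {c : ℤ → V} {N : ℕ}
  {W : Finset V} {x : V} [DecidableEq V]

theorem degree_add_one_le (h : MinCycle G t c N W x) :
    Nat.card (G.neighborSet x) + 1 ≤ (feet G W x).card + (comp G W x).ncard := by
  classical
  have hsub : G.neighborSet x ⊆ (comp G W x \ {x}) ∪ ↑(feet G W x) := by
    intro v hv
    have hvx : v ≠ x := (G.ne_of_adj hv).symm
    by_cases hvH : v ∈ comp G W x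
    · exact Or.inl ⟨hvH, hvx⟩
    · exact Or.inr (mem_feet.2 ⟨hvH, x, h.mem_comp, G.adj_symm hv⟩)
  have h1 := (Set.ncard_le_ncard hsub).trans (Set.ncard_union_le _ _)
  have h2 := Set.ncard_sdiff_singleton_add_one h.mem_comp
  rw [Set.ncard_coe_finset] at h1
  change (G.neighborSet x).ncard + 1 ≤ _
  omega

/-- The component of a minimal cycle is a singleton and toughness is attained. -/
theorem tight (h : MinCycle G t c N W x) : Tight G t c N x (feet G W x).card := by
  classical
  obtain ⟨P, f, hf, hPH, hbig, hsep, hW⟩ := h.exists_pieces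
  have ht := h.base.tpos
  have hA := h.two_le_card_feet
  obtain ⟨a₀⟩ : Nonempty (feet G W x) := by
    obtain ⟨v, hv⟩ := Finset.card_pos.1 (show 0 < (feet G W x).card by omega)
    exact ⟨⟨v, hv⟩⟩
  have hAt := (h.card_feet ⟨f a₀, (hf a₀).2.1, (hf a₀).2.2.1⟩).2
  let P₀ : Finset V := W.filter fun v => ∀ a, v ∉ P a
  have hP₀ : ∀ v ∈ comp G W x, v ∈ P₀ := fun v hv =>
    Finset.mem_filter.2 ⟨comp_subset hv, fun a ha => hPH a v ha hv⟩
  have hxP₀ : x ∈ P₀ := hP₀ x h.mem_comp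
  have hcount := h.base.tough.mul_card_add_sum_le ht (ι := Option (feet G W x))
    (by rw [Fintype.card_option, Fintype.card_coe]; omega) (fun o => o.elim P₀ P) (by
      rintro (_ | a)
      · exact ⟨x, hxP₀⟩
      · exact ⟨f a, (hf a).1⟩) (by
      rintro (_ | a) (_ | a') hij u hu v hv
      · exact (hij rfl).elim
      · obtain ⟨hu1, hu2⟩ := Finset.mem_filter.1 hu
        have := hW a' v hv u hu1 (hu2 a')
        exact ⟨this.1.symm, fun huv => this.2 huv.symm⟩
      · obtain ⟨hv1, hv2⟩ := Finset.mem_filter.1 hv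
        exact hW a u hu v hv1 (hv2 a)
      · exact hsep a a' (fun haa => hij (haa ▸ rfl)) u hu v hv)
  rw [Fintype.sum_option] at hcount
  simp only [Option.elim_none, Option.elim_some, Fintype.card_option, Fintype.card_coe,
    Nat.cast_add, Nat.cast_one] at hcount
  have hP₀c : (comp G W x).ncard ≤ P₀.card := by
    rw [← Set.ncard_coe_finset]
    exact Set.ncard_le_ncard hP₀
  have hH1 : 1 ≤ (comp G W x).ncard := (Set.ncard_pos).2 ⟨x, h.mem_comp⟩
  have hxlow : ¬ Low G t x := fun hx => by
    obtain ⟨i, hi⟩ := h.low x hx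
    exact (h.mem_iff x).1 h.mem i hi
  have hdeg : (Nat.card (G.neighborSet x) : ℝ) + 1 ≤
      (feet G W x).card + (comp G W x).ncard := by exact_mod_cast h.degree_add_one_le
  have hP₀r : ((comp G W x).ncard : ℝ) ≤ P₀.card := by exact_mod_cast hP₀c
  have hH1r : (1 : ℝ) ≤ (comp G W x).ncard := by exact_mod_cast hH1
  have hAr : (2 : ℝ) ≤ (feet G W x).card := by exact_mod_cast hA
  have hcardA : Fintype.card (feet G W x) = (feet G W x).card := by simp
  have hdisj : ∀ a, (comp G W x).ncard ≤ (P a).card := by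
    by_contra! hbad
    obtain ⟨a, ha⟩ := hbad
    have hlow : Low G t (f a) := (hbig a).resolve_left (not_le.2 ha)
    have hoth : ∀ a', a' ≠ a → (comp G W x).ncard ≤ (P a').card := by
      intro a' haa
      refine (hbig a').resolve_right fun hlow' => ?_
      have := hsep a' a haa (f a') (hf a').1 (f a) (hf a).1
      exact this.2 (h.base.adj_of_low hlow' hlow this.1)
    have hsum : (comp G W x).ncard * ((feet G W x).card - 1) + 1 ≤ ∑ a, (P a).card := by
      rw [← Finset.sum_erase_add _ _ (Finset.mem_univ a)]
      refine add_le_add ?_ (Finset.card_pos.2 ⟨_, (hf a).1⟩)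
      have := Finset.card_nsmul_le_sum (Finset.univ.erase a) (fun a => (P a).card)
        (comp G W x).ncard fun a' ha' => hoth a' (Finset.ne_of_mem_erase ha')
      rw [Finset.card_erase_of_mem (Finset.mem_univ a), Finset.card_univ, hcardA,
        smul_eq_mul, mul_comm] at this
      exact this
    have hsumr : ((comp G W x).ncard : ℝ) * ((feet G W x).card - 1) + 1 ≤
        ((∑ a, (P a).card : ℕ) : ℝ) := by
      have : (((comp G W x).ncard * ((feet G W x).card - 1) + 1 : ℕ) : ℝ) ≤
        ((∑ a, (P a).card : ℕ) : ℝ) := by exact_mod_cast hsum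
      rwa [Nat.cast_add, Nat.cast_mul, Nat.cast_sub (by omega), Nat.cast_one] at this
    have hxf : ¬ G.Adj x (f a) := fun hadj =>
      (hf a).2.2.1 (mem_feet.2 ⟨(hf a).2.1, x, h.mem_comp, hadj.symm⟩)
    have hne : x ≠ f a := fun hxf => (hf a).2.2.2 (hxf ▸ h.mem)
    have h1 := h.base.sigma x (f a) hne hxf
    rw [Low] at hlow
    push_cast at h1
    rw [mul_div_assoc] at h1
    have h2 : (Fintype.card V : ℝ) / (t + 1) < (feet G W x).card + (comp G W x).ncard := by
      linarith
    rw [div_lt_iff₀ (by linarith)] at h2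
    generalize ((comp G W x).ncard : ℝ) = η at *
    generalize ((feet G W x).card : ℝ) = α at *
    have h3 : (η - 1) * (α - 1) < t * (η - 1) := by nlinarith
    have h4 : (η - 1) * (α - 1 - t) < 0 := by linarith
    have h5 : 0 ≤ (η - 1) * (α - 1 - t) := mul_nonneg (by linarith) (by linarith)
    linarith
  have hsum : (feet G W x).card * (comp G W x).ncard ≤ ∑ a, (P a).card := by
    have := Finset.card_nsmul_le_sum Finset.univ (fun a => (P a).card)
      (comp G W x).ncard fun a _ => hdisj a
    rwa [Finset.card_univ, hcardA, smul_eq_mul] at this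
  have hsumr : ((feet G W x).card : ℝ) * (comp G W x).ncard ≤ ((∑ a, (P a).card : ℕ) : ℝ) := by
    exact_mod_cast hsum
  have hd : (Fintype.card V : ℝ) / (t + 1) ≤ Nat.card (G.neighborSet x) + 1 := by
    rw [Low, not_lt] at hxlow
    linarith
  have hdn : (Fintype.card V : ℝ) ≤ ((feet G W x).card + (comp G W x).ncard) * (t + 1) := by
    rw [← div_le_iff₀ (by linarith)]
    linarith
  have hH : (comp G W x).ncard = 1 := by
    by_contra hne
    have : (2 : ℝ) ≤ (comp G W x).ncard := by
      have : 2 ≤ (comp G W x).ncard := by omega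
      exact_mod_cast this
    generalize ((comp G W x).ncard : ℝ) = η at *
    generalize ((feet G W x).card : ℝ) = α at *
    nlinarith
  simp only [hH, Nat.cast_one, mul_one] at hdn hsumr hP₀r hdeg hsum hdisj
  have hn : (Fintype.card V : ℝ) = (t + 1) * ((feet G W x).card + 1) := by linarith
  have hP₀1 : P₀.card = 1 := by
    have : (P₀.card : ℝ) ≤ 1 := by linarith
    have : P₀.card ≤ 1 := by exact_mod_cast this
    omega
  have hsum1 : ∑ a, (P a).card = (feet G W x).card := by
    have : ((∑ a, (P a).card : ℕ) : ℝ) ≤ (feet G W x).card := by linarith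
    have : ∑ a, (P a).card ≤ (feet G W x).card := by exact_mod_cast this
    omega
  have hPone : ∀ a, (P a).card = 1 := by
    have h1 : ∑ a : feet G W x, 1 = ∑ a, (P a).card := by
      rw [hsum1, Finset.sum_const, Finset.card_univ, hcardA, smul_eq_mul, mul_one]
    exact fun a =>
      ((Finset.sum_eq_sum_iff_of_le fun a _ => hdisj a).1 h1 a (Finset.mem_univ a)).symm
  have hdiv : 2 * (Fintype.card V : ℝ) / (t + 1) - 2 = 2 * (feet G W x).card := by
    rw [hn]
    field_simp
    ring
  refine ⟨ht, h.base.tough, h.base.nonham, fun u v huv hadj => ?_, hA, hn, h.cyc,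
    (h.mem_iff x).1 h.mem, fun v hvx => ?_, ?_⟩
  · have := h.base.sigma u v huv hadj
    rw [hdiv] at this
    exact_mod_cast this
  · by_contra! hv
    have hvW : v ∈ W := (h.mem_iff v).2 hv
    by_cases hvP : ∃ a, v ∈ P a
    · obtain ⟨a, ha⟩ := hvP
      have := Finset.card_le_one.1 (hPone a).le v ha (f a) (hf a).1
      exact (hf a).2.2.2 (this ▸ hvW)
    · push Not at hvP
      exact hvx (Finset.card_le_one.1 hP₀1.le v (Finset.mem_filter.2 ⟨hvW, hvP⟩) x hxP₀)
  · have h1 : ((feet G W x).card : ℝ) ≤ Nat.card (G.neighborSet x) := by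
      have : (Fintype.card V : ℝ) / (t + 1) = (feet G W x).card + 1 := by
        rw [hn]; field_simp
      linarith
    have h2 : (feet G W x).card ≤ Nat.card (G.neighborSet x) := by exact_mod_cast h1
    have := h.degree_add_one_le
    omega

end MinCycle

/-- **Characterization of the extremal graphs.** If `G` is a `t`-tough graph on `n ≥ 3`
vertices with `σ₂(G) = 2n/(t+1) − 2` that is not hamiltonian, then `n` is odd and `G` is
the join of some graph `H` on `(n−1)/2` vertices with the edgeless graph on `(n+1)/2`
vertices. -/
theorem stmt1 {V : Type*} [Fintype V] [DecidableEq V] (t : ℝ) (ht : 0 < t)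
    (G : SimpleGraph V) (hn : 3 ≤ Fintype.card V) (htough : Tough t G)
    (hsigma2lb : ∀ u v : V, u ≠ v → ¬ G.Adj u v →
      2 * (Fintype.card V : ℝ) / (t + 1) - 2 ≤
        ((Nat.card (G.neighborSet u) + Nat.card (G.neighborSet v) : ℕ) : ℝ))
    (hsigma2eq : ∃ u v : V, u ≠ v ∧ ¬ G.Adj u v ∧
      ((Nat.card (G.neighborSet u) + Nat.card (G.neighborSet v) : ℕ) : ℝ) =
        2 * (Fintype.card V : ℝ) / (t + 1) - 2)
    (hnh : ¬ G.IsHamiltonian) :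
    ∃ m : ℕ, Fintype.card V = 2 * m + 1 ∧
      ∃ H : SimpleGraph (Fin m),
        Nonempty (G ≃g graphJoin H (⊥ : SimpleGraph (Fin (m + 1)))) := by
  by_contra hcon
  obtain ⟨c, N, W, x, h⟩ :=
    Counterexample.exists_minimal ⟨ht, hn, htough, hsigma2lb, hnh, hcon⟩
  exact hcon h.tight.exists_iso
end

section
/- Let t > 0 be a real number, let G be a t-tough graph on n vertices, and let C be a cycle of G that is not hamiltonian. If a vertex x ∈ V(G)∖V(C) has more than n/(t+1) − 1 neighbors on C, then G has a cycle C′ with V(C′) = V(C) ∪ {x}. -/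
open SimpleGraph

namespace SimpleGraph

variable {V : Type*} {G : SimpleGraph V}

/-- A walk can be split at any of its darts. -/
theorem Walk.exists_eq_append_cons_of_mem_darts {u v : V} (p : G.Walk u v) {d : G.Dart}
    (hd : d ∈ p.darts) :
    ∃ (q : G.Walk u d.fst) (r : G.Walk d.snd v), p = q.append (.cons d.adj r) := by
  induction p with
  | nil => simp at hd
  | cons h p ih =>
    rw [Walk.darts_cons, List.mem_cons] at hd
    rcases hd with rfl | hd
    · exact ⟨.nil, p, rfl⟩
    · obtain ⟨q, r, rfl⟩ := ih hd
      exact ⟨.cons h q, r, rfl⟩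

/-- Every vertex of a walk other than its endpoint is the first vertex of a dart of the walk. -/
theorem Walk.exists_mem_darts_fst_eq {u v y : V} (p : G.Walk u v) (hy : y ∈ p.support)
    (hne : y ≠ v) : ∃ d ∈ p.darts, d.fst = y := by
  induction p with
  | nil => simp_all
  | cons h p ih =>
    rw [Walk.support_cons, List.mem_cons] at hy
    rcases hy with rfl | hy
    · exact ⟨⟨(_, _), h⟩, by simp, rfl⟩
    · obtain ⟨d, hd, rfl⟩ := ih hy hne
      exact ⟨d, by simp [hd], rfl⟩

/-- Every vertex of a cycle is the first vertex of a dart of the cycle. -/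
theorem Walk.IsCycle.exists_mem_darts_fst_eq {v y : V} {C : G.Walk v v} (hC : C.IsCycle)
    (hy : y ∈ C.support) : ∃ d ∈ C.darts, d.fst = y := by
  by_cases h : y = v
  · subst h
    cases C with
    | nil => exact absurd rfl hC.ne_nil
    | cons h p => exact ⟨⟨(_, _), h⟩, by simp, rfl⟩
  · exact C.exists_mem_darts_fst_eq hy h

/-- Deleting a dart from a cycle leaves a path through the same vertices. -/
theorem Walk.IsCycle.exists_isPath_of_mem_darts {v : V} {C : G.Walk v v} (hC : C.IsCycle)
    {d : G.Dart} (hd : d ∈ C.darts) :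
    ∃ p : G.Walk d.snd d.fst, p.IsPath ∧ (∀ u, u ∈ p.support ↔ u ∈ C.support) ∧
      ∀ e ∈ C.darts, e = d ∨ e ∈ p.darts := by
  obtain ⟨q, r, rfl⟩ := C.exists_eq_append_cons_of_mem_darts hd
  refine ⟨r.append q, ?_, ?_, ?_⟩
  · have h := hC.support_nodup
    rw [Walk.tail_support_append, Walk.support_cons, List.tail_cons] at h
    rw [Walk.isPath_def, Walk.support_append]
    exact List.perm_append_comm.nodup_iff.mp h
  · intro u
    have hu : u = d.fst → u ∈ q.support := by rintro rfl; exact q.end_mem_support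
    simp only [Walk.mem_support_append_iff, Walk.support_cons, List.mem_cons]
    tauto
  · intro e he
    simp only [Walk.darts_append, Walk.darts_cons, List.mem_append, List.mem_cons] at he ⊢
    tauto

/-- A nontrivial path whose two ends are adjacent to a vertex off the path closes to a cycle
through that vertex. -/
theorem Walk.IsPath.exists_isCycle_insert {a b x : V} {p : G.Walk a b} (hp : p.IsPath)
    (hab : a ≠ b) (hx : x ∉ p.support) (ha : G.Adj x a) (hb : G.Adj x b) :
    ∃ (w : V) (C : G.Walk w w), C.IsCycle ∧
      {y | y ∈ C.support} = insert x {y | y ∈ p.support} := by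
  refine ⟨x, .cons ha (p.concat hb.symm), ?_, ?_⟩
  · rw [Walk.cons_isCycle_iff, Walk.concat_isPath_iff]
    refine ⟨⟨hp, hx⟩, fun h => ?_⟩
    rw [Walk.edges_concat, List.concat_eq_append, List.mem_append, List.mem_singleton] at h
    rcases h with h | h
    · exact hx (p.fst_mem_support_of_mem_edges h)
    · rw [Sym2.eq_swap, Sym2.eq_iff] at h
      grind [ha.ne, hb.ne]
  · ext y
    simp only [Walk.support_cons, Walk.support_concat, Set.mem_ofPred_eq, List.mem_cons,
      List.mem_append, List.not_mem_nil, Set.mem_insert_iff]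
    grind

/-- If no cycle has vertex set `V(C) ∪ {x}`, then `x` is not adjacent to the successor on `C` of
any of its neighbours. -/
theorem Walk.IsCycle.not_adj_snd {v x : V} {C : G.Walk v v} (hC : C.IsCycle)
    (hx : x ∉ C.support)
    (hno : ¬ ∃ (w : V) (C' : G.Walk w w), C'.IsCycle ∧
      {y | y ∈ C'.support} = insert x {y | y ∈ C.support})
    {d : G.Dart} (hd : d ∈ C.darts) (hxd : G.Adj x d.fst) : ¬ G.Adj x d.snd := by
  intro h
  obtain ⟨p, hp, hsupp, -⟩ := hC.exists_isPath_of_mem_darts hd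
  have := hp.exists_isCycle_insert d.adj.ne' (by rwa [hsupp]) h hxd
  simp only [hsupp] at this
  exact hno this

/-- If no cycle has vertex set `V(C) ∪ {x}`, then the successors on `C` of the neighbours of `x`
are pairwise nonadjacent. -/
theorem Walk.IsCycle.not_adj_snd_snd {v x : V} {C : G.Walk v v} (hC : C.IsCycle)
    (hx : x ∉ C.support)
    (hno : ¬ ∃ (w : V) (C' : G.Walk w w), C'.IsCycle ∧
      {y | y ∈ C'.support} = insert x {y | y ∈ C.support})
    {d e : G.Dart} (hd : d ∈ C.darts) (he : e ∈ C.darts) (hxd : G.Adj x d.fst)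
    (hxe : G.Adj x e.fst) : ¬ G.Adj d.snd e.snd := by
  intro h
  obtain ⟨p, hp, hsupp, hdarts⟩ := hC.exists_isPath_of_mem_darts hd
  obtain rfl | hep := hdarts e he
  · exact h.ne rfl
  obtain ⟨q, r, rfl⟩ := p.exists_eq_append_cons_of_mem_darts hep
  have hnd : (q.support ++ r.support).Nodup := by
    have := hp.support_nodup
    rwa [Walk.support_append, Walk.support_cons, List.tail_cons] at this
  have hpath : (q.reverse.append (.cons h r)).IsPath := by
    rw [Walk.isPath_def, Walk.support_append, Walk.support_cons, List.tail_cons,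
      Walk.support_reverse]
    exact ((List.reverse_perm _).append_right _).nodup_iff.mpr hnd
  have hs : ∀ u, u ∈ (q.reverse.append (.cons h r)).support ↔ u ∈ C.support := by
    intro u
    rw [← hsupp]
    simp [Walk.support_append]
  have hne : e.fst ≠ d.fst := fun h' =>
    (List.nodup_append.mp hnd).2.2 _ q.end_mem_support _ r.end_mem_support h'
  have := hpath.exists_isCycle_insert hne (by rwa [hs]) hxe hxd
  simp only [hs] at this
  exact hno this

end SimpleGraph

/-- Deleting the complement of an independent set leaves one component per vertex. -/
theorem numComp_compl_of_isIndepSet {V : Type*} {G : SimpleGraph V} {I : Set V}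
    (hI : G.IsIndepSet I) : numComp G Iᶜ = I.ncard := by
  rw [numComp, compl_compl, ← Nat.card_coe_set_eq]
  refine (Nat.card_eq_of_bijective (G.induce I).connectedComponentMk ⟨?_, Quot.mk_surjective⟩).symm
  intro a b hab
  have hbot : G.induce I = ⊥ := by
    ext a b
    simp only [comap_adj, Function.Embedding.subtype_apply, bot_adj, iff_false]
    exact fun h => hI a.2 b.2 h.ne h
  rw [ConnectedComponent.eq, hbot, reachable_bot] at hab
  exact hab

/-- In a `t`-tough graph on `n` vertices, an independent set with at least two vertices has at
most `n / (t + 1)` of them. -/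
theorem Tough.mul_card_le_of_isIndepSet {V : Type*} [Fintype V] [DecidableEq V] {t : ℝ}
    {G : SimpleGraph V} (h : Tough t G) {I : Finset V} (hI : G.IsIndepSet (I : Set V))
    (h2 : 2 ≤ I.card) : (t + 1) * I.card ≤ Fintype.card V := by
  have hc : numComp G ((Iᶜ : Finset V) : Set V) = I.card := by
    rw [Finset.coe_compl, numComp_compl_of_isIndepSet hI, Set.ncard_coe_finset]
  have hle := h Iᶜ (by rwa [hc])
  rw [hc] at hle
  have hsum : (I.card : ℝ) + (Iᶜ).card = Fintype.card V := by
    exact_mod_cast Finset.card_add_card_compl I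
  linarith

/-- **Cycle extension lemma.** Let `G` be a `t`-tough graph on `n` vertices and `C` a
non-hamiltonian cycle of `G`. If a vertex `x` off `C` has more than `n/(t+1) − 1`
neighbors on `C`, then `G` has a cycle `C'` with `V(C') = V(C) ∪ {x}`. -/
theorem stmt3 {V : Type*} [Fintype V] [DecidableEq V] (t : ℝ) (ht : 0 < t)
    (G : SimpleGraph V) (htough : Tough t G) (v : V) (C : G.Walk v v)
    (hC : C.IsCycle) (hnonham : ¬ C.IsHamiltonianCycle)
    (x : V) (hx : x ∉ C.support)
    (hdeg : (Fintype.card V : ℝ) / (t + 1) - 1 <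
      ((Nat.card {y : V | y ∈ C.support ∧ G.Adj x y} : ℕ) : ℝ)) :
    ∃ (w : V) (C' : G.Walk w w), C'.IsCycle ∧
      {y : V | y ∈ C'.support} = insert x {y : V | y ∈ C.support} := by
  classical
  by_contra hno
  rw [sub_lt_iff_lt_add, div_lt_iff₀ (by positivity)] at hdeg
  set N : Finset V := {y | y ∈ C.support ∧ G.Adj x y} with hN
  have hNcard : Nat.card {y : V | y ∈ C.support ∧ G.Adj x y} = N.card := by
    rw [← Set.ncard_coe_finset, ← Nat.card_coe_set_eq, hN]
    simp
  rw [hNcard] at hdeg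
  have hdart : ∀ y : N, ∃ d ∈ C.darts, d.fst = y := fun y =>
    hC.exists_mem_darts_fst_eq (Finset.mem_filter.mp y.2).2.1
  choose f hf hfst using hdart
  have hadj : ∀ y, G.Adj x (f y).fst := fun y => by
    rw [hfst]; exact (Finset.mem_filter.mp y.2).2.2
  have hmem : ∀ y, (f y).snd ∈ C.support := fun y => C.dart_snd_mem_support_of_mem_darts (hf y)
  have hinj : Function.Injective fun y => (f y).snd := by
    intro y z hyz
    have hnd : (C.darts.map (·.snd)).Nodup := by
      rw [Walk.map_snd_darts]; exact hC.support_nodup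
    have := List.inj_on_of_nodup_map hnd (hf y) (hf z) hyz
    exact Subtype.ext (by rw [← hfst y, ← hfst z, this])
  set A : Finset V := Finset.univ.image fun y => (f y).snd with hA
  have hAcard : A.card = N.card := by
    rw [hA, Finset.card_image_of_injective _ hinj, Finset.card_univ, Fintype.card_coe]
  have hxA : x ∉ A := by
    rw [hA, Finset.mem_image]
    rintro ⟨y, -, hy⟩
    exact hx (hy ▸ hmem y)
  rcases Nat.eq_zero_or_pos N.card with h0 | hpos
  · have hxv : ¬ G.Adj x v := fun h =>
      Finset.notMem_empty v (Finset.card_eq_zero.mp h0 ▸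
        Finset.mem_filter.mpr ⟨Finset.mem_univ v, C.start_mem_support, h⟩)
    have hne : x ≠ v := fun h => hx (h ▸ C.start_mem_support)
    have hI : G.IsIndepSet (({x, v} : Finset V) : Set V) := by
      rw [Finset.coe_pair, IsIndepSet, Set.pairwise_pair]
      exact fun _ => ⟨hxv, fun h => hxv h.symm⟩
    have hle := htough.mul_card_le_of_isIndepSet hI (Finset.card_pair hne).ge
    rw [Finset.card_pair hne] at hle
    rw [h0] at hdeg
    push_cast at hle hdeg
    linarith
  · have hI : G.IsIndepSet ((insert x A : Finset V) : Set V) := by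
      rw [Finset.coe_insert, IsIndepSet, Set.pairwise_insert]
      constructor
      · intro a ha b hb _
        obtain ⟨y, -, rfl⟩ := Finset.mem_image.mp ha
        obtain ⟨z, -, rfl⟩ := Finset.mem_image.mp hb
        exact hC.not_adj_snd_snd hx hno (hf y) (hf z) (hadj y) (hadj z)
      · intro a ha _
        obtain ⟨y, -, rfl⟩ := Finset.mem_image.mp ha
        have := hC.not_adj_snd hx hno (hf y) (hadj y)
        exact ⟨this, fun h => this h.symm⟩
    have hcard : (insert x A).card = N.card + 1 := by
      rw [Finset.card_insert_of_notMem hxA, hAcard]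
    have hle := htough.mul_card_le_of_isIndepSet hI (by omega)
    rw [hcard] at hle
    push_cast at hle
    linarith
end
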